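/- For all k ≥ 1, d ∈ ℕ and η, ε > 0 there exists a constant C > 0 such that: for every measurable A ⊆ ℝ^k with 0 < |A| < ∞ and |A+A| ≤ (2^{k+d+1}−ε)|A|, there exist a natural number d' ≤ d, a finite nonempty set X ⊆ ℝ^k, a d'-GAP P ⊆ ℝ^k and a parallelotope Q ⊆ ℝ^k with A ⊆ X+P+Q, #X ≤ C and #P·|Q| ≤ C|A|, such that, writing A_x := A ∩ (x+P+Q) for x ∈ X: (i) for all x, y ∈ X, |A_x+A_y| ≥ (|A_x|^{1/(k+d')} + |A_y|^{1/(k+d')})^{k+d'} − η·(#X)^{−2}·|A|; and (ii) for all x, y, z, w ∈ X, if (A_x+A_y) ∩ (A_z+A_w) ≠ ∅ then x+y = z+w. -/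

import Mathlib

open Set Pointwise MeasureTheory ENNReal

/-- `P ⊆ ℝ^k` is a `d`-dimensional generalized arithmetic progression:
`P = {∑ i, λ i • a i : 1 ≤ λ i ≤ ℓ i}`. -/
def IsGAPR (k d : ℕ) (P : Set (Fin k → ℝ)) : Prop :=
  ∃ (a : Fin d → (Fin k → ℝ)) (l : Fin d → ℕ), (∀ i, 1 ≤ l i) ∧
    P = (fun lam : Fin d → ℕ => ∑ i, (lam i : ℝ) • a i) ''
          {lam | ∀ i, 1 ≤ lam i ∧ lam i ≤ l i}

/-- `P ⊆ ℝ^k` is a proper `d`-GAP: the parametrisation is injective. -/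
def IsProperGAPR (k d : ℕ) (P : Set (Fin k → ℝ)) : Prop :=
  ∃ (a : Fin d → (Fin k → ℝ)) (l : Fin d → ℕ), (∀ i, 1 ≤ l i) ∧
    P = (fun lam : Fin d → ℕ => ∑ i, (lam i : ℝ) • a i) ''
          {lam | ∀ i, 1 ≤ lam i ∧ lam i ≤ l i} ∧
    Set.InjOn (fun lam : Fin d → ℕ => ∑ i, (lam i : ℝ) • a i)
      {lam | ∀ i, 1 ≤ lam i ∧ lam i ≤ l i}

/-- A parallelotope in `ℝ^k`: `{x₀ + ∑ i, λ i • v i : λ i ∈ [0,1]}`. -/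
def IsParallelotope (k : ℕ) (Q : Set (Fin k → ℝ)) : Prop :=
  ∃ (x₀ : Fin k → ℝ) (v : Fin k → (Fin k → ℝ)),
    Q = (fun lam : Fin k → ℝ => x₀ + ∑ i, lam i • v i) '' (Set.Icc 0 1)

/-- A homogeneous subadditive function on an abelian group all of whose balls are finite. -/
structure IsLatticeNorm {Λ : Type*} [AddCommGroup Λ] (N : Λ → ℝ) : Prop where
  add_le : ∀ x y, N (x + y) ≤ N x + N y
  zsmul : ∀ (m : ℤ) x, N (m • x) = |(m : ℝ)| * N x
  finite : ∀ R : ℝ, {x | N x ≤ R}.Finite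

namespace IsLatticeNorm

variable {Λ M : Type*} [AddCommGroup Λ] [AddCommGroup M] {N : Λ → ℝ}

lemma map_zero (hN : IsLatticeNorm N) : N 0 = 0 := by
  simpa using hN.zsmul 0 0

lemma map_neg (hN : IsLatticeNorm N) (x : Λ) : N (-x) = N x := by
  simpa using hN.zsmul (-1) x

lemma nonneg (hN : IsLatticeNorm N) (x : Λ) : 0 ≤ N x := by
  have h := hN.add_le x (-x)
  rw [add_neg_cancel, hN.map_zero, hN.map_neg] at h
  linarith

lemma nsmul (hN : IsLatticeNorm N) (m : ℕ) (x : Λ) : N (m • x) = m * N x := by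
  simpa using hN.zsmul m x

lemma pos (hN : IsLatticeNorm N) [Module.IsTorsionFree ℤ Λ] {x : Λ} (hx : x ≠ 0) : 0 < N x := by
  refine lt_of_le_of_ne (hN.nonneg x) fun h => ?_
  have hinj : Function.Injective fun m : ℤ => m • x := smul_left_injective ℤ hx
  refine Set.infinite_range_of_injective hinj ((hN.finite 0).subset ?_)
  rintro _ ⟨m, rfl⟩
  simp [hN.zsmul, ← h]

lemma sum_le (hN : IsLatticeNorm N) {ι : Type*} (s : Finset ι) (m : ι → ℤ) (b : ι → Λ) :
    N (∑ i ∈ s, m i • b i) ≤ ∑ i ∈ s, |(m i : ℝ)| * N (b i) := by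
  classical
  induction s using Finset.induction_on with
  | empty => simp [hN.map_zero]
  | insert i s hi ih =>
    rw [Finset.sum_insert hi, Finset.sum_insert hi, ← hN.zsmul]
    exact (hN.add_le _ _).trans (by gcongr)

/-- The homogeneous quotient norm: the infimum of `N x / q` over `x` lying above `q • y`. -/
noncomputable def quotient (N : Λ → ℝ) (π : Λ →+ M) (y : M) : ℝ :=
  sInf {r | ∃ (q : ℕ) (x : Λ), 0 < q ∧ π x = q • y ∧ r = N x / q}

lemma quotient_le (hN : IsLatticeNorm N) (π : Λ →+ M) {q : ℕ} (hq : 0 < q) {x : Λ} {y : M}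
    (h : π x = q • y) : quotient N π y ≤ N x / q := by
  refine csInf_le ⟨0, ?_⟩ ⟨q, x, hq, h, rfl⟩
  rintro _ ⟨q, x, -, -, rfl⟩
  have := hN.nonneg x
  positivity

lemma quotient_le_self (hN : IsLatticeNorm N) (π : Λ →+ M) (x : Λ) :
    quotient N π (π x) ≤ N x := by
  simpa using hN.quotient_le π one_pos (x := x) (y := π x) (by simp)

lemma exists_of_quotient_lt {π : Λ →+ M} (hπ : Function.Surjective π) {y : M} {r : ℝ}
    (h : quotient N π y < r) : ∃ (q : ℕ) (x : Λ), 0 < q ∧ π x = q • y ∧ N x / q < r := by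
  obtain ⟨x, hx⟩ := hπ y
  have hne : {r | ∃ (q : ℕ) (x : Λ), 0 < q ∧ π x = q • y ∧ r = N x / q}.Nonempty :=
    ⟨_, 1, x, one_pos, by simpa, rfl⟩
  obtain ⟨_, ⟨q, x, hq, hx, rfl⟩, hr⟩ := exists_lt_of_csInf_lt hne h
  exact ⟨q, x, hq, hx, hr⟩

/-- A rational multiple lying close to the fibre can be rounded to a lattice point. -/
lemma exists_add_zsmul_le (hN : IsLatticeNorm N) {π : Λ →+ M} {b : Λ}
    (hker : ∀ x, π x = 0 → ∃ m : ℤ, x = m • b) {q : ℕ} (hq : 0 < q) {x x' : Λ}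
    (h : π x' = q • π x) : ∃ m : ℤ, N (x + m • b) ≤ N x' / q + N b / 2 := by
  obtain ⟨p, hp⟩ := hker (x' - q • x) (by simp [h])
  have hq' : (0 : ℝ) < q := by exact_mod_cast hq
  refine ⟨round ((p : ℝ) / q), ?_⟩
  set m := round ((p : ℝ) / q)
  have h1 : q • (x + m • b) = x' + (q * m - p : ℤ) • b := by
    rw [sub_smul, ← hp, smul_add, mul_smul, natCast_zsmul]; abel
  have h2 : |((q * m - p : ℤ) : ℝ)| ≤ q / 2 := by
    have := abs_sub_round ((p : ℝ) / q)
    have h3 : ((q * m - p : ℤ) : ℝ) = -(q * ((p : ℝ) / q - m)) := by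
      push_cast; field_simp; ring
    rw [h3, abs_neg, abs_mul, abs_of_pos hq']
    calc (q : ℝ) * |(p : ℝ) / q - m| ≤ q * (1 / 2) := by gcongr
      _ = q / 2 := by ring
  have h4 : q * N (x + m • b) ≤ N x' + q / 2 * N b := by
    rw [← hN.nsmul, h1]
    refine (hN.add_le _ _).trans ?_
    rw [hN.zsmul]
    have := hN.nonneg b
    gcongr
  calc N (x + m • b) = q * N (x + m • b) / q := by field_simp
    _ ≤ (N x' + q / 2 * N b) / q := by gcongr
    _ = N x' / q + N b / 2 := by field_simp

lemma isLatticeNorm_quotient (hN : IsLatticeNorm N) {π : Λ →+ M} (hπ : Function.Surjective π)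
    {b : Λ} (hb : π b = 0) (hker : ∀ x, π x = 0 → ∃ m : ℤ, x = m • b) :
    IsLatticeNorm (quotient N π) := by
  have hnonneg : ∀ y, 0 ≤ quotient N π y := fun y => by
    apply Real.sInf_nonneg
    rintro _ ⟨q, x, -, -, rfl⟩
    have := hN.nonneg x
    positivity
  refine ⟨fun y z => ?_, fun m y => ?_, fun R => ?_⟩
  · refine le_of_forall_pos_lt_add fun ε hε => ?_
    obtain ⟨q, x, hq, hx, hxr⟩ := exists_of_quotient_lt hπ
      (lt_add_of_pos_right (quotient N π y) (half_pos hε))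
    obtain ⟨q', x', hq', hx', hxr'⟩ := exists_of_quotient_lt hπ
      (lt_add_of_pos_right (quotient N π z) (half_pos hε))
    have h1 := hN.quotient_le π (Nat.mul_pos hq hq') (x := q' • x + q • x') (y := y + z) (by
      simp only [map_add, map_nsmul, hx, hx', smul_add, mul_smul, smul_comm q' q])
    have h2 : N (q' • x + q • x') / ((q * q' : ℕ) : ℝ) ≤ N x / q + N x' / q' := by
      have h3 := hN.add_le (q' • x) (q • x')
      rw [hN.nsmul, hN.nsmul] at h3
      have a1 : (0 : ℝ) < q := by exact_mod_cast hq
      have a2 : (0 : ℝ) < q' := by exact_mod_cast hq'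
      rw [div_add_div _ _ a1.ne' a2.ne']
      push_cast
      gcongr
      linarith
    linarith
  · rcases eq_or_ne m 0 with rfl | hm
    · have := hN.quotient_le_self π 0
      rw [_root_.map_zero, hN.map_zero] at this
      simpa using le_antisymm this (hnonneg 0)
    have hm' : (0 : ℝ) < |(m : ℝ)| := by positivity
    apply le_antisymm
    · refine le_of_forall_pos_lt_add fun ε hε => ?_
      obtain ⟨q, x, hq, hx, hxr⟩ := exists_of_quotient_lt hπ
        (lt_add_of_pos_right (quotient N π y) (div_pos hε hm'))
      have h1 := hN.quotient_le π hq (x := m • x) (y := m • y) (by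
        rw [map_zsmul, hx, smul_comm])
      rw [hN.zsmul] at h1
      calc quotient N π (m • y) ≤ |(m : ℝ)| * (N x / q) := by rw [← mul_div_assoc]; exact h1
        _ < |(m : ℝ)| * (quotient N π y + ε / |(m : ℝ)|) := by gcongr
        _ = _ := by field_simp
    · refine le_of_forall_pos_lt_add fun ε hε => ?_
      obtain ⟨q, x, hq, hx, hxr⟩ := exists_of_quotient_lt hπ
        (lt_add_of_pos_right (quotient N π (m • y)) hε)
      have h1 := hN.quotient_le π (Nat.mul_pos hq (Int.natAbs_pos.2 hm)) (x := m.sign • x)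
        (y := y) (by
          rw [map_zsmul, hx, mul_smul, smul_comm, ← mul_smul, Int.sign_mul_self_eq_abs,
            ← Int.natCast_natAbs, natCast_zsmul])
      have h2 : N (m.sign • x) = N x := by
        rcases lt_or_gt_of_ne hm with h | h
        · simp [Int.sign_eq_neg_one_of_neg h, hN.map_neg]
        · simp [Int.sign_eq_one_of_pos h]
      have h3 : ((q * m.natAbs : ℕ) : ℝ) = q * |(m : ℝ)| := by
        push_cast; rw [Nat.cast_natAbs, Int.cast_abs]
      rw [h2, h3] at h1
      calc |(m : ℝ)| * quotient N π y ≤ |(m : ℝ)| * (N x / (q * |(m : ℝ)|)) := by gcongr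
        _ = N x / q := by
          have : (0 : ℝ) < q := by exact_mod_cast hq
          field_simp
        _ < _ := hxr
  · refine ((hN.finite (R + 1 + N b / 2)).image π).subset fun y hy => ?_
    obtain ⟨q, x, hq, hx, hxr⟩ := exists_of_quotient_lt (N := N) hπ
      (lt_of_le_of_lt hy (lt_add_one R))
    obtain ⟨z, rfl⟩ := hπ y
    obtain ⟨m, hm⟩ := hN.exists_add_zsmul_le hker hq hx
    exact ⟨z + m • b, show N (z + m • b) ≤ R + 1 + N b / 2 by linarith, by simp [hb]⟩

end IsLatticeNorm

open IsLatticeNorm in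
/-- A reduced basis of a quotient by a shortest vector lifts to a reduced basis. -/
lemma IsLatticeNorm.lift_reduced_basis {Λ M : Type*} [AddCommGroup Λ] [AddCommGroup M]
    [Module.IsTorsionFree ℤ Λ] {N : Λ → ℝ} (hN : IsLatticeNorm N) {π : Λ →+ M}
    (hπ : Function.Surjective π) {b₁ : Λ} (hb₁pos : 0 < N b₁) (hmin' : ∀ x, x ≠ 0 → N b₁ ≤ N x)
    (hb0 : π b₁ = 0) (hker : ∀ x, π x = 0 → ∃ m : ℤ, x = m • b₁) {r : ℕ} {C : ℝ} (hC1 : 1 ≤ C)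
    {c : Fin r → M} (hcpos : ∀ i, 0 < quotient N π (c i))
    (hcgen : ∀ x, ∃ m : Fin r → ℤ, x = ∑ i, m i • c i)
    (hcC : ∀ (m : Fin r → ℤ) (i : Fin r),
      |(m i : ℝ)| * quotient N π (c i) ≤ C * quotient N π (∑ j, m j • c j)) :
    ∃ b : Fin (r + 1) → Λ, (∀ i, 0 < N (b i)) ∧
      (∀ x, ∃ m : Fin (r + 1) → ℤ, x = ∑ i, m i • b i) ∧
      ∀ (m : Fin (r + 1) → ℤ) (i : Fin (r + 1)),
        |(m i : ℝ)| * N (b i) ≤ (1 + 4 * (r + 1) * C) * N (∑ j, m j • b j) := by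
  have hlift : ∀ i, ∃ β : Λ, π β = c i ∧ N β ≤ 4 * quotient N π (c i) := fun i => by
    obtain ⟨x, hx⟩ := hπ (c i)
    obtain ⟨q, x', hq, hx', hlt⟩ := exists_of_quotient_lt (N := N) (y := c i) hπ
      (r := 2 * quotient N π (c i)) (by linarith [hcpos i])
    obtain ⟨m, hm⟩ := hN.exists_add_zsmul_le hker hq (x := x) (x' := x') (by rw [hx', hx])
    have hπm : π (x + m • b₁) = c i := by simp [hb0, hx]
    refine ⟨x + m • b₁, hπm, ?_⟩
    have hne : x + m • b₁ ≠ 0 := fun h => by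
      rw [h, _root_.map_zero] at hπm
      have := hcpos i
      rw [← hπm, (hN.isLatticeNorm_quotient hπ hb0 hker).map_zero] at this
      exact lt_irrefl _ this
    linarith [hmin' _ hne]
  choose β hβ hβN using hlift
  have hcoef : ∀ (m : Fin (r + 1) → ℤ) (i : Fin r), |(m i.succ : ℝ)| * N (β i) ≤
      4 * C * N (∑ j, m j • (Fin.cons b₁ β : Fin (r + 1) → Λ) j) := fun m i => by
    set x := ∑ j, m j • (Fin.cons b₁ β : Fin (r + 1) → Λ) j with hx
    have hπx : π x = ∑ j : Fin r, m j.succ • c j := by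
      rw [hx, Fin.sum_univ_succ]
      simp [hb0, hβ]
    have h1 := hcC (fun j => m j.succ) i
    rw [← hπx] at h1
    calc |(m i.succ : ℝ)| * N (β i) ≤ |(m i.succ : ℝ)| * (4 * quotient N π (c i)) := by
          gcongr; exact hβN i
      _ = 4 * (|(m i.succ : ℝ)| * quotient N π (c i)) := by ring
      _ ≤ 4 * (C * quotient N π (π x)) := by gcongr
      _ ≤ 4 * (C * N x) := by gcongr; exact hN.quotient_le_self π x
      _ = _ := by ring
  refine ⟨Fin.cons b₁ β, fun i => ?_, fun x => ?_, fun m i => ?_⟩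
  · refine Fin.cases hb₁pos (fun i => ?_) i
    refine hN.pos fun h => ?_
    have h2 := hcpos i
    rw [← hβ i] at h2
    simp only [Fin.cons_succ] at h
    rw [h, _root_.map_zero, (hN.isLatticeNorm_quotient hπ hb0 hker).map_zero] at h2
    exact lt_irrefl _ h2
  · obtain ⟨m, hm⟩ := hcgen (π x)
    obtain ⟨p, hp⟩ := hker (x - ∑ i, m i • β i) (by simp [hm, hβ])
    refine ⟨Fin.cons p m, ?_⟩
    rw [Fin.sum_univ_succ]
    simp only [Fin.cons_zero, Fin.cons_succ]
    rw [← hp]; abel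
  · set x := ∑ j, m j • (Fin.cons b₁ β : Fin (r + 1) → Λ) j with hx
    have hx0 := hN.nonneg x
    refine Fin.cases ?_ (fun i => ?_) i
    · simp only [Fin.cons_zero]
      have h1 : m 0 • b₁ = x + ∑ j : Fin r, (-m j.succ) • β j := by
        rw [hx, Fin.sum_univ_succ]
        simp
      rw [← hN.zsmul, h1]
      calc N (x + ∑ j : Fin r, (-m j.succ) • β j)
          ≤ N x + ∑ j : Fin r, |((-m j.succ : ℤ) : ℝ)| * N (β j) :=
            (hN.add_le _ _).trans (by gcongr; exact hN.sum_le _ _ _)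
        _ ≤ N x + ∑ j : Fin r, 4 * C * N x := by
            refine add_le_add_right (Finset.sum_le_sum fun j _ => ?_) _
            rw [Int.cast_neg, abs_neg]
            exact hcoef m j
        _ = (1 + 4 * r * C) * N x := by simp; ring
        _ ≤ (1 + 4 * (r + 1) * C) * N x := by gcongr; linarith
    · simp only [Fin.cons_succ]
      refine (hcoef m i).trans ?_
      gcongr
      nlinarith [Nat.cast_nonneg (α := ℝ) r]

open IsLatticeNorm in
/-- Every lattice norm has a basis that is orthogonal up to a constant depending on the rank. -/
theorem exists_reduced_basis (r : ℕ) : ∃ C : ℝ, 1 ≤ C ∧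
    ∀ (Λ : Type) [AddCommGroup Λ] [Module.IsTorsionFree ℤ Λ] [Module.Finite ℤ Λ] (N : Λ → ℝ),
      IsLatticeNorm N → Module.finrank ℤ Λ = r →
      ∃ b : Fin r → Λ, (∀ i, 0 < N (b i)) ∧ (∀ x, ∃ m : Fin r → ℤ, x = ∑ i, m i • b i) ∧
        ∀ (m : Fin r → ℤ) (i : Fin r), |(m i : ℝ)| * N (b i) ≤ C * N (∑ j, m j • b j) := by
  induction r with
  | zero =>
    refine ⟨1, le_rfl, fun Λ _ _ _ N hN hr => ⟨Fin.elim0, fun i => i.elim0, fun x => ?_,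
      fun _ i => i.elim0⟩⟩
    have : Subsingleton Λ := Module.finrank_zero_iff.1 hr
    exact ⟨Fin.elim0, Subsingleton.elim _ _⟩
  | succ r ih =>
    obtain ⟨C, hC1, hC⟩ := ih
    refine ⟨1 + 4 * (r + 1) * C, by nlinarith, fun Λ _ _ _ N hN hr => ?_⟩
    have hnt : Nontrivial Λ := by
      by_contra h
      rw [not_nontrivial_iff_subsingleton] at h
      simp [Module.finrank_zero_of_subsingleton] at hr
    obtain ⟨x₀, hx₀⟩ := exists_ne (0 : Λ)
    obtain ⟨b₁, ⟨hb₁, -⟩, hmin⟩ := Set.exists_min_image {x | x ≠ 0 ∧ N x ≤ N x₀} N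
      ((hN.finite (N x₀)).subset fun x hx => hx.2) ⟨x₀, hx₀, le_rfl⟩
    have hmin' : ∀ x, x ≠ 0 → N b₁ ≤ N x := fun x hx => by
      rcases le_or_gt (N x) (N x₀) with h | h
      · exact hmin x ⟨hx, h⟩
      · exact (hmin x₀ ⟨hx₀, le_rfl⟩).trans h.le
    have hb₁pos := hN.pos hb₁
    let S : Submodule ℤ Λ := Submodule.span ℤ {b₁}
    let π : Λ →+ Λ ⧸ S := S.mkQ.toAddMonoidHom
    have hπ : Function.Surjective π := S.mkQ_surjective
    have hb0 : π b₁ = 0 := (Submodule.Quotient.mk_eq_zero S).2 (Submodule.mem_span_singleton_self b₁)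
    have hker : ∀ x, π x = 0 → ∃ m : ℤ, x = m • b₁ := fun x hx => by
      obtain ⟨m, hm⟩ := Submodule.mem_span_singleton.1 ((Submodule.Quotient.mk_eq_zero S).1 hx)
      exact ⟨m, hm.symm⟩
    have htf : Module.IsTorsionFree ℤ (Λ ⧸ S) := by
      refine Module.IsTorsionFree.of_smul_eq_zero fun q y hy => ?_
      by_contra! hcon
      obtain ⟨x, rfl⟩ := hπ y
      obtain ⟨m, hm⟩ := hN.exists_add_zsmul_le hker (q := q.natAbs) (Int.natAbs_pos.2 hcon.1)
        (x := x) (x' := 0) (by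
          rw [_root_.map_zero, ← natCast_zsmul, Int.natCast_natAbs]
          rcases abs_choice q with h | h <;> simp [h, hy])
      rw [hN.map_zero, zero_div, zero_add] at hm
      have : x + m • b₁ = 0 := by
        by_contra h
        linarith [hmin' _ h]
      apply hcon.2
      have h2 := congrArg π this
      simpa [hb0] using h2
    have hrank : Module.finrank ℤ (Λ ⧸ S) = r := by
      have h1 := S.finrank_quotient_add_finrank
      have h2 : Module.finrank ℤ S = 1 := by
        rw [← (LinearEquiv.toSpanNonzeroSingleton ℤ Λ b₁ hb₁).finrank_eq, Module.finrank_self]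
      omega
    obtain ⟨c, hcpos, hcgen, hcC⟩ := hC (Λ ⧸ S) (quotient N π)
      (hN.isLatticeNorm_quotient hπ hb0 hker) hrank
    exact hN.lift_reduced_basis hπ hb₁pos hmin' hb0 hker hC1 hcpos hcgen hcC

section Bogolyubov

variable {N : ℕ} [NeZero N]

/-- The exponential sum of a set of residues. -/
noncomputable def expSum (B : Finset (ZMod N)) (γ : ZMod N) : ℂ :=
  ∑ b ∈ B, ZMod.stdAddChar (γ * b)

lemma conj_stdAddChar (x : ZMod N) :
    (starRingEnd ℂ) (ZMod.stdAddChar x) = ZMod.stdAddChar (-x) :=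
  (AddChar.map_neg_eq_conj _ _).symm

lemma sum_stdAddChar_mul (y : ZMod N) :
    ∑ γ : ZMod N, (ZMod.stdAddChar (γ * y) : ℂ) = if y = 0 then (N : ℂ) else 0 := by
  have h := AddChar.sum_mulShift y (ZMod.isPrimitive_stdAddChar N)
  rw [h]; simp [ZMod.card]

lemma normSq_expSum (B : Finset (ZMod N)) (γ : ZMod N) :
    (Complex.normSq (expSum B γ) : ℂ) =
      ∑ b ∈ B, ∑ c ∈ B, ZMod.stdAddChar (γ * (b - c)) := by
  rw [← Complex.mul_conj, expSum, map_sum, Finset.sum_mul_sum]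
  refine Finset.sum_congr rfl fun b _ => Finset.sum_congr rfl fun c _ => ?_
  rw [conj_stdAddChar, ← AddChar.map_add_eq_mul]
  congr 1; ring

lemma sum_normSq_expSum (B : Finset (ZMod N)) :
    ∑ γ, Complex.normSq (expSum B γ) = N * B.card := by
  have h : ((∑ γ, Complex.normSq (expSum B γ) : ℝ) : ℂ) = ((N * B.card : ℝ) : ℂ) := by
    push_cast
    simp_rw [normSq_expSum]
    rw [Finset.sum_comm]
    simp_rw [Finset.sum_comm (s := Finset.univ), sum_stdAddChar_mul, sub_eq_zero]
    simp [Finset.sum_ite_eq, mul_comm]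
  exact_mod_cast h

lemma sum_normSq_sq_mul_eq_zero {B : Finset (ZMod N)} {t : ZMod N}
    (ht : ∀ a ∈ B, ∀ b ∈ B, ∀ c ∈ B, ∀ e ∈ B, t ≠ a + b - c - e) :
    ∑ γ, (Complex.normSq (expSum B γ) : ℂ) ^ 2 * ZMod.stdAddChar (γ * t) = 0 := by
  have h : ∀ γ, (Complex.normSq (expSum B γ) : ℂ) ^ 2 * ZMod.stdAddChar (γ * t) =
      ∑ b ∈ B, ∑ c ∈ B, ∑ b' ∈ B, ∑ c' ∈ B,
        ZMod.stdAddChar (γ * ((b - c) + (b' - c') + t)) := fun γ => by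
    rw [sq, normSq_expSum]
    simp only [Finset.sum_mul, Finset.mul_sum, mul_add, AddChar.map_add_eq_mul]
    refine Finset.sum_congr rfl fun _ _ => Finset.sum_congr rfl fun _ _ =>
      Finset.sum_congr rfl fun _ _ => Finset.sum_congr rfl fun _ _ => ?_
    ring
  simp_rw [h]
  rw [Finset.sum_comm]
  refine Finset.sum_eq_zero fun b hb => ?_
  rw [Finset.sum_comm]
  refine Finset.sum_eq_zero fun c hc => ?_
  rw [Finset.sum_comm]
  refine Finset.sum_eq_zero fun b' hb' => ?_
  rw [Finset.sum_comm]
  refine Finset.sum_eq_zero fun c' hc' => ?_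
  rw [sum_stdAddChar_mul, if_neg]
  intro h0
  exact ht c hc c' hc' b hb b' hb' (by linear_combination h0)

lemma re_stdAddChar_nonneg {y : ZMod N} {x : ℤ} (hx : (x : ZMod N) = y) (h : 4 * |x| ≤ N) :
    0 ≤ (ZMod.stdAddChar y : ℂ).re := by
  have hN : (0 : ℝ) < N := by exact_mod_cast Nat.pos_of_ne_zero (NeZero.ne N)
  rw [← hx, ZMod.stdAddChar_coe]
  have : (2 * Real.pi * Complex.I * x / N : ℂ) = ((2 * Real.pi * x / N : ℝ) : ℂ) * Complex.I := by
    push_cast; ring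
  rw [this, Complex.exp_ofReal_mul_I_re]
  have h' : 4 * |(x : ℝ)| ≤ N := by exact_mod_cast h
  have h1 : |2 * Real.pi * x / N| ≤ Real.pi / 2 := by
    rw [abs_div, abs_mul, abs_of_pos hN, abs_of_pos Real.two_pi_pos, div_le_iff₀ hN]
    nlinarith [Real.pi_pos]
  exact Real.cos_nonneg_of_mem_Icc (abs_le.1 h1)

/-- Bogolyubov's lemma in a cyclic group. -/
theorem exists_bohr_subset {B : Finset (ZMod N)} (hB : B.Nonempty) :
    ∃ Γ : Finset (ZMod N), (Γ.card : ℝ) * B.card ^ 2 ≤ 2 * N ^ 2 ∧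
      ∀ t : ZMod N, (∀ γ ∈ Γ, ∃ x : ℤ, (x : ZMod N) = γ * t ∧ 4 * |x| ≤ N) →
        ∃ a ∈ B, ∃ b ∈ B, ∃ c ∈ B, ∃ e ∈ B, t = a + b - c - e := by
  classical
  have hN : (0 : ℝ) < N := by exact_mod_cast Nat.pos_of_ne_zero (NeZero.ne N)
  have hβ : (0 : ℝ) < B.card := by exact_mod_cast hB.card_pos
  set β : ℝ := (B.card : ℝ) with hβdef
  let θ : ℝ := β ^ 3 / (2 * N)
  have hθ : 0 < θ := by positivity
  let Γ : Finset (ZMod N) := Finset.univ.filter fun γ => θ ≤ Complex.normSq (expSum B γ)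
  have hP := sum_normSq_expSum B
  refine ⟨Γ, ?_, fun t ht => ?_⟩
  · have h1 : Γ.card * θ ≤ N * β := by
      rw [← hP, ← nsmul_eq_mul, ← Finset.sum_const]
      refine (Finset.sum_le_sum (g := fun γ => Complex.normSq (expSum B γ)) fun γ hγ =>
        (Finset.mem_filter.1 hγ).2).trans ?_
      exact Finset.sum_le_sum_of_subset_of_nonneg (Finset.subset_univ _)
        fun _ _ _ => Complex.normSq_nonneg _
    have h2 : (Γ.card : ℝ) * (β ^ 3 / (2 * N)) * (2 * N) ≤ N * β * (2 * N) := by gcongr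
    have h3 : (Γ.card : ℝ) * (β ^ 3 / (2 * N)) * (2 * N) = Γ.card * β ^ 2 * β := by
      field_simp
    rw [h3] at h2
    exact le_of_mul_le_mul_right (by linarith) hβ
  · by_contra! hcon
    have h0 := congrArg Complex.re (sum_normSq_sq_mul_eq_zero hcon)
    rw [Complex.re_sum, Complex.zero_re] at h0
    have hre : ∀ γ, ((Complex.normSq (expSum B γ) : ℂ) ^ 2 * ZMod.stdAddChar (γ * t)).re =
        Complex.normSq (expSum B γ) ^ 2 * (ZMod.stdAddChar (γ * t) : ℂ).re := fun γ => by
      rw [← Complex.ofReal_pow, Complex.re_ofReal_mul]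
    simp_rw [hre] at h0
    have hF0 : Complex.normSq (expSum B 0) = β ^ 2 := by
      simp [expSum, Complex.normSq_natCast, hβdef, sq]
    rw [← Finset.add_sum_erase _ _ (Finset.mem_univ (0 : ZMod N)), hF0] at h0
    have hle : ∀ γ, -(θ * Complex.normSq (expSum B γ)) ≤
        Complex.normSq (expSum B γ) ^ 2 * (ZMod.stdAddChar (γ * t) : ℂ).re := fun γ => by
      have hnn := Complex.normSq_nonneg (expSum B γ)
      by_cases hγ : γ ∈ Γ
      · obtain ⟨x, hx, hx4⟩ := ht γ hγ
        have := re_stdAddChar_nonneg hx hx4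
        have h1 : 0 ≤ θ * Complex.normSq (expSum B γ) := by positivity
        have h2 : 0 ≤ Complex.normSq (expSum B γ) ^ 2 * (ZMod.stdAddChar (γ * t) : ℂ).re := by
          positivity
        linarith
      · have hlt : Complex.normSq (expSum B γ) < θ := by
          simpa [Γ] using hγ
        have h1 : -1 ≤ (ZMod.stdAddChar (γ * t) : ℂ).re := by
          have := Complex.abs_re_le_norm (ZMod.stdAddChar (γ * t) : ℂ)
          rw [AddChar.norm_apply] at this
          exact (abs_le.1 this).1
        nlinarith [mul_nonneg hnn (sub_nonneg.2 hlt.le), sq_nonneg (Complex.normSq (expSum B γ))]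
    have hsum : -(θ * (N * β)) ≤ ∑ γ ∈ Finset.univ.erase 0,
        Complex.normSq (expSum B γ) ^ 2 * (ZMod.stdAddChar (γ * t) : ℂ).re := by
      calc -(θ * (N * β)) ≤ ∑ γ ∈ Finset.univ.erase 0, -(θ * Complex.normSq (expSum B γ)) := by
            rw [Finset.sum_neg_distrib, ← Finset.mul_sum, ← hP]
            gcongr
            · exact fun _ _ _ => Complex.normSq_nonneg _
            · exact Finset.erase_subset _ _
        _ ≤ _ := Finset.sum_le_sum fun γ _ => hle γ
    have h1 : θ * (N * β) = β ^ 4 / 2 := by simp only [θ]; field_simp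
    rw [h1] at hsum
    simp only [zero_mul, AddChar.map_zero_eq_one, Complex.one_re, mul_one] at h0
    have : 0 < β ^ 4 := by positivity
    nlinarith

end Bogolyubov

/-- A large part of a finite set embeds into an interval modulo a prime so that no nonzero element
of a prescribed finite set becomes a small multiple of `N`. -/
lemma exists_ruzsa_model {G : Type*} [AddCommGroup G] [DecidableEq G]
    (hG : ∀ T : Finset G, 0 ∉ T → ∃ f : G →+ ℤ, ∀ t ∈ T, f t ≠ 0)
    (A T : Finset G) {N : ℕ} (hN : 0 < N) (hTN : 2 * T.card ≤ N) :
    ∃ (A' : Finset G) (p : ℕ) (φ : G →+ ZMod p) (F : G → ℤ), A' ⊆ A ∧ A.card ≤ 16 * A'.card ∧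
      (∀ a ∈ A', (F a : ZMod p) = φ a) ∧ (∀ a ∈ A', ∀ b ∈ A', 16 * |F a - F b| < p) ∧
      ∀ t ∈ T, t ≠ 0 → ∀ z : ℤ, 2 * |z| < p → (z : ZMod p) = φ t → ¬ (N : ℤ) ∣ z := by
  obtain ⟨f, hf⟩ := hG (T.erase 0) (by simp)
  obtain ⟨p, hp, hprime⟩ := Nat.exists_infinite_primes
    (2 * T.card + 1 + ∑ t ∈ T, (f t).natAbs)
  have : Fact p.Prime := ⟨hprime⟩
  have hft : ∀ t ∈ T, t ≠ 0 → ((f t : ℤ) : ZMod p) ≠ 0 := fun t ht h0 h => by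
    rw [ZMod.intCast_zmod_eq_zero_iff_dvd] at h
    have h1 := Int.le_of_dvd (by have := hf t (by simp [ht, h0]); positivity)
      ((dvd_abs _ _).2 h)
    have h2 : (f t).natAbs ≤ ∑ t ∈ T, (f t).natAbs :=
      Finset.single_le_sum (f := fun t => (f t).natAbs) (fun _ _ => Nat.zero_le _) ht
    rw [Int.abs_eq_natAbs] at h1
    omega
  let J : ℕ := p / (2 * N)
  have hJ : 2 * N * J ≤ p := Nat.mul_div_le p (2 * N)
  let bad : Finset (ZMod p) := (T ×ˢ Finset.Icc (-(J : ℤ)) J).image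
    fun u => ((u.2 * N : ℤ) : ZMod p) * ((f u.1 : ℤ) : ZMod p)⁻¹
  have hbad : bad.card < Fintype.card (ZMod p) := by
    rw [ZMod.card]
    refine Finset.card_image_le.trans_lt ?_
    rw [Finset.card_product, Int.card_Icc]
    have h1 : ((J : ℤ) + 1 - -(J : ℤ)).toNat = 2 * J + 1 := by omega
    rw [h1]
    have h2 : 2 * T.card * (2 * J) ≤ N * (2 * J) := Nat.mul_le_mul_right _ hTN
    have h3 : 2 * T.card + 1 ≤ p := by omega
    nlinarith
  obtain ⟨q, hq⟩ : ∃ q, q ∉ bad := by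
    by_contra! h
    rw [Finset.eq_univ_of_forall h, Finset.card_univ] at hbad
    exact lt_irrefl _ hbad
  let φ : G →+ ZMod p := (AddMonoidHom.mulLeft q).comp ((Int.castAddHom (ZMod p)).comp f)
  have hφ : ∀ x, φ x = q * ((f x : ℤ) : ZMod p) := fun x => rfl
  have hp0 : 0 < p := hprime.pos
  obtain ⟨j, hj, hcard⟩ := Finset.exists_le_card_fiber_of_nsmul_le_card_of_maps_to
    (s := A) (t := Finset.range 16) (f := fun a => 16 * (φ a).val / p)
    (b := (A.card / 16 : ℚ)) (fun a _ => by
      rw [Finset.mem_range, Nat.div_lt_iff_lt_mul hp0]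
      have := ZMod.val_lt (φ a)
      omega) ⟨0, by simp⟩ (by simp only [Finset.card_range, nsmul_eq_mul]; push_cast; linarith)
  have hcard' : A.card ≤ 16 * (A.filter fun a => 16 * (φ a).val / p = j).card := by
    rw [div_le_iff₀ (by norm_num)] at hcard
    rw [mul_comm]
    exact_mod_cast hcard
  refine ⟨A.filter fun a => 16 * (φ a).val / p = j, p, φ, fun a => ((φ a).val : ℤ),
    Finset.filter_subset _ _, hcard', fun a _ => by simp, fun a ha b hb => ?_,
    fun t ht h0 z hz hzt hNz => ?_⟩
  · have h1 := (Finset.mem_filter.1 ha).2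
    have h2 := (Finset.mem_filter.1 hb).2
    have h3 := Nat.div_mul_le_self (16 * (φ a).val) p
    have h4 := Nat.div_mul_le_self (16 * (φ b).val) p
    have h5 := Nat.lt_div_mul_add hp0 (a := 16 * (φ a).val)
    have h6 := Nat.lt_div_mul_add hp0 (a := 16 * (φ b).val)
    rw [h1] at h3 h5
    rw [h2] at h4 h6
    have h7 : (16 : ℤ) * |((φ a).val : ℤ) - (φ b).val| = |16 * ((φ a).val : ℤ) - 16 * (φ b).val| := by
      rw [← mul_sub, abs_mul]; rfl
    rw [h7, abs_lt]
    constructor <;> zify at h3 h4 h5 h6 <;> linarith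
  · obtain ⟨i, rfl⟩ := hNz
    apply hq
    refine Finset.mem_image.2 ⟨(t, i), Finset.mem_product.2 ⟨ht, ?_⟩, ?_⟩
    · rw [Finset.mem_Icc, ← abs_le]
      rw [abs_mul, Nat.abs_cast] at hz
      have : |i| * (2 * N : ℕ) ≤ p := by push_cast; linarith
      rw [Int.abs_eq_natAbs] at this ⊢
      have h3 : i.natAbs ≤ J := (Nat.le_div_iff_mul_le (by omega)).2 (by exact_mod_cast this)
      exact_mod_cast h3
    · rw [hφ] at hzt
      have := hft t ht h0
      simp only
      rw [mul_comm i, hzt, mul_assoc, mul_inv_cancel₀ this, mul_one]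

/-- A finite set of small doubling carries an injective local homomorphism from a Bohr set of
bounded rank in a cyclic group of comparable order. -/
lemma exists_bohr_hom {G : Type*} [AddCommGroup G] [DecidableEq G]
    (hG : ∀ T : Finset G, 0 ∉ T → ∃ f : G →+ ℤ, ∀ t ∈ T, f t ≠ 0)
    {A : Finset G} (hA : A.Nonempty) {K : ℝ} (hAK : ((A + A).card : ℝ) ≤ K * A.card) :
    ∃ (N : ℕ) (Γ : Finset (ZMod N)) (s : ZMod N → G), 0 < N ∧ A.card ≤ N ∧
      (N : ℝ) ≤ 2 * K ^ 12 * A.card ∧ (Γ.card : ℝ) ≤ 2 * (32 * K ^ 12) ^ 2 ∧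
      (∀ t, (∀ γ ∈ Γ, ∃ x : ℤ, (x : ZMod N) = γ * t ∧ 4 * |x| ≤ N) → s t ∈ 2 • A - 2 • A) ∧
      (∀ t t', (∀ γ ∈ Γ, ∃ x : ℤ, (x : ZMod N) = γ * t ∧ 4 * |x| ≤ N) →
        (∀ γ ∈ Γ, ∃ x : ℤ, (x : ZMod N) = γ * t' ∧ 4 * |x| ≤ N) →
        (∀ γ ∈ Γ, ∃ x : ℤ, (x : ZMod N) = γ * (t + t') ∧ 4 * |x| ≤ N) →
        s (t + t') = s t + s t') ∧
      (∀ t t', (∀ γ ∈ Γ, ∃ x : ℤ, (x : ZMod N) = γ * t ∧ 4 * |x| ≤ N) →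
        (∀ γ ∈ Γ, ∃ x : ℤ, (x : ZMod N) = γ * t' ∧ 4 * |x| ≤ N) → s t = s t' → t = t') := by
  classical
  obtain ⟨T, hT⟩ : ∃ T : Finset G, T = 6 • A - 6 • A := ⟨_, rfl⟩
  have hmem6 : ∀ a₁ ∈ A, ∀ a₂ ∈ A, ∀ a₃ ∈ A, ∀ a₄ ∈ A, ∀ a₅ ∈ A, ∀ a₆ ∈ A,
      a₁ + a₂ + a₃ + a₄ + a₅ + a₆ ∈ 6 • A := fun a₁ h₁ a₂ h₂ a₃ h₃ a₄ h₄ a₅ h₅ a₆ h₆ => by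
    simp only [succ_nsmul, zero_nsmul, zero_add]
    exact Finset.add_mem_add (Finset.add_mem_add (Finset.add_mem_add (Finset.add_mem_add
      (Finset.add_mem_add h₁ h₂) h₃) h₄) h₅) h₆
  have hAcard : (0 : ℝ) < A.card := by exact_mod_cast hA.card_pos
  obtain ⟨a₀, ha₀⟩ := hA
  have hdiff : ∀ a ∈ A, ∀ b ∈ A, a - b ∈ T := fun a ha b hb => by
    rw [hT]
    have := Finset.sub_mem_sub (hmem6 a ha a₀ ha₀ a₀ ha₀ a₀ ha₀ a₀ ha₀ a₀ ha₀)
      (hmem6 b hb a₀ ha₀ a₀ ha₀ a₀ ha₀ a₀ ha₀ a₀ ha₀)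
    simpa using this
  have hAT : A.card ≤ T.card := by
    refine Finset.card_le_card_of_injOn (fun a => a - a₀) (fun a ha => hdiff a ha a₀ ha₀) ?_
    intro a _ b _ h
    simpa using h
  have hTK : (T.card : ℝ) ≤ K ^ 12 * A.card := by
    have h1 := Finset.pluennecke_ruzsa_inequality_nsmul_sub_nsmul_add (A := A) ⟨a₀, ha₀⟩ A 6 6
    rw [← hT] at h1
    have h2 : (T.card : ℝ) ≤ ((A + A).card / A.card : ℝ) ^ 12 * A.card := by
      have := (NNRat.cast_le (K := ℝ)).2 h1
      push_cast at this
      exact_mod_cast this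
    refine h2.trans ?_
    gcongr
    rwa [div_le_iff₀ hAcard]
  have hTpos : 0 < T.card := lt_of_lt_of_le (by exact_mod_cast hAcard) hAT
  obtain ⟨N, hNdef⟩ : ∃ N : ℕ, N = 2 * T.card := ⟨_, rfl⟩
  have hN : 0 < N := by omega
  have : NeZero N := ⟨hN.ne'⟩
  obtain ⟨A', p, φ, F, hA'A, hA'card, hFφ, hFp, hno⟩ := exists_ruzsa_model hG A T hN hNdef.ge
  have hFinj : Set.InjOn (fun a => (F a : ZMod N)) A' := fun a ha b hb hab => by
    by_contra hne
    refine hno (a - b) (hdiff a (hA'A ha) b (hA'A hb)) (sub_ne_zero.2 hne) (F a - F b) ?_ ?_ ?_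
    · have := hFp a ha b hb
      have := abs_nonneg (F a - F b)
      linarith
    · simp [hFφ a ha, hFφ b hb]
    · rw [← ZMod.intCast_zmod_eq_zero_iff_dvd]
      simpa [sub_eq_zero] using hab
  let B : Finset (ZMod N) := A'.image fun a => (F a : ZMod N)
  have hBcard : B.card = A'.card := Finset.card_image_of_injOn hFinj
  have hA'0 : (0 : ℝ) < A'.card := by
    have : 0 < A.card := by exact_mod_cast hAcard
    exact_mod_cast (by omega : 0 < A'.card)
  have hBne : B.Nonempty := by
    rw [← Finset.card_pos, hBcard]
    exact_mod_cast hA'0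
  obtain ⟨Γ, hΓcard, hΓ⟩ := exists_bohr_subset hBne
  have hNK : (N : ℝ) ≤ 2 * K ^ 12 * A.card := by
    rw [hNdef]; push_cast; linarith
  have hkey : ∀ t, ∃ s : G, (∀ γ ∈ Γ, ∃ x : ℤ, (x : ZMod N) = γ * t ∧ 4 * |x| ≤ N) →
      ∃ z : ℤ, (z : ZMod N) = t ∧ (z : ZMod p) = φ s ∧ 8 * |z| < p ∧
        ∃ a ∈ A, ∃ b ∈ A, ∃ c ∈ A, ∃ e ∈ A, s = a + b - c - e := fun t => by
    by_cases ht : ∀ γ ∈ Γ, ∃ x : ℤ, (x : ZMod N) = γ * t ∧ 4 * |x| ≤ N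
    · obtain ⟨a', ha', b', hb', c', hc', e', he', h⟩ := hΓ t ht
      obtain ⟨a, ha, rfl⟩ := Finset.mem_image.1 ha'
      obtain ⟨b, hb, rfl⟩ := Finset.mem_image.1 hb'
      obtain ⟨c, hc, rfl⟩ := Finset.mem_image.1 hc'
      obtain ⟨e, he, rfl⟩ := Finset.mem_image.1 he'
      refine ⟨a + b - c - e, fun _ => ⟨F a + F b - F c - F e, ?_, ?_, ?_, a, hA'A ha, b, hA'A hb,
        c, hA'A hc, e, hA'A he, rfl⟩⟩
      · rw [h]; push_cast; ring
      · simp [hFφ a ha, hFφ b hb, hFφ c hc, hFφ e he]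
      · have h1 := hFp a ha c hc
        have h2 := hFp b hb e he
        have h3 := abs_add_le (F a - F c) (F b - F e)
        rw [show F a + F b - F c - F e = (F a - F c) + (F b - F e) by ring]
        linarith
    · exact ⟨0, fun h => absurd h ht⟩
  choose s hs using hkey
  refine ⟨N, Γ, s, hN, by omega, hNK, ?_, fun t ht => ?_, fun t t' ht ht' ht'' => ?_,
    fun t t' ht ht' h => ?_⟩
  · have h1 : (N : ℝ) ≤ 32 * K ^ 12 * A'.card := by
      have : (A.card : ℝ) ≤ 16 * A'.card := by exact_mod_cast hA'card
      calc (N : ℝ) ≤ 2 * K ^ 12 * A.card := hNK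
        _ ≤ 2 * K ^ 12 * (16 * A'.card) := by gcongr
        _ = _ := by ring
    rw [hBcard] at hΓcard
    have h2 : (Γ.card : ℝ) * A'.card ^ 2 ≤ 2 * (32 * K ^ 12) ^ 2 * A'.card ^ 2 := by
      calc _ ≤ 2 * (N : ℝ) ^ 2 := hΓcard
        _ ≤ 2 * (32 * K ^ 12 * A'.card) ^ 2 := by gcongr
        _ = _ := by ring
    exact le_of_mul_le_mul_right h2 (by positivity)
  · obtain ⟨z, -, -, -, a, ha, b, hb, c, hc, e, he, h⟩ := hs t ht
    rw [h, two_nsmul, sub_sub]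
    exact Finset.sub_mem_sub (Finset.add_mem_add ha hb) (Finset.add_mem_add hc he)
  · obtain ⟨z, hz, hzφ, hzp, a, ha, b, hb, c, hc, e, he, h⟩ := hs t ht
    obtain ⟨z', hz', hzφ', hzp', a', ha', b', hb', c', hc', e', he', h'⟩ := hs t' ht'
    obtain ⟨z'', hz'', hzφ'', hzp'', a'', ha'', b'', hb'', c'', hc'', e'', he'', h''⟩ :=
      hs (t + t') ht''
    by_contra hne
    refine hno (s t + s t' - s (t + t')) ?_ (fun h0 => hne (sub_eq_zero.1 h0).symm)
      (z + z' - z'') ?_ ?_ ?_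
    · have := Finset.sub_mem_sub (hmem6 a ha b hb a' ha' b' hb' c'' hc'' e'' he'')
        (hmem6 c hc e he c' hc' e' he' a'' ha'' b'' hb'')
      rw [h, h', h'', hT]
      convert this using 1
      abel
    · have h1 := abs_sub (z + z') z''
      have h2 := abs_add_le z z'
      have := abs_nonneg z
      linarith
    · simp [hzφ, hzφ', hzφ'']
    · rw [← ZMod.intCast_zmod_eq_zero_iff_dvd]
      simp [hz, hz', hz'']
  · obtain ⟨z, hz, hzφ, hzp, -⟩ := hs t ht
    obtain ⟨z', hz', hzφ', hzp', -⟩ := hs t' ht'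
    have h1 : ((z - z' : ℤ) : ZMod p) = 0 := by simp [hzφ, hzφ', h]
    rw [ZMod.intCast_zmod_eq_zero_iff_dvd] at h1
    have h2 : z - z' = 0 := by
      refine Int.eq_zero_of_abs_lt_dvd h1 ?_
      have := abs_sub z z'
      have := abs_nonneg z
      linarith [abs_nonneg z']
    rw [← hz, ← hz', sub_eq_zero.1 h2]

/-- A local homomorphism on the ball of radius `R` is additive on combinations staying inside the
ball term by term. -/
lemma IsLatticeNorm.local_hom_sum {Λ G : Type*} [AddCommGroup Λ] [AddCommGroup G] {ν : Λ → ℝ}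
    (hν : IsLatticeNorm ν) {σ : Λ → G} {R : ℝ} (hR : 0 ≤ R)
    (hσ : ∀ x y, ν x ≤ R → ν y ≤ R → ν (x + y) ≤ R → σ (x + y) = σ x + σ y)
    {ι : Type*} (t : Finset ι) (b : ι → Λ) (m : ι → ℤ)
    (hm : ∑ i ∈ t, |(m i : ℝ)| * ν (b i) ≤ R) :
    σ (∑ i ∈ t, m i • b i) = ∑ i ∈ t, m i • σ (b i) := by
  classical
  have h0 : σ 0 = 0 := by
    have := hσ 0 0 (by rwa [hν.map_zero]) (by rwa [hν.map_zero]) (by rwa [add_zero, hν.map_zero])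
    rw [add_zero] at this
    simpa using this
  have hneg : ∀ x, ν x ≤ R → σ (-x) = - σ x := fun x hx => by
    have := hσ x (-x) hx (by rwa [hν.map_neg]) (by rwa [add_neg_cancel, hν.map_zero])
    rw [add_neg_cancel, h0] at this
    exact eq_neg_of_add_eq_zero_right this.symm
  have hnat : ∀ (n : ℕ) x, n * ν x ≤ R → σ ((n : ℤ) • x) = (n : ℤ) • σ x := by
    intro n x
    induction n with
    | zero => intro; simp [h0]
    | succ n ih =>
      intro h
      have hx := hν.nonneg x
      have hnx : 0 ≤ (n : ℝ) * ν x := by positivity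
      push_cast at h ⊢
      rw [add_zsmul, one_zsmul, hσ, ih (by nlinarith), add_zsmul, one_zsmul]
      · rw [hν.zsmul]; simp; nlinarith
      · nlinarith
      · have h1 := hν.add_le ((n : ℤ) • x) x
        rw [hν.zsmul, Int.cast_natCast, Nat.abs_cast] at h1
        linarith
  have hmul : ∀ (n : ℤ) x, |(n : ℝ)| * ν x ≤ R → σ (n • x) = n • σ x := by
    intro n x h
    obtain ⟨k, rfl | rfl⟩ := n.eq_nat_or_neg
    · exact hnat k x (by simpa using h)
    · have h' : (k : ℝ) * ν x ≤ R := by simpa using h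
      rw [neg_smul, neg_smul, hneg, hnat k x h']
      rw [hν.zsmul]; simpa using h'
  induction t using Finset.induction_on with
  | empty => simp [h0]
  | insert i t hi ih =>
    rw [Finset.sum_insert hi] at hm
    have h1 : 0 ≤ |(m i : ℝ)| * ν (b i) := mul_nonneg (abs_nonneg _) (hν.nonneg _)
    have h2 : ν (∑ i ∈ t, m i • b i) ≤ ∑ i ∈ t, |(m i : ℝ)| * ν (b i) := hν.sum_le t m b
    have h3 := hν.nonneg (∑ i ∈ t, m i • b i)
    rw [Finset.sum_insert hi, Finset.sum_insert hi, hσ, ih (by linarith), hmul _ _ (by linarith)]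
    · rw [hν.zsmul]; linarith
    · linarith
    · refine (hν.add_le _ _).trans ?_
      rw [hν.zsmul]; linarith

/-- The lattice of integer points representing the orbit of `(γ)_{γ ∈ Γ}` modulo `N`. -/
def bohrLattice {N : ℕ} (Γ : Finset (ZMod N)) : Submodule ℤ (Γ → ℤ) where
  carrier := {x | ∃ t : ZMod N, ∀ γ, (x γ : ZMod N) = γ * t}
  add_mem' := by
    rintro x y ⟨t, ht⟩ ⟨u, hu⟩
    exact ⟨t + u, fun γ => by simp [ht, hu, mul_add]⟩
  zero_mem' := ⟨0, by simp⟩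
  smul_mem' := by
    rintro n x ⟨t, ht⟩
    exact ⟨n * t, fun γ => by simp [ht]; ring⟩

lemma isLatticeNorm_bohrLattice {N : ℕ} (Γ : Finset (ZMod N)) :
    IsLatticeNorm fun x : bohrLattice Γ => ‖(x : Γ → ℤ)‖ where
  add_le x y := norm_add_le _ _
  zsmul n x := by
    rw [Submodule.coe_smul, norm_smul, Int.norm_eq_abs]
  finite R := by
    have : ({x : Γ → ℤ | ‖x‖ ≤ R}).Finite := by
      have := (isCompact_closedBall (0 : Γ → ℤ) R).finite_of_discrete
      refine this.subset fun x hx => ?_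
      simpa using hx
    exact Set.Finite.of_finite_image (f := Subtype.val)
      (this.subset (by rintro _ ⟨x, hx, rfl⟩; exact hx)) Subtype.val_injective.injOn

theorem exists_gap_of_bohr_hom (D : ℕ) : ∃ M : ℕ, 0 < M ∧
    ∀ {G : Type} [AddCommGroup G] {N : ℕ} [NeZero N] (Γ : Finset (ZMod N)) (s : ZMod N → G),
      Γ.card ≤ D → (1 : ZMod N) ∈ Γ →
      (∀ t t', (∀ γ ∈ Γ, ∃ x : ℤ, (x : ZMod N) = γ * t ∧ 4 * |x| ≤ N) →
        (∀ γ ∈ Γ, ∃ x : ℤ, (x : ZMod N) = γ * t' ∧ 4 * |x| ≤ N) →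
        (∀ γ ∈ Γ, ∃ x : ℤ, (x : ZMod N) = γ * (t + t') ∧ 4 * |x| ≤ N) →
        s (t + t') = s t + s t') →
      ∃ (r : ℕ) (a : Fin r → G) (l : Fin r → ℕ) (W : Finset (ZMod N)), r ≤ D ∧
        N ≤ M * W.card ∧ ∏ i, (2 * l i + 1) ≤ N ∧
        (∀ w ∈ W, ∀ γ ∈ Γ, ∃ x : ℤ, (x : ZMod N) = γ * w ∧ 4 * |x| ≤ N) ∧
        ∀ w ∈ W, ∀ w' ∈ W, ∃ m : Fin r → ℤ, (∀ i, |m i| ≤ l i) ∧ s w - s w' = ∑ i, m i • a i := by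
  choose Cr hCr1 hCr using exists_reduced_basis
  obtain ⟨C, hC⟩ : ∃ C : ℝ, ∀ r ≤ D, Cr r ≤ C := by
    refine ⟨∑ r ∈ Finset.range (D + 1), Cr r, fun r hr => ?_⟩
    exact Finset.single_le_sum (f := Cr) (fun i _ => zero_le_one.trans (hCr1 i))
      (Finset.mem_range.2 (by omega))
  have hC1 : 1 ≤ C := (hCr1 0).trans (hC 0 (Nat.zero_le _))
  obtain ⟨M₀, hM₀⟩ := exists_nat_ge (8 * (D + 1) * C)
  have hM₀8 : 8 ≤ M₀ := by
    have : (8 : ℝ) ≤ M₀ := by nlinarith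
    exact_mod_cast this
  refine ⟨M₀ ^ D, by positivity, ?_⟩
  intro G _ N _ Γ s hΓD h1Γ hs
  have hN0 : 0 < N := NeZero.pos N
  have hNR : (0 : ℝ) < N := by exact_mod_cast hN0
  have hν := isLatticeNorm_bohrLattice Γ
  obtain ⟨r, hr⟩ : ∃ r, r = Module.finrank ℤ (bohrLattice Γ) := ⟨_, rfl⟩
  have hrD : r ≤ D := by
    rw [hr]
    refine (Submodule.finrank_le _).trans ?_
    simpa using hΓD
  obtain ⟨b, hb0, hbspan, hbC⟩ := hCr r (bohrLattice Γ) _ hν hr.symm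
  have hone : ∀ x : bohrLattice Γ, ∀ γ : Γ,
      ((x : Γ → ℤ) γ : ZMod N) = γ * (((x : Γ → ℤ) ⟨1, h1Γ⟩ : ℤ) : ZMod N) := fun x γ => by
    obtain ⟨t, ht⟩ := x.2
    rw [ht, ht]; simp
  have hcoord : ∀ (x : Γ → ℤ) γ, (|x γ| : ℝ) ≤ ‖x‖ := fun x γ => by
    rw [← Int.norm_eq_abs]; exact norm_le_pi_norm x γ
  let σ : bohrLattice Γ → G := fun x => s (((x : Γ → ℤ) ⟨1, h1Γ⟩ : ℤ) : ZMod N)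
  have hball : ∀ x : bohrLattice Γ, ‖(x : Γ → ℤ)‖ ≤ N / 4 → ∀ γ ∈ Γ, ∃ y : ℤ,
      (y : ZMod N) = γ * (((x : Γ → ℤ) ⟨1, h1Γ⟩ : ℤ) : ZMod N) ∧ 4 * |y| ≤ N := fun x hx γ hγ => by
    refine ⟨(x : Γ → ℤ) ⟨γ, hγ⟩, hone x ⟨γ, hγ⟩, ?_⟩
    have h1 := (hcoord x ⟨γ, hγ⟩).trans hx
    have : (4 : ℝ) * |((x : Γ → ℤ) ⟨γ, hγ⟩ : ℝ)| ≤ N := by linarith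
    exact_mod_cast this
  have hσ : ∀ x y : bohrLattice Γ, ‖(x : Γ → ℤ)‖ ≤ N / 4 → ‖(y : Γ → ℤ)‖ ≤ N / 4 →
      ‖((x + y : bohrLattice Γ) : Γ → ℤ)‖ ≤ N / 4 → σ (x + y) = σ x + σ y := by
    intro x y hx hy hxy
    have := hs _ _ (hball x hx) (hball y hy) (by simpa using hball _ hxy)
    simpa [σ] using this
  let l : Fin r → ℕ := fun i => ⌊(N : ℝ) / (4 * (D + 1) * ‖(b i : Γ → ℤ)‖)⌋₊
  have hl : ∀ i (n : ℤ), |n| ≤ l i ↔ |(n : ℝ)| * ‖(b i : Γ → ℤ)‖ ≤ N / (4 * (D + 1)) := by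
    intro i n
    have hbi : 0 < ‖(b i : Γ → ℤ)‖ := hb0 i
    rw [Int.abs_eq_natAbs, Nat.cast_le, Nat.le_floor_iff (by positivity), le_div_iff₀ (by positivity),
      le_div_iff₀ (by positivity), Nat.cast_natAbs, Int.cast_abs]
    rw [show |(n : ℝ)| * (4 * (D + 1) * ‖(b i : Γ → ℤ)‖) = |(n : ℝ)| * ‖(b i : Γ → ℤ)‖ * (4 * (D + 1)) by ring]
  have hlsum : ∀ m : Fin r → ℤ, (∀ i, |m i| ≤ l i) →
      ∑ i, |(m i : ℝ)| * ‖(b i : Γ → ℤ)‖ ≤ N / 4 := by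
    intro m hm
    calc ∑ i, |(m i : ℝ)| * ‖(b i : Γ → ℤ)‖ ≤ ∑ i : Fin r, (N : ℝ) / (4 * (D + 1)) :=
          Finset.sum_le_sum fun i _ => (hl i _).1 (hm i)
      _ = r * (N / (4 * (D + 1))) := by simp
      _ ≤ (D + 1) * (N / (4 * (D + 1))) := by
          gcongr
          have : (r : ℝ) ≤ D := by exact_mod_cast hrD
          linarith
      _ = N / 4 := by field_simp
  have hnormsum : ∀ m : Fin r → ℤ, ‖((∑ i, m i • b i : bohrLattice Γ) : Γ → ℤ)‖ ≤
      ∑ i, |(m i : ℝ)| * ‖(b i : Γ → ℤ)‖ :=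
    fun m => hν.sum_le _ m b
  have hprod : ∏ i, (2 * l i + 1) ≤ N := by
    have h1 : (Fintype.piFinset fun i => Finset.Icc (-(l i : ℤ)) (l i)).card = ∏ i, (2 * l i + 1) := by
      rw [Fintype.card_piFinset]
      refine Finset.prod_congr rfl fun i _ => ?_
      rw [Int.card_Icc]; omega
    rw [← h1, ← ZMod.card N, ← Finset.card_univ]
    refine Finset.card_le_card_of_injOn
      (fun m => ((((∑ i, m i • b i : bohrLattice Γ) : Γ → ℤ) ⟨1, h1Γ⟩ : ℤ) : ZMod N))
      (fun _ _ => by simp) ?_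
    intro m hm m' hm' heq
    have hm1 : ∀ i, |m i| ≤ l i := fun i => by
      have := Finset.mem_Icc.1 (Fintype.mem_piFinset.1 hm i)
      rw [abs_le]; exact this
    have hm1' : ∀ i, |m' i| ≤ l i := fun i => by
      have := Finset.mem_Icc.1 (Fintype.mem_piFinset.1 hm' i)
      rw [abs_le]; exact this
    have hdiff : (∑ i, (m - m') i • b i : bohrLattice Γ) = ∑ i, m i • b i - ∑ i, m' i • b i := by
      simp [sub_smul]
    have hy : ‖((∑ i, (m - m') i • b i : bohrLattice Γ) : Γ → ℤ)‖ ≤ N / 2 := by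
      rw [hdiff]
      have h2 := (hnormsum m).trans (hlsum m hm1)
      have h3 := (hnormsum m').trans (hlsum m' hm1')
      have h4 := norm_sub_le ((∑ i, m i • b i : bohrLattice Γ) : Γ → ℤ)
        ((∑ i, m' i • b i : bohrLattice Γ) : Γ → ℤ)
      rw [Submodule.coe_sub]
      linarith
    have hzero : ((∑ i, (m - m') i • b i : bohrLattice Γ) : Γ → ℤ) = 0 := by
      funext γ
      have h5 := hone (∑ i, (m - m') i • b i) γ
      have h6 : ((((∑ i, (m - m') i • b i : bohrLattice Γ) : Γ → ℤ) ⟨1, h1Γ⟩ : ℤ) : ZMod N) = 0 := by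
        rw [hdiff, Submodule.coe_sub, Pi.sub_apply, Int.cast_sub, sub_eq_zero]
        exact heq
      rw [h6, mul_zero, ZMod.intCast_zmod_eq_zero_iff_dvd] at h5
      refine Int.eq_zero_of_abs_lt_dvd h5 ?_
      have h7 := (hcoord _ γ).trans hy
      have h8 : |((((∑ i, (m - m') i • b i : bohrLattice Γ) : Γ → ℤ) γ : ℤ) : ℝ)| < (N : ℝ) := by
        linarith
      exact_mod_cast h8
    funext i
    have h9 := hbC (m - m') i
    rw [hzero, norm_zero, mul_zero] at h9
    have h10 : |(((m - m') i : ℤ) : ℝ)| ≤ 0 := by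
      by_contra! h
      exact absurd h9 (not_le.2 (mul_pos h (hb0 i)))
    have h11 : (((m - m') i : ℤ) : ℝ) = 0 := abs_nonpos_iff.1 h10
    have h12 : (m - m') i = 0 := by exact_mod_cast h11
    simpa [sub_eq_zero] using h12
  obtain ⟨c, hc, hcard⟩ := Finset.exists_le_card_fiber_of_nsmul_le_card_of_maps_to
    (s := (Finset.univ : Finset (ZMod N)))
    (t := Fintype.piFinset fun _ : Γ => Finset.range M₀)
    (f := fun t γ => M₀ * ((γ : ZMod N) * t).val / N)
    (b := (N / M₀ ^ Γ.card : ℚ)) (fun t _ => by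
      rw [Fintype.mem_piFinset]
      intro γ
      rw [Finset.mem_range, Nat.div_lt_iff_lt_mul hN0]
      exact Nat.mul_lt_mul_of_pos_left (ZMod.val_lt _) (by omega))
      ⟨fun _ => 0, by rw [Fintype.mem_piFinset]; intro; simp; omega⟩ (by
        simp only [Fintype.card_piFinset, Finset.card_range, Finset.prod_const, Finset.card_univ,
          Fintype.card_coe, nsmul_eq_mul, ZMod.card]
        push_cast
        rw [mul_div_cancel₀]
        positivity)
  set B₀ : Finset (ZMod N) :=
    Finset.univ.filter fun t => (fun γ : Γ => M₀ * ((γ : ZMod N) * t).val / N) = c with hB₀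
  have hB₀card : N ≤ M₀ ^ D * B₀.card := by
    rw [div_le_iff₀ (by positivity)] at hcard
    have h1 : N ≤ B₀.card * M₀ ^ Γ.card := by exact_mod_cast hcard
    refine h1.trans ?_
    rw [mul_comm]
    exact Nat.mul_le_mul_right _ (Nat.pow_le_pow_right (by omega) hΓD)
  obtain ⟨t₀, ht₀⟩ : B₀.Nonempty := by
    rw [← Finset.card_pos]
    by_contra! h
    have h0 : B₀.card = 0 := by omega
    rw [h0] at hB₀card
    omega
  have hW : ∀ t ∈ B₀, ∃ x : bohrLattice Γ, (((x : Γ → ℤ) ⟨1, h1Γ⟩ : ℤ) : ZMod N) = t - t₀ ∧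
      M₀ * ‖(x : Γ → ℤ)‖ ≤ N := by
    intro t ht
    refine ⟨⟨fun γ => (((γ : ZMod N) * t).val : ℤ) - ((γ : ZMod N) * t₀).val,
      ⟨t - t₀, fun γ => by simp [mul_sub]⟩⟩, by simp, ?_⟩
    rw [mul_comm, ← le_div_iff₀ (by positivity)]
    refine (pi_norm_le_iff_of_nonneg (by positivity)).2 fun γ => ?_
    rw [Int.norm_eq_abs, le_div_iff₀ (by positivity)]
    have h1 := congrFun (Finset.mem_filter.1 ht).2 γ
    have h2 := congrFun (Finset.mem_filter.1 ht₀).2 γ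
    have h3 := Nat.div_mul_le_self (M₀ * ((γ : ZMod N) * t).val) N
    have h4 := Nat.div_mul_le_self (M₀ * ((γ : ZMod N) * t₀).val) N
    have h5 := Nat.lt_div_mul_add hN0 (a := M₀ * ((γ : ZMod N) * t).val)
    have h6 := Nat.lt_div_mul_add hN0 (a := M₀ * ((γ : ZMod N) * t₀).val)
    rw [h1] at h3 h5
    rw [h2] at h4 h6
    have h7 : (M₀ : ℝ) = |(M₀ : ℝ)| := (abs_of_nonneg (by positivity)).symm
    rw [h7, ← abs_mul, abs_le]
    rify at h3 h4 h5 h6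
    push_cast
    constructor <;> nlinarith
  refine ⟨r, fun i => σ (b i), l, B₀.image fun t => t - t₀, hrD, ?_, hprod, ?_, ?_⟩
  · rw [Finset.card_image_of_injective _ (sub_left_injective)]
    exact hB₀card
  · intro w hw
    obtain ⟨t, ht, rfl⟩ := Finset.mem_image.1 hw
    obtain ⟨x, hx, hxN⟩ := hW t ht
    rw [← hx]
    refine hball x ?_
    have : (8 : ℝ) ≤ M₀ := by exact_mod_cast hM₀8
    nlinarith [norm_nonneg (x : Γ → ℤ)]
  · intro w hw w' hw'
    obtain ⟨t, ht, rfl⟩ := Finset.mem_image.1 hw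
    obtain ⟨t', ht', rfl⟩ := Finset.mem_image.1 hw'
    obtain ⟨x, hx, hxN⟩ := hW t ht
    obtain ⟨x', hx', hxN'⟩ := hW t' ht'
    obtain ⟨m, hm⟩ := hbspan (x - x')
    have hM8 : (8 : ℝ) ≤ M₀ := by exact_mod_cast hM₀8
    have hxx : M₀ * ‖((x - x' : bohrLattice Γ) : Γ → ℤ)‖ ≤ 2 * N := by
      have := norm_sub_le (x : Γ → ℤ) (x' : Γ → ℤ)
      rw [Submodule.coe_sub]
      nlinarith
    have hx4 : ‖(x : Γ → ℤ)‖ ≤ N / 4 := by nlinarith [norm_nonneg (x : Γ → ℤ)]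
    have hx4' : ‖(x' : Γ → ℤ)‖ ≤ N / 4 := by nlinarith [norm_nonneg (x' : Γ → ℤ)]
    have hx4'' : ‖((x - x' : bohrLattice Γ) : Γ → ℤ)‖ ≤ N / 4 := by
      nlinarith [norm_nonneg ((x - x' : bohrLattice Γ) : Γ → ℤ)]
    have hml : ∀ i, |m i| ≤ l i := by
      intro i
      rw [hl]
      have h1 := hbC m i
      rw [← hm] at h1
      refine h1.trans ?_
      have h2 : Cr r * ‖((x - x' : bohrLattice Γ) : Γ → ℤ)‖ ≤
          C * ‖((x - x' : bohrLattice Γ) : Γ → ℤ)‖ := by gcongr; exact hC r hrD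
      refine h2.trans ?_
      rw [le_div_iff₀ (by positivity)]
      have h3 : 8 * (D + 1) * C * ‖((x - x' : bohrLattice Γ) : Γ → ℤ)‖ ≤
          M₀ * ‖((x - x' : bohrLattice Γ) : Γ → ℤ)‖ := by gcongr
      linarith
    refine ⟨m, hml, ?_⟩
    have h1 := hν.local_hom_sum (by positivity) hσ Finset.univ b m (hlsum m hml)
    have h2 := hσ (x - x') x' hx4'' hx4' (by rwa [sub_add_cancel])
    rw [sub_add_cancel, hm, h1] at h2
    rw [← hx, ← hx']
    exact sub_eq_of_eq_add h2

/-- **Freiman's theorem**, in covering form, for groups with enough homomorphisms to `ℤ`. -/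
theorem exists_gap_cover_of_card_add_le (K : ℕ) : ∃ D C : ℕ, ∀ {G : Type} [AddCommGroup G]
    [DecidableEq G] (_ : ∀ T : Finset G, 0 ∉ T → ∃ f : G →+ ℤ, ∀ t ∈ T, f t ≠ 0)
    (A : Finset G), A.Nonempty → (A + A).card ≤ K * A.card →
      ∃ (r : ℕ) (a : Fin r → G) (l : Fin r → ℕ) (X : Finset G), r ≤ D ∧ X.card ≤ C ∧
        ∏ i, (2 * l i + 1) ≤ C * A.card ∧
        ∀ x ∈ A, ∃ y ∈ X, ∃ m : Fin r → ℤ, (∀ i, |m i| ≤ l i) ∧ x = y + ∑ i, m i • a i := by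
  classical
  obtain ⟨M, hM, hgap⟩ := exists_gap_of_bohr_hom (2 * (32 * K ^ 12) ^ 2 + 1)
  refine ⟨2 * (32 * K ^ 12) ^ 2 + 1, 2 * K ^ 12 + K ^ 5 * M, ?_⟩
  intro G _ _ hG A hA hAK
  obtain ⟨N, Γ, s, hN, hAN, hNA, hΓ, hsA, hsadd, hsinj⟩ := exists_bohr_hom hG hA (K := K)
    (by exact_mod_cast hAK)
  have hN' : NeZero N := ⟨hN.ne'⟩
  have hmono : ∀ t, (∀ γ ∈ insert 1 Γ, ∃ x : ℤ, (x : ZMod N) = γ * t ∧ 4 * |x| ≤ N) →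
      ∀ γ ∈ Γ, ∃ x : ℤ, (x : ZMod N) = γ * t ∧ 4 * |x| ≤ N :=
    fun t h γ hγ => h γ (Finset.mem_insert_of_mem hγ)
  obtain ⟨r, a, l, W, hr, hW, hl, hWB, hWs⟩ := hgap (insert 1 Γ) s
    ((Finset.card_insert_le _ _).trans (by
      have : Γ.card ≤ 2 * (32 * K ^ 12) ^ 2 := by exact_mod_cast hΓ
      omega)) (Finset.mem_insert_self _ _)
    (fun t t' h h' h'' => hsadd t t' (hmono _ h) (hmono _ h') (hmono _ h''))
  have hWcard : (W.image s).card = W.card := Finset.card_image_of_injOn fun w hw w' hw' h =>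
    hsinj w w' (hmono _ (hWB w hw)) (hmono _ (hWB w' hw')) h
  have hWne : (W.image s).Nonempty := by
    rw [← Finset.card_pos, hWcard]
    by_contra! h
    have : W.card = 0 := by omega
    rw [this] at hW
    omega
  have hsum : (A + W.image s).card ≤ K ^ 5 * A.card := by
    have h1 : A + W.image s ⊆ 3 • A - 2 • A := by
      have h2 : W.image s ⊆ 2 • A - 2 • A := fun x hx => by
        obtain ⟨w, hw, rfl⟩ := Finset.mem_image.1 hx
        exact hsA w (hmono _ (hWB w hw))
      refine (Finset.add_subset_add_left h2).trans (le_of_eq ?_)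
      rw [show 3 • A = A + 2 • A by rw [succ_nsmul', ], add_sub_assoc]
    have h2 := Finset.pluennecke_ruzsa_inequality_nsmul_sub_nsmul_add (A := A) hA A 3 2
    have h3 : (((A + A).card : ℚ≥0) / A.card) ≤ K := by
      have : (0 : ℚ≥0) < A.card := by exact_mod_cast hA.card_pos
      rw [div_le_iff₀ this]
      exact_mod_cast hAK
    have h4 : ((3 • A - 2 • A).card : ℚ≥0) ≤ K ^ 5 * A.card := by
      refine h2.trans ?_
      gcongr
    exact (Finset.card_le_card h1).trans (by exact_mod_cast h4)
  obtain ⟨F, hFA, hFcard, hAF⟩ := Finset.ruzsa_covering_add (A := A) (B := W.image s)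
    (K := ((K ^ 5 * M : ℕ) : ℝ)) hWne (by
      have h1 : (A + W.image s).card ≤ K ^ 5 * M * (W.image s).card := by
        rw [hWcard, mul_assoc]
        exact hsum.trans (Nat.mul_le_mul_left _ (hAN.trans hW))
      exact_mod_cast h1)
  have hFcard' : F.card ≤ K ^ 5 * M := by exact_mod_cast hFcard
  refine ⟨r, a, l, F, hr, by omega, ?_, fun x hx => ?_⟩
  · have : N ≤ 2 * K ^ 12 * A.card := by exact_mod_cast hNA
    calc _ ≤ N := hl
      _ ≤ _ := this
      _ ≤ _ := Nat.mul_le_mul_right _ (by omega)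
  · obtain ⟨y, hy, z, hz, rfl⟩ := Finset.mem_add.1 (hAF hx)
    obtain ⟨u, hu, u', hu', rfl⟩ := Finset.mem_sub.1 hz
    obtain ⟨w, hw, rfl⟩ := Finset.mem_image.1 hu
    obtain ⟨w', hw', rfl⟩ := Finset.mem_image.1 hu'
    obtain ⟨m, hm, h⟩ := hWs w hw w' hw'
    exact ⟨y, hy, m, hm, by rw [h]⟩

lemma exists_hom_int_forall_ne_zero (k : ℕ) (T : Finset (Fin k → ℤ)) (hT : 0 ∉ T) :
    ∃ f : (Fin k → ℤ) →+ ℤ, ∀ t ∈ T, f t ≠ 0 := by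
  let p : (Fin k → ℤ) → Polynomial ℤ := fun t => ∑ i, Polynomial.monomial i.1 (t i)
  have hp : ∀ t ∈ T, p t ≠ 0 := fun t ht h => by
    refine hT ?_
    convert ht
    funext i
    have := congrArg (fun q => Polynomial.coeff q i.1) h
    simpa [p, Polynomial.finsetSum_coeff, Polynomial.coeff_monomial, Fin.val_inj, eq_comm] using this
  obtain ⟨q, hq⟩ : ∃ q : ℤ, (∏ t ∈ T, p t).eval q ≠ 0 := by
    by_contra! h
    exact Finset.prod_ne_zero_iff.2 hp (Polynomial.funext fun q => by simp [h q])
  refine ⟨∑ i, (AddMonoidHom.mulRight (q ^ i.1)).comp (Pi.evalAddMonoidHom (fun _ : Fin k => ℤ) i),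
    fun t ht => ?_⟩
  rw [Polynomial.eval_prod, Finset.prod_ne_zero_iff] at hq
  simpa [p, Polynomial.eval_finsetSum] using hq t ht

/-- The Brunn–Minkowski lower bound for the size of the sum of two sets of sizes `a` and `b` in
dimension `n`. -/
noncomputable def bmSum (n : ℕ) (a b : ℝ) : ℝ := (a ^ (n : ℝ)⁻¹ + b ^ (n : ℝ)⁻¹) ^ (n : ℝ)

lemma bmSum_mono (n : ℕ) {a b a' b' : ℝ} (ha : 0 ≤ a) (hb : 0 ≤ b) (haa : a ≤ a') (hbb : b ≤ b') :
    bmSum n a b ≤ bmSum n a' b' := by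
  unfold bmSum; gcongr

lemma bmSum_smul {n : ℕ} (hn : 0 < n) {a b c : ℝ} (hc : 0 ≤ c) (ha : 0 ≤ a) (hb : 0 ≤ b) :
    bmSum n (c * a) (c * b) = c * bmSum n a b := by
  have hn' : (n : ℝ) ≠ 0 := by positivity
  unfold bmSum
  rw [Real.mul_rpow hc ha, Real.mul_rpow hc hb, ← mul_add, Real.mul_rpow (by positivity)
    (by positivity), Real.rpow_inv_rpow hc hn']

lemma bmSum_self {n : ℕ} (hn : 0 < n) {a : ℝ} (ha : 0 ≤ a) : bmSum n a a = 2 ^ n * a := by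
  have hn' : (n : ℝ) ≠ 0 := by positivity
  unfold bmSum
  rw [← two_mul, Real.mul_rpow (by norm_num) (by positivity), Real.rpow_inv_rpow ha hn',
    Real.rpow_natCast]

lemma le_bmSum {n : ℕ} (hn : 0 < n) {a b : ℝ} (ha : 0 ≤ a) (hb : 0 ≤ b) : a ≤ bmSum n a b := by
  have hn' : (n : ℝ) ≠ 0 := by positivity
  calc a = (a ^ (n : ℝ)⁻¹) ^ (n : ℝ) := (Real.rpow_inv_rpow ha hn').symm
    _ ≤ _ := by
      unfold bmSum
      gcongr
      have : 0 ≤ b ^ (n : ℝ)⁻¹ := by positivity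
      linarith

lemma bmSum_one (a b : ℝ) : bmSum 1 a b = a + b := by
  simp [bmSum]

lemma bmSum_succ_le {n : ℕ} (hn : 0 < n) {F G α β : ℝ} (hF : 0 ≤ F) (hG : 0 ≤ G) (hα : 0 ≤ α)
    (hβ : 0 ≤ β) : bmSum (n + 1) (F * α) (G * β) ≤ bmSum n F G * (α + β) := by
  have hn' : (0 : ℝ) < n := by positivity
  obtain ⟨p, hp, rfl⟩ : ∃ p : ℝ, 0 ≤ p ∧ F = p ^ (n : ℝ) :=
    ⟨F ^ (n : ℝ)⁻¹, by positivity, (Real.rpow_inv_rpow hF hn'.ne').symm⟩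
  obtain ⟨q, hq, rfl⟩ : ∃ q : ℝ, 0 ≤ q ∧ G = q ^ (n : ℝ) :=
    ⟨G ^ (n : ℝ)⁻¹, by positivity, (Real.rpow_inv_rpow hG hn'.ne').symm⟩
  have hpq : ((n + 1 : ℝ) / n).HolderConjugate (n + 1) := by
    rw [Real.holderConjugate_iff]
    refine ⟨by rw [lt_div_iff₀ hn']; linarith, by field_simp⟩
  have key := Real.inner_le_Lp_mul_Lq_of_nonneg (Finset.univ : Finset (Fin 2)) hpq
    (f := ![p ^ ((n : ℝ) / (n + 1)), q ^ ((n : ℝ) / (n + 1))])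
    (g := ![α ^ ((n + 1 : ℝ)⁻¹), β ^ ((n + 1 : ℝ)⁻¹)])
    (by intro i _; fin_cases i <;> simp <;> positivity)
    (by intro i _; fin_cases i <;> simp <;> positivity)
  simp only [Fin.sum_univ_two, Matrix.cons_val_zero, Matrix.cons_val_one] at key
  rw [← Real.rpow_mul hp, ← Real.rpow_mul hq, ← Real.rpow_mul hα, ← Real.rpow_mul hβ,
    show (n : ℝ) / (n + 1) * ((n + 1) / n) = 1 by field_simp,
    show (n + 1 : ℝ)⁻¹ * (n + 1) = 1 by field_simp] at key
  simp only [Real.rpow_one] at key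
  unfold bmSum
  rw [Real.mul_rpow (by positivity) hα, Real.mul_rpow (by positivity) hβ, ← Real.rpow_mul hp,
    ← Real.rpow_mul hq, ← Real.rpow_mul hp, ← Real.rpow_mul hq, mul_inv_cancel₀ hn'.ne',
    Real.rpow_one, Real.rpow_one]
  push_cast
  rw [← div_eq_mul_inv]
  calc _ ≤ ((p + q) ^ (1 / ((n + 1 : ℝ) / n)) * (α + β) ^ (1 / (n + 1 : ℝ))) ^ (n + 1 : ℝ) := by
        gcongr
    _ = _ := by
        rw [Real.mul_rpow (by positivity) (by positivity), ← Real.rpow_mul (by positivity),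
          ← Real.rpow_mul (by positivity)]
        rw [show 1 / ((n + 1 : ℝ) / n) * (n + 1) = n by field_simp,
          show 1 / (n + 1 : ℝ) * (n + 1) = 1 by field_simp, Real.rpow_one]

lemma integral_card_filter_le {ι : Type*} (s : Finset ι) (c : ι → ℝ) (hc : ∀ i ∈ s, 0 ≤ c i) :
    IntegrableOn (fun x : ℝ => ((s.filter fun i => x ≤ c i).card : ℝ)) (Ioc 0 1) ∧
    ∫ x in Ioc (0 : ℝ) 1, ((s.filter fun i => x ≤ c i).card : ℝ) = ∑ i ∈ s, min 1 (c i) := by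
  have h1 : (fun x : ℝ => ((s.filter fun i => x ≤ c i).card : ℝ)) =
      fun x => ∑ i ∈ s, (Iic (c i)).indicator (fun _ => (1 : ℝ)) x := by
    funext x
    rw [Finset.card_filter]
    push_cast
    refine Finset.sum_congr rfl fun i _ => ?_
    simp [Set.indicator]
  have h2 : ∀ i ∈ s, IntegrableOn ((Iic (c i)).indicator (fun _ => (1 : ℝ))) (Ioc 0 1) :=
    fun i _ => (integrableOn_const (by simp)).indicator measurableSet_Iic
  rw [h1]
  refine ⟨integrable_finsetSum _ h2, ?_⟩
  rw [integral_finsetSum _ h2]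
  refine Finset.sum_congr rfl fun i hi => ?_
  rw [setIntegral_indicator measurableSet_Iic, setIntegral_const]
  rw [Ioc_inter_Iic, measureReal_def, Real.volume_Ioc, sub_zero,
    ENNReal.toReal_ofReal (le_min zero_le_one (hc i hi)), smul_eq_mul, mul_one]

/-- A Prékopa–Leindler type inequality on `ℤ`, proved by comparing superlevel sets. -/
lemma sum_div_add_sum_div_le {I J : Finset ℤ} {f g h : ℤ → ℝ} {F G H : ℝ} (hF : 0 < F) (hG : 0 < G)
    (hH : 0 < H) (hf : ∀ s ∈ I, 0 ≤ f s ∧ f s ≤ F) (hg : ∀ t ∈ J, 0 ≤ g t ∧ g t ≤ G)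
    (hfF : ∃ s ∈ I, f s = F) (hgG : ∃ t ∈ J, g t = G) (hh : ∀ r ∈ I + J, 0 ≤ h r)
    (hfg : ∀ x : ℝ, 0 < x → x ≤ 1 → ∀ s ∈ I, ∀ t ∈ J, x * F ≤ f s → x * G ≤ g t →
      x * H ≤ h (s + t)) :
    (∑ s ∈ I, f s) / F + (∑ t ∈ J, g t) / G ≤ (∑ r ∈ I + J, h r) / H + 1 := by
  obtain ⟨hi1, he1⟩ := integral_card_filter_le I (fun s => f s / F)
    fun s hs => div_nonneg (hf s hs).1 hF.le
  obtain ⟨hi2, he2⟩ := integral_card_filter_le J (fun s => g s / G)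
    fun s hs => div_nonneg (hg s hs).1 hG.le
  obtain ⟨hi3, he3⟩ := integral_card_filter_le (I + J) (fun s => h s / H)
    fun s hs => div_nonneg (hh s hs) hH.le
  have h1 : ∑ s ∈ I, min 1 (f s / F) = (∑ s ∈ I, f s) / F := by
    rw [Finset.sum_div]
    exact Finset.sum_congr rfl fun s hs => min_eq_right ((div_le_one hF).2 (hf s hs).2)
  have h2 : ∑ s ∈ J, min 1 (g s / G) = (∑ s ∈ J, g s) / G := by
    rw [Finset.sum_div]
    exact Finset.sum_congr rfl fun s hs => min_eq_right ((div_le_one hG).2 (hg s hs).2)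
  have h3 : ∑ s ∈ I + J, min 1 (h s / H) ≤ (∑ s ∈ I + J, h s) / H := by
    rw [Finset.sum_div]
    exact Finset.sum_le_sum fun s hs => min_le_right _ _
  have key := setIntegral_mono_on (hi1.add hi2)
    (hi3.add (integrableOn_const (C := (1 : ℝ)) (by simp))) measurableSet_Ioc (fun x hx => by
      simp only [Pi.add_apply]
      obtain ⟨s₀, hs₀, hs₀F⟩ := hfF
      obtain ⟨t₀, ht₀, ht₀G⟩ := hgG
      have hne1 : (I.filter fun s => x ≤ f s / F).Nonempty :=
        ⟨s₀, Finset.mem_filter.2 ⟨hs₀, by rw [hs₀F, div_self hF.ne']; exact hx.2⟩⟩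
      have hne2 : (J.filter fun s => x ≤ g s / G).Nonempty :=
        ⟨t₀, Finset.mem_filter.2 ⟨ht₀, by rw [ht₀G, div_self hG.ne']; exact hx.2⟩⟩
      have h4 := cauchy_davenport_add_of_linearOrder_isCancelAdd hne1 hne2
      have h5 : (I.filter fun s => x ≤ f s / F) + (J.filter fun s => x ≤ g s / G) ⊆
          (I + J).filter fun s => x ≤ h s / H := by
        intro r hr
        obtain ⟨s, hs, t, ht, rfl⟩ := Finset.mem_add.1 hr
        rw [Finset.mem_filter] at hs ht ⊢
        refine ⟨Finset.add_mem_add hs.1 ht.1, ?_⟩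
        rw [le_div_iff₀ hH]
        exact hfg x hx.1 hx.2 s hs.1 t ht.1 ((le_div_iff₀ hF).1 hs.2) ((le_div_iff₀ hG).1 ht.2)
      have h6 := Finset.card_le_card h5
      have h7 : (I.filter fun s => x ≤ f s / F).card + (J.filter fun s => x ≤ g s / G).card ≤
          ((I + J).filter fun s => x ≤ h s / H).card + 1 := by omega
      exact_mod_cast h7)
  rw [integral_add' hi1 hi2, integral_add' hi3 (integrableOn_const (by simp)), he1, he2, he3, h1,
    h2] at key
  simp at key
  linarith

/-- The slice of a finite set of integer points at height `s` in the zeroth coordinate. -/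
def latticeSlice {n : ℕ} (U : Finset (Fin (n + 1) → ℤ)) (s : ℤ) : Finset (Fin n → ℤ) :=
  (U.filter fun x => x 0 = s).image Fin.tail

lemma mem_latticeSlice {n : ℕ} {U : Finset (Fin (n + 1) → ℤ)} {s : ℤ} {y : Fin n → ℤ} :
    y ∈ latticeSlice U s ↔ Fin.cons s y ∈ U := by
  simp only [latticeSlice, Finset.mem_image, Finset.mem_filter]
  constructor
  · rintro ⟨x, ⟨hx, rfl⟩, rfl⟩
    rwa [Fin.cons_self_tail]
  · intro h
    exact ⟨_, ⟨h, by simp⟩, by simp⟩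

lemma card_eq_sum_card_latticeSlice {n : ℕ} (U : Finset (Fin (n + 1) → ℤ)) {I : Finset ℤ}
    (hI : ∀ x ∈ U, x 0 ∈ I) : U.card = ∑ s ∈ I, (latticeSlice U s).card := by
  rw [Finset.card_eq_sum_card_fiberwise hI]
  refine Finset.sum_congr rfl fun s _ => ?_
  rw [latticeSlice, Finset.card_image_of_injOn]
  intro x hx y hy h
  have hx0 : x 0 = s := (Finset.mem_filter.1 hx).2
  have hy0 : y 0 = s := (Finset.mem_filter.1 hy).2
  rw [← Fin.cons_self_tail x, ← Fin.cons_self_tail y, hx0, hy0, h]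

lemma card_le_of_abs_sub_lt {n : ℕ} {U : Finset (Fin n → ℤ)} {L : Fin n → ℕ}
    (hU : ∀ x ∈ U, ∀ y ∈ U, ∀ i, |x i - y i| < L i) : U.card ≤ 2 ^ n * ∏ i, L i := by
  rcases U.eq_empty_or_nonempty with rfl | ⟨x₀, hx₀⟩
  · simp
  have h1 : U ⊆ Fintype.piFinset fun i => Finset.Ioo (x₀ i - L i) (x₀ i + L i) := fun x hx => by
    rw [Fintype.mem_piFinset]
    intro i
    have := abs_lt.1 (hU x hx x₀ hx₀ i)
    rw [Finset.mem_Ioo]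
    constructor <;> linarith
  refine (Finset.card_le_card h1).trans ?_
  rw [Fintype.card_piFinset]
  calc _ ≤ ∏ i, 2 * L i := Finset.prod_le_prod' fun i _ => by rw [Int.card_Ioo]; omega
    _ = _ := by rw [Finset.prod_mul_distrib]; simp

/-- A discrete Brunn–Minkowski inequality for sets of integer points in a box, with an error
governed by the shortest side of the box. -/
theorem bmSum_card_le (n : ℕ) : ∃ C : ℝ, 0 ≤ C ∧
    ∀ (U V : Finset (Fin (n + 1) → ℤ)) (L : Fin (n + 1) → ℕ), U.Nonempty → V.Nonempty →
      (∀ x ∈ U, ∀ y ∈ U, ∀ i, |x i - y i| < L i) → (∀ x ∈ V, ∀ y ∈ V, ∀ i, |x i - y i| < L i) →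
      bmSum (n + 1) U.card V.card ≤ (U + V).card + C * ((∏ i, (L i : ℝ)) * ∑ i, (L i : ℝ)⁻¹) := by
  induction n with
  | zero =>
    refine ⟨1, zero_le_one, fun U V L hU hV hUL hVL => ?_⟩
    have hL : (L 0 : ℝ) ≠ 0 := by
      obtain ⟨x, hx⟩ := hU
      have := hUL x hx x hx 0
      simp at this
      positivity
    have hinj : Function.Injective fun x : Fin 1 → ℤ => x 0 := fun x y h => by
      funext i
      rw [Subsingleton.elim i 0]
      exact h
    have h1 := cauchy_davenport_add_of_linearOrder_isCancelAdd (hU.image fun x => x 0)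
      (hV.image fun x => x 0)
    have h2 : U.image (fun x => x 0) + V.image (fun x => x 0) = (U + V).image fun x => x 0 :=
      (Finset.image_add (Pi.evalAddMonoidHom (fun _ : Fin 1 => ℤ) 0)).symm
    rw [h2, Finset.card_image_of_injective _ hinj, Finset.card_image_of_injective _ hinj,
      Finset.card_image_of_injective _ hinj] at h1
    have h3 : U.card + V.card ≤ (U + V).card + 1 := by omega
    have h4 := bmSum_one U.card V.card
    simp only [zero_add, h4]
    simp [hL]
    exact_mod_cast h3
  | succ n ih =>
    obtain ⟨C, hC, ih⟩ := ih
    refine ⟨4 * C + 4 ^ (n + 1), by positivity, fun U V L hU hV hUL hVL => ?_⟩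
    obtain ⟨x₀, hx₀⟩ := id hU
    obtain ⟨y₀, hy₀⟩ := id hV
    have hLpos : ∀ i, (0 : ℝ) < L i := fun i => by
      have := hUL x₀ hx₀ x₀ hx₀ i
      simp at this
      exact_mod_cast this
    obtain ⟨I, hIdef⟩ : ∃ I, I = U.image fun x => x 0 := ⟨_, rfl⟩
    obtain ⟨J, hJdef⟩ : ∃ J, J = V.image fun x => x 0 := ⟨_, rfl⟩
    have hUI : ∀ x ∈ U, x 0 ∈ I := fun x hx => hIdef ▸ Finset.mem_image_of_mem _ hx
    have hVJ : ∀ x ∈ V, x 0 ∈ J := fun x hx => hJdef ▸ Finset.mem_image_of_mem _ hx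
    have hUs : ∀ s ∈ I, (latticeSlice U s).Nonempty := fun s hs => by
      rw [hIdef] at hs
      obtain ⟨x, hx, rfl⟩ := Finset.mem_image.1 hs
      exact ⟨Fin.tail x, by rwa [mem_latticeSlice, Fin.cons_self_tail]⟩
    have hVs : ∀ s ∈ J, (latticeSlice V s).Nonempty := fun s hs => by
      rw [hJdef] at hs
      obtain ⟨x, hx, rfl⟩ := Finset.mem_image.1 hs
      exact ⟨Fin.tail x, by rwa [mem_latticeSlice, Fin.cons_self_tail]⟩
    have hUd : ∀ s, ∀ x ∈ latticeSlice U s, ∀ y ∈ latticeSlice U s, ∀ i, |x i - y i| < L i.succ :=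
      fun s x hx y hy i => by
        simpa using hUL _ (mem_latticeSlice.1 hx) _ (mem_latticeSlice.1 hy) i.succ
    have hVd : ∀ s, ∀ x ∈ latticeSlice V s, ∀ y ∈ latticeSlice V s, ∀ i, |x i - y i| < L i.succ :=
      fun s x hx y hy i => by
        simpa using hVL _ (mem_latticeSlice.1 hx) _ (mem_latticeSlice.1 hy) i.succ
    obtain ⟨s₀, hs₀, hmaxF⟩ := I.exists_max_image (fun s => (latticeSlice U s).card)
      ⟨_, hUI _ hx₀⟩
    obtain ⟨t₀, ht₀, hmaxG⟩ := J.exists_max_image (fun s => (latticeSlice V s).card)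
      ⟨_, hVJ _ hy₀⟩
    obtain ⟨F, hF⟩ : ∃ F, F = ((latticeSlice U s₀).card : ℝ) := ⟨_, rfl⟩
    obtain ⟨G, hG⟩ : ∃ G, G = ((latticeSlice V t₀).card : ℝ) := ⟨_, rfl⟩
    have hF0 : 0 < F := by rw [hF]; exact_mod_cast (hUs s₀ hs₀).card_pos
    have hG0 : 0 < G := by rw [hG]; exact_mod_cast (hVs t₀ ht₀).card_pos
    obtain ⟨P, hP⟩ : ∃ P, P = ∏ i : Fin (n + 1), (L i.succ : ℝ) := ⟨_, rfl⟩
    obtain ⟨σ, hσ⟩ : ∃ σ, σ = ∑ i : Fin (n + 1), (L i.succ : ℝ)⁻¹ := ⟨_, rfl⟩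
    have hP0 : 0 ≤ P := by rw [hP]; positivity
    have hσ0 : 0 ≤ σ := by rw [hσ]; positivity
    have hH0 : 0 < bmSum (n + 1) F G := hF0.trans_le (le_bmSum n.succ_pos hF0.le hG0.le)
    have hslice : ∀ s ∈ I, ∀ t ∈ J, bmSum (n + 1) (latticeSlice U s).card (latticeSlice V t).card ≤
        (latticeSlice (U + V) (s + t)).card + C * (P * σ) := fun s hs t ht => by
      refine (ih _ _ (fun i => L i.succ) (hUs s hs) (hVs t ht) (hUd s) (hVd t)).trans ?_
      rw [← hP, ← hσ]
      gcongr
      intro z hz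
      obtain ⟨x, hx, y, hy, rfl⟩ := Finset.mem_add.1 hz
      rw [mem_latticeSlice] at hx hy ⊢
      have h1 := Finset.add_mem_add hx hy
      convert h1 using 1
      funext i
      refine Fin.cases ?_ (fun i => ?_) i <;> simp
    have key := sum_div_add_sum_div_le (I := I) (J := J)
      (f := fun s => ((latticeSlice U s).card : ℝ)) (g := fun s => ((latticeSlice V s).card : ℝ))
      (h := fun s => (latticeSlice (U + V) s).card + C * (P * σ)) hF0 hG0 hH0
      (fun s hs => ⟨by positivity, by rw [hF]; exact_mod_cast hmaxF s hs⟩)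
      (fun s hs => ⟨by positivity, by rw [hG]; exact_mod_cast hmaxG s hs⟩)
      ⟨s₀, hs₀, hF.symm⟩ ⟨t₀, ht₀, hG.symm⟩ (fun r _ => by positivity)
      (fun x hx _ s hs t ht hxF hxG => by
        rw [← bmSum_smul n.succ_pos hx.le hF0.le hG0.le]
        exact (bmSum_mono _ (by positivity) (by positivity) hxF hxG).trans (hslice s hs t ht))
    rw [Finset.sum_add_distrib] at key
    have hUc : (∑ s ∈ I, ((latticeSlice U s).card : ℝ)) = U.card := by
      rw [card_eq_sum_card_latticeSlice U hUI]; push_cast; rfl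
    have hVc : (∑ s ∈ J, ((latticeSlice V s).card : ℝ)) = V.card := by
      rw [card_eq_sum_card_latticeSlice V hVJ]; push_cast; rfl
    have hUVc : (∑ s ∈ I + J, ((latticeSlice (U + V) s).card : ℝ)) = (U + V).card := by
      rw [card_eq_sum_card_latticeSlice (U + V) (I := I + J)]
      · push_cast; rfl
      · intro z hz
        obtain ⟨x, hx, y, hy, rfl⟩ := Finset.mem_add.1 hz
        exact Finset.add_mem_add (hUI x hx) (hVJ y hy)
    have hIJ : ((I + J).card : ℝ) ≤ 4 * L 0 := by
      have h1 : I + J ⊆ Finset.Ioo (x₀ 0 + y₀ 0 - 2 * L 0) (x₀ 0 + y₀ 0 + 2 * L 0) := by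
        intro r hr
        obtain ⟨s, hs, t, ht, rfl⟩ := Finset.mem_add.1 hr
        rw [hIdef] at hs
        rw [hJdef] at ht
        obtain ⟨x, hx, rfl⟩ := Finset.mem_image.1 hs
        obtain ⟨y, hy, rfl⟩ := Finset.mem_image.1 ht
        have h2 := abs_lt.1 (hUL x hx x₀ hx₀ 0)
        have h3 := abs_lt.1 (hVL y hy y₀ hy₀ 0)
        rw [Finset.mem_Ioo]
        constructor <;> linarith [h2.1, h2.2, h3.1, h3.2]
      have h2 := Finset.card_le_card h1
      rw [Int.card_Ioo] at h2
      have h3 : (I + J).card ≤ 4 * L 0 := by omega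
      exact_mod_cast h3
    rw [hUc, hVc, hUVc, Finset.sum_const, nsmul_eq_mul] at key
    have hHP : bmSum (n + 1) F G ≤ 4 ^ (n + 1) * P := by
      have h1 : F ≤ 2 ^ (n + 1) * P := by
        rw [hF, hP]; exact_mod_cast card_le_of_abs_sub_lt (hUd s₀)
      have h2 : G ≤ 2 ^ (n + 1) * P := by
        rw [hG, hP]; exact_mod_cast card_le_of_abs_sub_lt (hVd t₀)
      refine (bmSum_mono _ hF0.le hG0.le h1 h2).trans (le_of_eq ?_)
      rw [bmSum_self n.succ_pos (by positivity), ← mul_assoc, ← mul_pow]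
      norm_num
    have hhold := bmSum_succ_le n.succ_pos hF0.le hG0.le (α := U.card / F) (β := V.card / G)
      (by positivity) (by positivity)
    rw [mul_div_cancel₀ _ hF0.ne', mul_div_cancel₀ _ hG0.ne'] at hhold
    refine hhold.trans ?_
    have h4 := mul_le_mul_of_nonneg_left key hH0.le
    rw [mul_add _ _ (1 : ℝ), mul_div_cancel₀ _ hH0.ne', mul_one] at h4
    refine h4.trans ?_
    have h5 : ((I + J).card : ℝ) * (C * (P * σ)) ≤ 4 * L 0 * (C * (P * σ)) := by gcongr
    rw [Fin.prod_univ_succ, Fin.sum_univ_succ, ← hP, ← hσ]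
    have h6 : (L 0 : ℝ) * P * ((L 0 : ℝ)⁻¹ + σ) = P + L 0 * P * σ := by
      have := (hLpos 0).ne'
      field_simp
    rw [h6]
    have h7 : 0 ≤ L 0 * P * σ := by positivity
    have h8 : (0 : ℝ) ≤ 4 ^ (n + 1) * (L 0 * P * σ) := by positivity
    have h9 : 0 ≤ C * P := by positivity
    nlinarith

lemma bmSum_card_le_fintype (ι : Type*) [Fintype ι] [Nonempty ι] : ∃ C : ℝ, 0 ≤ C ∧
    ∀ (U V : Finset (ι → ℤ)) (L : ι → ℕ), U.Nonempty → V.Nonempty →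
      (∀ x ∈ U, ∀ y ∈ U, ∀ i, |x i - y i| < L i) → (∀ x ∈ V, ∀ y ∈ V, ∀ i, |x i - y i| < L i) →
      bmSum (Fintype.card ι) U.card V.card ≤
        (U + V).card + C * ((∏ i, (L i : ℝ)) * ∑ i, (L i : ℝ)⁻¹) := by
  classical
  obtain ⟨n, hn⟩ : ∃ n, Fintype.card ι = n + 1 := ⟨_, (Nat.succ_pred Fintype.card_ne_zero).symm⟩
  obtain ⟨C, hC, h⟩ := bmSum_card_le n
  let e : Fin (n + 1) ≃ ι := (Fintype.equivFinOfCardEq hn).symm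
  let f : (ι → ℤ) →+ (Fin (n + 1) → ℤ) :=
    { toFun := fun x => x ∘ e, map_zero' := rfl, map_add' := fun _ _ => rfl }
  have hf : Function.Injective f := fun x y hxy => by
    funext i
    simpa [f] using congrFun hxy (e.symm i)
  refine ⟨C, hC, fun U V L hU hV hUL hVL => ?_⟩
  have key := h (U.image f) (V.image f) (L ∘ e) (hU.image _) (hV.image _)
    (by
      simp only [Finset.forall_mem_image]
      exact fun x hx y hy i => hUL x hx y hy (e i))
    (by
      simp only [Finset.forall_mem_image]
      exact fun x hx y hy i => hVL x hx y hy (e i))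
  rw [← Finset.image_add f, Finset.card_image_of_injective _ hf, Finset.card_image_of_injective _ hf,
    Finset.card_image_of_injective _ hf] at key
  rw [hn]
  have h1 : ∏ i, ((L ∘ e) i : ℝ) = ∏ i, (L i : ℝ) := e.prod_comp fun i => (L i : ℝ)
  have h2 : ∑ i, ((L ∘ e) i : ℝ)⁻¹ = ∑ i, (L i : ℝ)⁻¹ := e.sum_comp fun i => (L i : ℝ)⁻¹
  rwa [h1, h2] at key

/-- The sum of a generalized arithmetic progression and a parallelotope, both symmetric. -/
def gapBox {k d : ℕ} (a : Fin d → Fin k → ℝ) (l : Fin d → ℕ) (v : Fin k → Fin k → ℝ) :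
    Set (Fin k → ℝ) :=
  {x | ∃ (n : Fin d → ℤ) (t : Fin k → ℝ), (∀ i, |n i| ≤ l i) ∧ (∀ j, |t j| ≤ 1) ∧
    x = ∑ i, (n i : ℝ) • a i + ∑ j, t j • v j}

/-- Integer relations of moderate size among the generators hold only trivially. -/
def GapProper {k d : ℕ} (a : Fin d → Fin k → ℝ) (l : Fin d → ℕ) (v : Fin k → Fin k → ℝ) : Prop :=
  ∀ (n : Fin d → ℤ) (t : Fin k → ℝ), (∀ i, |n i| ≤ 8 * l i) → (∀ j, |t j| ≤ 8) →
    ∑ i, (n i : ℝ) • a i + ∑ j, t j • v j = 0 → n = 0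

lemma sum_smul_eq_toLin {k : ℕ} (v : Fin k → Fin k → ℝ) (t : Fin k → ℝ) :
    ∑ j, t j • v j = Matrix.toLin' (Matrix.of v).transpose t := by
  funext i
  simp [Matrix.mulVec, dotProduct, mul_comm]

lemma eq_zero_of_sum_smul_eq_zero {k : ℕ} {v : Fin k → Fin k → ℝ} (hv : (Matrix.of v).det ≠ 0)
    {t : Fin k → ℝ} (h : ∑ j, t j • v j = 0) : t = 0 := by
  rw [sum_smul_eq_toLin, Matrix.toLin'_apply] at h
  exact Matrix.eq_zero_of_mulVec_eq_zero (by rwa [Matrix.det_transpose]) h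

lemma volume_image_add_sum_smul {k : ℕ} (c : Fin k → ℝ) (v : Fin k → Fin k → ℝ)
    (s : Set (Fin k → ℝ)) :
    volume ((fun t => c + ∑ j, t j • v j) '' s) =
      ENNReal.ofReal |(Matrix.of v).det| * volume s := by
  have h1 : (fun t : Fin k → ℝ => c + ∑ j, t j • v j) '' s =
      c +ᵥ (Matrix.toLin' (Matrix.of v).transpose '' s) := by
    rw [← Set.image_vadd, Set.image_image]
    refine Set.image_congr fun t _ => ?_
    rw [sum_smul_eq_toLin]; rfl
  rw [h1, measure_vadd, Measure.addHaar_image_linearMap, LinearMap.det_toLin', Matrix.det_transpose]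

/-- The cell of the grid of mesh `1 / m` attached to the structure with generators `a`, `v`. -/
def gapCell {k d : ℕ} (a : Fin d → Fin k → ℝ) (v : Fin k → Fin k → ℝ) (m : ℕ)
    (p : Fin d ⊕ Fin k → ℤ) : Set (Fin k → ℝ) :=
  (fun t => ∑ i, (p (.inl i) : ℝ) • a i + ∑ j, t j • v j) ''
    Set.univ.pi fun j => Ico ((p (.inr j) : ℝ) / m) ((p (.inr j) + 1) / m)

lemma volume_gapCell {k d : ℕ} (a : Fin d → Fin k → ℝ) (v : Fin k → Fin k → ℝ) {m : ℕ}
    (p : Fin d ⊕ Fin k → ℤ) :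
    volume (gapCell a v m p) = ENNReal.ofReal (|(Matrix.of v).det| * ((m : ℝ)⁻¹) ^ k) := by
  rw [gapCell, volume_image_add_sum_smul, Real.volume_pi_Ico,
    ENNReal.ofReal_mul (abs_nonneg _)]
  congr 1
  have : ∀ j : Fin k, ((p (.inr j) : ℝ) + 1) / m - (p (.inr j) : ℝ) / m = (m : ℝ)⁻¹ :=
    fun j => by ring
  simp only [this, Finset.prod_const, Finset.card_univ, Fintype.card_fin]
  rw [ENNReal.ofReal_pow (by positivity)]

lemma measurableSet_gapCell {k d : ℕ} (a : Fin d → Fin k → ℝ) {v : Fin k → Fin k → ℝ}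
    (hv : (Matrix.of v).det ≠ 0) (m : ℕ) (p : Fin d ⊕ Fin k → ℤ) :
    MeasurableSet (gapCell a v m p) := by
  refine MeasurableSet.image_of_continuousOn_injOn
    (MeasurableSet.univ_pi fun j => measurableSet_Ico) (by fun_prop) ?_
  intro t _ t' _ h
  have h1 : ∑ j, (t - t') j • v j = 0 := by
    simpa [sub_smul, sub_eq_zero] using h
  exact sub_eq_zero.1 (eq_zero_of_sum_smul_eq_zero hv h1)

/-- The indices of the grid cells of the structure box that meet `U`. -/
noncomputable def gapGrid {k d : ℕ} (a : Fin d → Fin k → ℝ) (l : Fin d → ℕ) (v : Fin k → Fin k → ℝ)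
    (m : ℕ) (U : Set (Fin k → ℝ)) : Finset (Fin d ⊕ Fin k → ℤ) :=
  open Classical in
  (Fintype.piFinset (Sum.elim (fun i => Finset.Icc (-(l i : ℤ)) (l i))
    fun _ => Finset.Icc (-(m : ℤ)) m)).filter fun p => (gapCell a v m p ∩ U).Nonempty

section gapGrid

variable {k d : ℕ} {a : Fin d → Fin k → ℝ} {l : Fin d → ℕ} {v : Fin k → Fin k → ℝ} {m : ℕ}
  {U V : Set (Fin k → ℝ)}

lemma mem_gapGrid {p : Fin d ⊕ Fin k → ℤ} : p ∈ gapGrid a l v m U ↔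
    (∀ i, |p (.inl i)| ≤ l i) ∧ (∀ j, |p (.inr j)| ≤ m) ∧ (gapCell a v m p ∩ U).Nonempty := by
  simp [gapGrid, Fintype.mem_piFinset, abs_le, and_assoc]

lemma exists_mem_gapGrid (hm : 0 < m) (hU : U ⊆ gapBox a l v) {u : Fin k → ℝ} (hu : u ∈ U) :
    ∃ p ∈ gapGrid a l v m U, u ∈ gapCell a v m p := by
  obtain ⟨n, t, hn, ht, rfl⟩ := hU hu
  have hm' : (0 : ℝ) < m := by exact_mod_cast hm
  have hcell : ∑ i, (n i : ℝ) • a i + ∑ j, t j • v j ∈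
      gapCell a v m (Sum.elim n fun j => ⌊m * t j⌋) := by
    refine ⟨t, fun j _ => ?_, rfl⟩
    simp only [Sum.elim_inr, Set.mem_Ico]
    rw [div_le_iff₀ hm', lt_div_iff₀ hm', mul_comm (t j)]
    exact ⟨Int.floor_le _, Int.lt_floor_add_one _⟩
  refine ⟨_, mem_gapGrid.2 ⟨hn, fun j => ?_, _, hcell, hu⟩, hcell⟩
  have h1 := abs_le.1 (ht j)
  rw [Sum.elim_inr, abs_le]
  constructor
  · rw [Int.le_floor]; push_cast; nlinarith
  · have : ((⌊m * t j⌋ : ℤ) : ℝ) ≤ m := (Int.floor_le _).trans (by nlinarith)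
    exact_mod_cast this

lemma volume_le_card_gapGrid (hm : 0 < m) (hU : U ⊆ gapBox a l v) :
    volume U ≤ (gapGrid a l v m U).card * ENNReal.ofReal (|(Matrix.of v).det| * ((m : ℝ)⁻¹) ^ k) := by
  calc volume U ≤ volume (⋃ p ∈ gapGrid a l v m U, gapCell a v m p) := by
        refine measure_mono fun u hu => ?_
        obtain ⟨p, hp, hup⟩ := exists_mem_gapGrid hm hU hu
        exact Set.mem_biUnion hp hup
    _ ≤ ∑ p ∈ gapGrid a l v m U, volume (gapCell a v m p) := measure_biUnion_finset_le _ _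
    _ = _ := by simp [volume_gapCell]

lemma card_gapGrid_add_le (hv : (Matrix.of v).det ≠ 0) (hav : GapProper a l v) (hm : 2 ≤ m) :
    ((gapGrid a l v m U + gapGrid a l v m V).card : ℝ≥0∞) *
        ENNReal.ofReal (|(Matrix.of v).det| * ((m : ℝ)⁻¹) ^ k) ≤
      volume (Metric.cthickening (2 / m * ∑ j, ‖v j‖) (U + V)) := by
  have hm' : (0 : ℝ) < m := by positivity
  have hm2 : (2 : ℝ) ≤ m := by exact_mod_cast hm
  have hbd : ∀ r ∈ gapGrid a l v m U + gapGrid a l v m V,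
      (∀ i, |r (.inl i)| ≤ 2 * l i) ∧ ∀ j, |r (.inr j)| ≤ 2 * m := by
    intro r hr
    obtain ⟨p, hp, q, hq, rfl⟩ := Finset.mem_add.1 hr
    rw [mem_gapGrid] at hp hq
    refine ⟨fun i => ?_, fun j => ?_⟩
    · have := abs_add_le (p (.inl i)) (q (.inl i))
      have := hp.1 i
      have := hq.1 i
      simp only [Pi.add_apply]
      linarith
    · have := abs_add_le (p (.inr j)) (q (.inr j))
      have := hp.2.1 j
      have := hq.2.1 j
      simp only [Pi.add_apply]
      linarith
  have hbdt : ∀ r ∈ gapGrid a l v m U + gapGrid a l v m V, ∀ t : Fin k → ℝ,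
      t ∈ (Set.univ.pi fun j => Ico ((r (.inr j) : ℝ) / m) ((r (.inr j) + 1) / m)) →
      ∀ j, |t j| ≤ 4 := by
    intro r hr t ht j
    have h1 := ht j trivial
    rw [Set.mem_Ico, div_le_iff₀ hm', lt_div_iff₀ hm'] at h1
    have h2 := (hbd r hr).2 j
    rw [abs_le] at h2 ⊢
    have h3 : (-(2 * m) : ℝ) ≤ r (.inr j) := by exact_mod_cast h2.1
    have h4 : (r (.inr j) : ℝ) ≤ 2 * m := by exact_mod_cast h2.2
    constructor <;> by_contra! h <;> nlinarith
  have hdisj : ((gapGrid a l v m U + gapGrid a l v m V : Finset _) : Set _).PairwiseDisjoint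
      (gapCell a v m) := by
    intro r hr r' hr' hne
    refine Set.disjoint_left.2 ?_
    rintro _ ⟨t, ht, rfl⟩ ⟨t', ht', heq⟩
    apply hne
    have h0 : ∑ i, ((r (.inl i) - r' (.inl i) : ℤ) : ℝ) • a i + ∑ j, (t j - t' j) • v j = 0 := by
      simp only [Int.cast_sub, sub_smul, Finset.sum_sub_distrib]
      simp only at heq
      linear_combination (exp := 1) -heq
    have h1 := hav (fun i => r (.inl i) - r' (.inl i)) (fun j => t j - t' j)
      (fun i => by
        have := abs_sub (r (.inl i)) (r' (.inl i))
        have := (hbd r hr).1 i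
        have := (hbd r' hr').1 i
        have : (0 : ℤ) ≤ l i := by positivity
        linarith)
      (fun j => by
        have := abs_sub (t j) (t' j)
        have := hbdt r hr t ht j
        have := hbdt r' hr' t' ht' j
        linarith) h0
    have h2 : ∀ i, r (.inl i) = r' (.inl i) := fun i => sub_eq_zero.1 (congrFun h1 i)
    have h3 : (fun j => t j - t' j) = 0 := by
      refine eq_zero_of_sum_smul_eq_zero hv ?_
      simpa [h2] using h0
    funext i
    rcases i with i | j
    · exact h2 i
    · have h4 : t j = t' j := sub_eq_zero.1 (congrFun h3 j)
      have h5 := ht j trivial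
      have h6 := ht' j trivial
      rw [Set.mem_Ico, div_le_iff₀ hm', lt_div_iff₀ hm'] at h5 h6
      rw [← h4] at h6
      have h7 : ⌊t j * m⌋ = r (.inr j) := Int.floor_eq_iff.2 h5
      rw [← h7]
      exact Int.floor_eq_iff.2 h6
  calc _ = ∑ p ∈ gapGrid a l v m U + gapGrid a l v m V, volume (gapCell a v m p) := by
        simp [volume_gapCell]
    _ = volume (⋃ p ∈ gapGrid a l v m U + gapGrid a l v m V, gapCell a v m p) :=
        (measure_biUnion_finset hdisj fun p _ => measurableSet_gapCell a hv m p).symm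
    _ ≤ _ := by
      refine measure_mono (Set.iUnion₂_subset fun r hr => ?_)
      rintro _ ⟨t, ht, rfl⟩
      obtain ⟨p, hp, q, hq, rfl⟩ := Finset.mem_add.1 hr
      obtain ⟨_, ⟨tp, htp, rfl⟩, hu⟩ := (mem_gapGrid.1 hp).2.2
      obtain ⟨_, ⟨tq, htq, rfl⟩, hw⟩ := (mem_gapGrid.1 hq).2.2
      refine Metric.mem_cthickening_of_dist_le _ _ _ _ (Set.add_mem_add hu hw) ?_
      rw [dist_eq_norm]
      have h1 : ∑ i, (((p + q) (.inl i) : ℤ) : ℝ) • a i + ∑ j, t j • v j -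
          (∑ i, (p (.inl i) : ℝ) • a i + ∑ j, tp j • v j +
            (∑ i, (q (.inl i) : ℝ) • a i + ∑ j, tq j • v j)) =
          ∑ j, (t j - tp j - tq j) • v j := by
        simp only [Pi.add_apply, Int.cast_add, add_smul, sub_smul, Finset.sum_sub_distrib,
          Finset.sum_add_distrib]
        abel
      simp only
      rw [h1, Finset.mul_sum]
      refine (norm_sum_le _ _).trans (Finset.sum_le_sum fun j _ => ?_)
      rw [norm_smul]
      gcongr
      have h2 := ht j trivial
      have h3 := htp j trivial
      have h4 := htq j trivial
      rw [Set.mem_Ico, div_le_iff₀ hm', lt_div_iff₀ hm'] at h2 h3 h4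
      simp only [Pi.add_apply, Int.cast_add] at h2
      rw [Real.norm_eq_abs, abs_le, le_div_iff₀ hm', ← neg_div, div_le_iff₀ hm']
      constructor <;> linarith [h2.1, h2.2, h3.1, h3.2, h4.1, h4.2]

end gapGrid

lemma isCompact_gapBox {k d : ℕ} (a : Fin d → Fin k → ℝ) (l : Fin d → ℕ) (v : Fin k → Fin k → ℝ) :
    IsCompact (gapBox a l v) := by
  have h1 : ((Fintype.piFinset fun i => Finset.Icc (-(l i : ℤ)) (l i) : Finset (Fin d → ℤ)) :
      Set (Fin d → ℤ)).Finite := Finset.finite_toSet _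
  have h2 : gapBox a l v = ⋃ n ∈ (Fintype.piFinset fun i => Finset.Icc (-(l i : ℤ)) (l i)),
      (fun t : Fin k → ℝ => ∑ i, ((n : Fin d → ℤ) i : ℝ) • a i + ∑ j, t j • v j) ''
        Set.univ.pi fun _ => Icc (-1 : ℝ) 1 := by
    ext x
    simp only [gapBox, Set.mem_iUnion, Set.mem_image, Fintype.mem_piFinset, Finset.mem_Icc,
      Set.mem_univ_pi, Set.mem_Icc, ← abs_le, exists_prop]
    constructor
    · rintro ⟨n, t, hn, ht, rfl⟩
      exact ⟨n, hn, t, ht, rfl⟩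
    · rintro ⟨n, hn, t, ht, rfl⟩
      exact ⟨n, t, hn, ht, rfl⟩
  rw [h2]
  exact h1.isCompact_biUnion fun n _ =>
    (isCompact_univ_pi fun _ => isCompact_Icc).image (by fun_prop)

lemma gapGrid_abs_sub_lt {k d : ℕ} {a : Fin d → Fin k → ℝ} {l : Fin d → ℕ}
    {v : Fin k → Fin k → ℝ} {m : ℕ} {U : Set (Fin k → ℝ)} :
    ∀ x ∈ gapGrid a l v m U, ∀ y ∈ gapGrid a l v m U, ∀ i,
      |x i - y i| < (Sum.elim (fun i => 2 * l i + 1) (fun _ => 2 * m + 1) i : ℕ) := by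
  intro x hx y hy i
  rw [mem_gapGrid] at hx hy
  have h1 := abs_sub (x i) (y i)
  rcases i with i | j
  · have h2 := hx.1 i
    have h3 := hy.1 i
    simp only [Sum.elim_inl]
    push_cast
    linarith
  · have h2 := hx.2.1 j
    have h3 := hy.2.1 j
    simp only [Sum.elim_inr]
    push_cast
    linarith

/-- The Brunn–Minkowski inequality for compact subsets of a proper structure box. -/
theorem bmSum_volume_le_of_isCompact (k d : ℕ) (hk : 1 ≤ k) : ∃ C : ℝ, 0 ≤ C ∧
    ∀ (a : Fin d → Fin k → ℝ) (l : Fin d → ℕ) (v : Fin k → Fin k → ℝ), (Matrix.of v).det ≠ 0 →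
      GapProper a l v → ∀ U V : Set (Fin k → ℝ), IsCompact U → IsCompact V → U.Nonempty →
      V.Nonempty → U ⊆ gapBox a l v → V ⊆ gapBox a l v →
      bmSum (k + d) (volume U).toReal (volume V).toReal ≤ (volume (U + V)).toReal +
        C * ((∏ i, (2 * l i + 1 : ℝ)) * |(Matrix.of v).det| * ∑ i, (2 * l i + 1 : ℝ)⁻¹) := by
  have : Nonempty (Fin k) := ⟨⟨0, hk⟩⟩
  obtain ⟨C, hC, hBM⟩ := bmSum_card_le_fintype (Fin d ⊕ Fin k)
  refine ⟨C * 3 ^ k, by positivity, fun a l v hv hav U V hUc hVc hUn hVn hU hV => ?_⟩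
  set P : ℝ := ∏ i, (2 * l i + 1 : ℝ) with hP
  set σl : ℝ := ∑ i, (2 * l i + 1 : ℝ)⁻¹ with hσ
  have hP0 : 0 ≤ P := by positivity
  have hσ0 : 0 ≤ σl := by positivity
  have hdet : 0 < |(Matrix.of v).det| := abs_pos.2 hv
  have hUVc : IsCompact (U + V) := hUc.add hVc
  have hbound : ∀ m : ℕ, 2 ≤ m → bmSum (k + d) (volume U).toReal (volume V).toReal ≤
      (volume (Metric.cthickening (2 / m * ∑ j, ‖v j‖) (U + V))).toReal +
        C * 3 ^ k * (P * |(Matrix.of v).det| * (σl + k * (2 * m + 1 : ℝ)⁻¹)) := by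
    intro m hm
    have hm' : (0 : ℝ) < m := by positivity
    have hm1 : (1 : ℝ) ≤ m := by exact_mod_cast (by omega : 1 ≤ m)
    set c : ℝ := |(Matrix.of v).det| * ((m : ℝ)⁻¹) ^ k with hc
    have hc0 : 0 ≤ c := by positivity
    have hUg : (volume U).toReal ≤ c * (gapGrid a l v m U).card := by
      have := ENNReal.toReal_mono (by finiteness) (volume_le_card_gapGrid (m := m) (by omega) hU)
      rwa [ENNReal.toReal_mul, ENNReal.toReal_natCast, ENNReal.toReal_ofReal hc0, mul_comm] at this
    have hVg : (volume V).toReal ≤ c * (gapGrid a l v m V).card := by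
      have := ENNReal.toReal_mono (by finiteness) (volume_le_card_gapGrid (m := m) (by omega) hV)
      rwa [ENNReal.toReal_mul, ENNReal.toReal_natCast, ENNReal.toReal_ofReal hc0, mul_comm] at this
    have hUVg : c * (gapGrid a l v m U + gapGrid a l v m V).card ≤
        (volume (Metric.cthickening (2 / m * ∑ j, ‖v j‖) (U + V))).toReal := by
      have := ENNReal.toReal_mono
        ((hUVc.isBounded.cthickening (δ := 2 / m * ∑ j, ‖v j‖)).measure_lt_top.ne)
        (card_gapGrid_add_le (U := U) (V := V) hv hav hm)
      rwa [ENNReal.toReal_mul, ENNReal.toReal_natCast, ENNReal.toReal_ofReal hc0, mul_comm] at this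
    have hne : ∀ {W : Set (Fin k → ℝ)}, W.Nonempty → W ⊆ gapBox a l v →
        (gapGrid a l v m W).Nonempty := fun ⟨w, hw⟩ hW => by
      obtain ⟨p, hp, -⟩ := exists_mem_gapGrid (m := m) (by omega) hW hw
      exact ⟨p, hp⟩
    have key := hBM (gapGrid a l v m U) (gapGrid a l v m V) _ (hne hUn hU) (hne hVn hV)
      gapGrid_abs_sub_lt gapGrid_abs_sub_lt
    rw [Fintype.card_sum, Fintype.card_fin, Fintype.card_fin, add_comm d k] at key
    simp only [Fintype.prod_sum_type, Fintype.sum_sum_type, Sum.elim_inl, Sum.elim_inr,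
      Finset.prod_const, Finset.sum_const, Finset.card_univ, Fintype.card_fin, nsmul_eq_mul] at key
    push_cast at key
    rw [← hP, ← hσ] at key
    calc _ ≤ bmSum (k + d) (c * (gapGrid a l v m U).card) (c * (gapGrid a l v m V).card) :=
          bmSum_mono _ ENNReal.toReal_nonneg ENNReal.toReal_nonneg hUg hVg
      _ = c * bmSum (k + d) (gapGrid a l v m U).card (gapGrid a l v m V).card :=
          bmSum_smul (by omega) hc0 (by positivity) (by positivity)
      _ ≤ c * ((gapGrid a l v m U + gapGrid a l v m V).card +
            C * (P * (2 * m + 1) ^ k * (σl + k * (2 * m + 1 : ℝ)⁻¹))) := by gcongr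
      _ ≤ _ := by
          rw [mul_add]
          refine add_le_add hUVg ?_
          have h1 : ((m : ℝ)⁻¹) ^ k * (2 * m + 1) ^ k ≤ 3 ^ k := by
            rw [← mul_pow]
            gcongr
            rw [inv_mul_le_iff₀ hm']
            linarith
          calc _ = (((m : ℝ)⁻¹) ^ k * (2 * m + 1) ^ k) *
                (C * (P * |(Matrix.of v).det| * (σl + k * (2 * m + 1 : ℝ)⁻¹))) := by
                rw [hc]; ring
            _ ≤ 3 ^ k * (C * (P * |(Matrix.of v).det| * (σl + k * (2 * m + 1 : ℝ)⁻¹))) := by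
                gcongr
            _ = _ := by ring
  have hlim1 : Filter.Tendsto (fun m : ℕ => (2 : ℝ) / m * ∑ j, ‖v j‖) Filter.atTop (nhds 0) := by
    simpa using (tendsto_const_div_atTop_nhds_zero_nat (2 : ℝ)).mul_const (∑ j, ‖v j‖)
  have hlim2 : Filter.Tendsto (fun m : ℕ =>
      (volume (Metric.cthickening ((2 : ℝ) / m * ∑ j, ‖v j‖) (U + V))).toReal) Filter.atTop
      (nhds (volume (U + V)).toReal) :=
    (ENNReal.tendsto_toReal hUVc.measure_lt_top.ne).comp
      ((tendsto_measure_cthickening_of_isCompact hUVc).comp hlim1)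
  have hlim3 : Filter.Tendsto (fun m : ℕ => (2 * m + 1 : ℝ)⁻¹) Filter.atTop (nhds 0) := by
    refine tendsto_inv_atTop_zero.comp ?_
    refine Filter.tendsto_atTop_add_const_right _ _ ?_
    exact tendsto_natCast_atTop_atTop.const_mul_atTop two_pos
  have hlim4 := hlim2.add (((hlim3.const_mul (k : ℝ)).const_add σl).const_mul
    (P * |(Matrix.of v).det|) |>.const_mul (C * 3 ^ k))
  rw [mul_zero, add_zero] at hlim4
  exact ge_of_tendsto hlim4 (Filter.eventually_atTop.2 ⟨2, hbound⟩)

lemma exists_isCompact_seq_tendsto {k : ℕ} {A : Set (Fin k → ℝ)} (hA : MeasurableSet A)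
    (hfin : volume A ≠ ⊤) (hne : A.Nonempty) : ∃ K : ℕ → Set (Fin k → ℝ),
      (∀ n, K n ⊆ A ∧ IsCompact (K n) ∧ (K n).Nonempty) ∧
      Filter.Tendsto (fun n => (volume (K n)).toReal) Filter.atTop (nhds (volume A).toReal) := by
  obtain ⟨x, hx⟩ := hne
  have h : ∀ n : ℕ, ∃ K ⊆ A, IsCompact K ∧ volume A < volume K + ((n : ℝ≥0∞) + 1)⁻¹ := fun n =>
    hA.exists_isCompact_lt_add hfin (by simp)
  choose K hKA hKc hK using h
  refine ⟨fun n => insert x (K n), fun n => ⟨Set.insert_subset hx (hKA n), (hKc n).insert x,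
    Set.insert_nonempty _ _⟩, ?_⟩
  have hfin' : ∀ n, volume (insert x (K n)) ≠ ⊤ := fun n =>
    ((measure_mono (Set.insert_subset hx (hKA n))).trans_lt hfin.lt_top).ne
  refine tendsto_of_tendsto_of_tendsto_of_le_of_le
    (g := fun n : ℕ => (volume A).toReal - ((n : ℝ) + 1)⁻¹) (h := fun _ => (volume A).toReal)
    ?_ tendsto_const_nhds (fun n => ?_) (fun n => ?_)
  · have := tendsto_one_div_add_atTop_nhds_zero_nat (𝕜 := ℝ)
    simpa using this.const_sub (volume A).toReal
  · have h1 : volume A ≤ volume (insert x (K n)) + ((n : ℝ≥0∞) + 1)⁻¹ :=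
      (hK n).le.trans (by gcongr; exact Set.subset_insert _ _)
    have h2 := ENNReal.toReal_mono
      (ENNReal.add_ne_top.2 ⟨hfin' n, ENNReal.inv_ne_top.2 (by simp)⟩) h1
    rw [ENNReal.toReal_add (hfin' n) (ENNReal.inv_ne_top.2 (by simp)), ENNReal.toReal_inv] at h2
    have h3 : ((n : ℝ≥0∞) + 1).toReal = (n : ℝ) + 1 := by
      rw [ENNReal.toReal_add (by simp) (by simp)]; simp
    rw [h3] at h2
    simp only
    linarith
  · exact ENNReal.toReal_mono hfin (measure_mono (Set.insert_subset hx (hKA n)))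

/-- The Brunn–Minkowski inequality for measurable subsets of translates of a proper structure
box. -/
theorem bmSum_volume_le (k d : ℕ) (hk : 1 ≤ k) : ∃ C : ℝ, 0 ≤ C ∧
    ∀ (a : Fin d → Fin k → ℝ) (l : Fin d → ℕ) (v : Fin k → Fin k → ℝ), (Matrix.of v).det ≠ 0 →
      GapProper a l v → ∀ (x y : Fin k → ℝ) (U V : Set (Fin k → ℝ)), MeasurableSet U →
      MeasurableSet V → U.Nonempty → V.Nonempty → (∀ u ∈ U, u - x ∈ gapBox a l v) →
      (∀ u ∈ V, u - y ∈ gapBox a l v) →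
      bmSum (k + d) (volume U).toReal (volume V).toReal ≤ (volume (U + V)).toReal +
        C * ((∏ i, (2 * l i + 1 : ℝ)) * |(Matrix.of v).det| * ∑ i, (2 * l i + 1 : ℝ)⁻¹) := by
  obtain ⟨C, hC, h⟩ := bmSum_volume_le_of_isCompact k d hk
  refine ⟨C, hC, fun a l v hv hav x y U V hUm hVm hUn hVn hU hV => ?_⟩
  have hb : ∀ (z : Fin k → ℝ) (W : Set (Fin k → ℝ)), (∀ u ∈ W, u - z ∈ gapBox a l v) →
      Bornology.IsBounded W := fun z W hW => by
    refine ((isCompact_gapBox a l v).image (f := fun u => u + z) (by fun_prop)).isBounded.subset ?_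
    exact fun u hu => ⟨u - z, hW u hu, sub_add_cancel u z⟩
  have hbU := hb x U hU
  have hbV := hb y V hV
  have hUV : volume (U + V) ≠ ⊤ := (hbU.add hbV).measure_lt_top.ne
  obtain ⟨K, hK, hKlim⟩ := exists_isCompact_seq_tendsto hUm hbU.measure_lt_top.ne hUn
  obtain ⟨M, hM, hMlim⟩ := exists_isCompact_seq_tendsto hVm hbV.measure_lt_top.ne hVn
  have hlim : Filter.Tendsto (fun n => bmSum (k + d) (volume (K n)).toReal (volume (M n)).toReal)
      Filter.atTop (nhds (bmSum (k + d) (volume U).toReal (volume V).toReal)) := by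
    unfold bmSum
    refine Filter.Tendsto.rpow_const (Filter.Tendsto.add ?_ ?_) (Or.inr (by positivity))
    · exact hKlim.rpow_const (Or.inr (by positivity))
    · exact hMlim.rpow_const (Or.inr (by positivity))
  refine le_of_tendsto' hlim fun n => ?_
  have htr : ∀ (z : Fin k → ℝ) (W : Set (Fin k → ℝ)),
      volume ((fun u => u - z) '' W) = volume W := fun z W => by
    simp only [sub_eq_add_neg, Set.image_add_right, neg_neg]
    exact measure_preimage_add_right _ _ _
  have key := h a l v hv hav ((fun u => u - x) '' K n) ((fun u => u - y) '' M n)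
    ((hK n).2.1.image (by fun_prop)) ((hM n).2.1.image (by fun_prop)) ((hK n).2.2.image _)
    ((hM n).2.2.image _) (by rintro _ ⟨u, hu, rfl⟩; exact hU u ((hK n).1 hu))
    (by rintro _ ⟨u, hu, rfl⟩; exact hV u ((hM n).1 hu))
  have hsum : (fun u => u - x) '' K n + (fun u => u - y) '' M n =
      (fun u => u - (x + y)) '' (K n + M n) := by
    ext w
    simp only [Set.mem_add, Set.mem_image]
    constructor
    · rintro ⟨_, ⟨p, hp, rfl⟩, _, ⟨q, hq, rfl⟩, rfl⟩
      exact ⟨p + q, ⟨p, hp, q, hq, rfl⟩, by abel⟩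
    · rintro ⟨_, ⟨p, hp, q, hq, rfl⟩, rfl⟩
      exact ⟨p - x, ⟨p, hp, rfl⟩, q - y, ⟨q, hq, rfl⟩, by abel⟩
  rw [hsum, htr, htr, htr] at key
  refine key.trans ?_
  gcongr
  · exact (hK n).1
  · exact (hM n).1

lemma exists_hom_int_forall_ne_zero_sum (k : ℕ) (T : Finset (Fin 0 ⊕ Fin k → ℤ)) (hT : 0 ∉ T) :
    ∃ f : (Fin 0 ⊕ Fin k → ℤ) →+ ℤ, ∀ t ∈ T, f t ≠ 0 := by
  classical
  let e : (Fin 0 ⊕ Fin k → ℤ) →+ (Fin k → ℤ) :=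
    { toFun := fun p j => p (.inr j), map_zero' := rfl, map_add' := fun _ _ => rfl }
  obtain ⟨f, hf⟩ := exists_hom_int_forall_ne_zero k (T.image e) (by
    simp only [Finset.mem_image, not_exists, not_and]
    intro t ht h0
    have : t = 0 := by
      funext i
      rcases i with i | j
      · exact i.elim0
      · exact congrFun h0 j
    exact hT (this ▸ ht))
  exact ⟨f.comp e, fun t ht => hf _ (Finset.mem_image_of_mem e ht)⟩

lemma sum_smul_single {k : ℕ} (r : ℝ) (t : Fin k → ℝ) :
    ∑ j, t j • (r • Pi.single j 1 : Fin k → ℝ) = r • t := by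
  funext i
  simp [Finset.sum_apply, Pi.single_apply, mul_comm]

lemma det_smul_single {k : ℕ} (r : ℝ) :
    (Matrix.of fun j : Fin k => (r • Pi.single j 1 : Fin k → ℝ)).det = r ^ k := by
  have : (Matrix.of fun j : Fin k => (r • Pi.single j 1 : Fin k → ℝ)) = r • 1 := by
    ext i j
    simp [Matrix.one_apply, Pi.single_apply, eq_comm]
  rw [this, Matrix.det_smul]
  simp

/-- Compact sets of small doubling are covered by few translates of a `gapBox`. -/
theorem exists_cover_of_isCompact (k K : ℕ) : ∃ D M : ℕ, ∀ A : Set (Fin k → ℝ), IsCompact A →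
    0 < volume A → volume (A + A) ≤ K * volume A →
    ∃ (d : ℕ) (X : Finset (Fin k → ℝ)) (a : Fin d → Fin k → ℝ) (l : Fin d → ℕ)
      (v : Fin k → Fin k → ℝ), d ≤ D ∧ X.card ≤ M ∧ (Matrix.of v).det ≠ 0 ∧
      (∀ u ∈ A, ∃ x ∈ X, u - x ∈ gapBox a l v) ∧
      (∏ i, (2 * l i + 1 : ℝ)) * |(Matrix.of v).det| ≤ M * (volume A).toReal := by
  classical
  obtain ⟨D, C, hF⟩ := exists_gap_cover_of_card_add_le (K + 1)
  refine ⟨D, C * (K + 1), fun A hA hpos hK => ?_⟩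
  have hne : A.Nonempty := nonempty_of_measure_ne_zero hpos.ne'
  have hfin : volume A ≠ ⊤ := hA.measure_lt_top.ne
  obtain ⟨R, hR1, hR⟩ : ∃ R : ℝ, 1 ≤ R ∧ ∀ u ∈ A, ‖u‖ ≤ R := by
    obtain ⟨R, hR⟩ := hA.isBounded.exists_norm_le
    exact ⟨max R 1, le_max_right _ _, fun u hu => (hR u hu).trans (le_max_left _ _)⟩
  have hR0 : 0 < R := by linarith
  let a₀ : Fin 0 → Fin k → ℝ := Fin.elim0
  let l₀ : Fin 0 → ℕ := Fin.elim0
  let v₀ : Fin k → Fin k → ℝ := fun j => R • Pi.single j 1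
  have hdet : (Matrix.of v₀).det = R ^ k := det_smul_single R
  have hdet0 : (Matrix.of v₀).det ≠ 0 := by rw [hdet]; positivity
  have hsub : A ⊆ gapBox a₀ l₀ v₀ := by
    intro u hu
    refine ⟨Fin.elim0, R⁻¹ • u, fun i => i.elim0, fun j => ?_, ?_⟩
    · rw [Pi.smul_apply, smul_eq_mul, abs_mul, abs_of_pos (inv_pos.2 hR0), inv_mul_le_iff₀ hR0,
        mul_one]
      exact (norm_le_pi_norm u j).trans (hR u hu)
    · simp only [v₀]
      rw [sum_smul_single, smul_smul, mul_inv_cancel₀ hR0.ne', one_smul]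
      simp
  have hprop : GapProper a₀ l₀ v₀ := fun n t _ _ _ => Subsingleton.elim _ _
  have hcomp : IsCompact (A + A) := hA.add hA
  -- thickenings of the sumset shrink to the sumset
  obtain ⟨m, hm2, hm⟩ : ∃ m : ℕ, 2 ≤ m ∧
      volume (Metric.cthickening (2 / m * ∑ j, ‖v₀ j‖) (A + A)) < (K + 1) * volume A := by
    have h1 : Filter.Tendsto (fun r => volume (Metric.cthickening r (A + A))) (nhds 0)
        (nhds (volume (A + A))) := tendsto_measure_cthickening_of_isCompact hcomp
    have h2 : Filter.Tendsto (fun m : ℕ => 2 / (m : ℝ) * ∑ j, ‖v₀ j‖) Filter.atTop (nhds 0) := by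
      have := (tendsto_const_div_atTop_nhds_zero_nat (2 : ℝ)).mul_const (∑ j, ‖v₀ j‖)
      simpa using this
    have h3 : volume (A + A) < (K + 1) * volume A := by
      refine hK.trans_lt ?_
      rw [add_mul, one_mul]
      exact ENNReal.lt_add_right (ENNReal.mul_ne_top (by simp) hfin) hpos.ne'
    obtain ⟨m, hm, hm2⟩ := (((h1.comp h2).eventually_lt_const h3).and
      (Filter.eventually_ge_atTop 2)).exists
    exact ⟨m, hm2, hm⟩
  have hm0 : 0 < m := by omega
  have hm0' : (0 : ℝ) < m := by exact_mod_cast hm0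
  obtain ⟨G, hG⟩ : ∃ G, G = gapGrid a₀ l₀ v₀ m A := ⟨_, rfl⟩
  have hvol := volume_le_card_gapGrid hm0 hsub
  have hcard := card_gapGrid_add_le (U := A) (V := A) hdet0 hprop hm2
  rw [← hG] at hvol hcard
  have hcell : |(Matrix.of v₀).det| * ((m : ℝ)⁻¹) ^ k = (R / m) ^ k := by
    rw [hdet, abs_of_pos (by positivity)]; rw [div_eq_mul_inv, mul_pow]
  rw [hcell] at hvol hcard
  have hc0 : 0 < (R / m) ^ k := by positivity
  have hcR : ((G + G).card : ℝ) * (R / m) ^ k ≤ (K + 1) * (volume A).toReal := by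
    have := ENNReal.toReal_mono (ENNReal.mul_ne_top (by simp) hfin) (hcard.trans hm.le)
    rw [ENNReal.toReal_mul, ENNReal.toReal_mul, ENNReal.toReal_ofReal hc0.le] at this
    simpa [ENNReal.toReal_add] using this
  have hvR : (volume A).toReal ≤ G.card * (R / m) ^ k := by
    have := ENNReal.toReal_mono (ENNReal.mul_ne_top (by simp) (by simp)) hvol
    rw [ENNReal.toReal_mul, ENNReal.toReal_ofReal hc0.le] at this
    simpa using this
  have hGne : G.Nonempty := by
    obtain ⟨u, hu⟩ := hne
    obtain ⟨p, hp, -⟩ := exists_mem_gapGrid hm0 hsub hu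
    exact ⟨p, hG ▸ hp⟩
  have hGG : (G + G).card ≤ (K + 1) * G.card := by
    have h1 : ((G + G).card : ℝ) * (R / m) ^ k ≤ ((K + 1) * G.card) * (R / m) ^ k := by
      rw [mul_assoc]
      exact hcR.trans (by gcongr)
    exact_mod_cast le_of_mul_le_mul_right h1 hc0
  obtain ⟨r, a, l, X, hr, hX, hl, hcov⟩ := hF (exists_hom_int_forall_ne_zero_sum k) G hGne hGG
  let φ : (Fin 0 ⊕ Fin k → ℤ) →+ (Fin k → ℝ) :=
    { toFun := fun p => (R / m) • fun j => (p (.inr j) : ℝ)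
      map_zero' := by ext; simp
      map_add' := fun p q => by ext; simp [mul_add] }
  have hGle : (G.card : ℝ) ≤ (G + G).card := by
    exact_mod_cast Finset.card_le_card_add_left hGne
  refine ⟨r, X.image φ, fun i => φ (a i), l, fun j => (R / m) • Pi.single j 1, hr,
    (Finset.card_image_le.trans hX).trans (Nat.le_mul_of_pos_right _ (by omega)), ?_, ?_, ?_⟩
  · rw [det_smul_single]; positivity
  · intro u hu
    obtain ⟨p, hp, t, ht, rfl⟩ := exists_mem_gapGrid hm0 hsub hu
    obtain ⟨y, hy, n, hn, hpn⟩ := hcov p (hG ▸ hp)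
    refine ⟨φ y, Finset.mem_image_of_mem _ hy, n, fun j => m * t j - p (.inr j), hn,
      fun j => ?_, ?_⟩
    · have := ht j (mem_univ j)
      rw [Set.mem_Ico, div_le_iff₀ hm0', lt_div_iff₀ hm0'] at this
      rw [abs_le]
      constructor <;> nlinarith [this.1, this.2]
    · have h1 : φ p = φ y + ∑ i, (n i : ℝ) • φ (a i) := by
        rw [hpn, map_add, map_sum]
        simp only [map_zsmul, Int.cast_smul_eq_zsmul]
      simp only [v₀]
      rw [sum_smul_single, sum_smul_single, Finset.univ_eq_empty, Finset.sum_empty, zero_add,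
        sub_eq_iff_eq_add]
      have h2 : (R / m) • (fun j => (m : ℝ) * t j - p (.inr j)) = R • t - φ p := by
        funext j
        simp only [φ, Pi.smul_apply, Pi.sub_apply, smul_eq_mul, AddMonoidHom.coe_mk, ZeroHom.coe_mk]
        field_simp
      rw [h2, h1]
      abel
  · rw [det_smul_single, abs_of_pos hc0]
    have h1 : (∏ i, (2 * l i + 1 : ℝ)) ≤ C * G.card := by exact_mod_cast hl
    calc (∏ i, (2 * l i + 1 : ℝ)) * (R / m) ^ k ≤ (C * (G + G).card) * (R / m) ^ k := by
          gcongr; exact h1.trans (by gcongr)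
      _ = C * ((G + G).card * (R / m) ^ k) := by ring
      _ ≤ C * ((K + 1) * (volume A).toReal) := by gcongr
      _ = _ := by push_cast; ring

/-- Ruzsa's covering lemma for measurable sets. -/
lemma exists_finset_subset_add_sub {k K : ℕ} {A B : Set (Fin k → ℝ)} (hB : MeasurableSet B)
    (hB0 : 0 < volume B) (hBfin : volume B ≠ ⊤) (hAB : volume (A + B) ≤ K * volume B) :
    ∃ Y : Finset (Fin k → ℝ), Y.card ≤ K ∧ ∀ u ∈ A, ∃ y ∈ Y, ∃ b ∈ B, ∃ b' ∈ B, u = y + b - b' := by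
  classical
  let good : Finset (Fin k → ℝ) → Prop := fun Y =>
    (Y : Set (Fin k → ℝ)) ⊆ A ∧ (Y : Set (Fin k → ℝ)).PairwiseDisjoint fun y => y +ᵥ B
  have hcard : ∀ Y, good Y → Y.card ≤ K := by
    rintro Y ⟨hYA, hYd⟩
    have h1 : (Y.card : ℝ≥0∞) * volume B ≤ K * volume B := by
      calc (Y.card : ℝ≥0∞) * volume B = ∑ y ∈ Y, volume (y +ᵥ B) := by simp [measure_vadd]
        _ = volume (⋃ y ∈ Y, y +ᵥ B) :=
          (measure_biUnion_finset hYd fun y _ => hB.const_vadd y).symm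
        _ ≤ volume (A + B) := by
          refine measure_mono (Set.iUnion₂_subset fun y hy => ?_)
          rintro _ ⟨b, hb, rfl⟩
          exact Set.add_mem_add (hYA hy) hb
        _ ≤ _ := hAB
    have h2 := (ENNReal.mul_le_mul_iff_left hB0.ne' hBfin).1 h1
    exact_mod_cast h2
  obtain ⟨Y, hY, hmax⟩ : ∃ Y, good Y ∧ ∀ Z, good Z → Z.card ≤ Y.card := by
    obtain ⟨Y, hY, hYn⟩ := Nat.findGreatest_spec (P := fun n => ∃ Y, good Y ∧ Y.card = n)
      (Nat.zero_le K) ⟨∅, ⟨by simp, by simp⟩, rfl⟩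
    exact ⟨Y, hY, fun Z hZ => hYn ▸ Nat.le_findGreatest (hcard Z hZ) ⟨Z, hZ, rfl⟩⟩
  refine ⟨Y, hcard Y hY, fun u hu => ?_⟩
  by_contra! hcon
  have hBne : B.Nonempty := nonempty_of_measure_ne_zero hB0.ne'
  have huY : u ∉ Y := by
    intro huY
    obtain ⟨b, hb⟩ := hBne
    exact hcon u huY b hb b hb (by simp)
  have hgood : good (insert u Y) := by
    refine ⟨?_, ?_⟩
    · rw [Finset.coe_insert]
      exact Set.insert_subset hu hY.1
    · rw [Finset.coe_insert]
      refine hY.2.insert fun y hy _ => ?_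
      rw [Set.disjoint_left]
      rintro _ ⟨b, hb, rfl⟩ ⟨b', hb', h⟩
      refine hcon y hy b' hb' b hb ?_
      have h' : y + b' = u + b := h
      rw [h', add_sub_cancel_right]
  have := hmax _ hgood
  rw [Finset.card_insert_of_notMem huY] at this
  omega

lemma sub_mem_gapBox_two {k d : ℕ} {a : Fin d → Fin k → ℝ} {l : Fin d → ℕ}
    {v : Fin k → Fin k → ℝ} {x y : Fin k → ℝ} (hx : x ∈ gapBox a l v) (hy : y ∈ gapBox a l v) :
    x - y ∈ gapBox a (fun i => 2 * l i) fun j => (2 : ℝ) • v j := by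
  obtain ⟨n, t, hn, ht, rfl⟩ := hx
  obtain ⟨n', t', hn', ht', rfl⟩ := hy
  refine ⟨n - n', fun j => (t j - t' j) / 2, fun i => ?_, fun j => ?_, ?_⟩
  · have := abs_sub (n i) (n' i)
    have := hn i
    have := hn' i
    simp only [Pi.sub_apply]
    push_cast
    linarith
  · have := abs_sub (t j) (t' j)
    have := ht j
    have := ht' j
    rw [abs_div, abs_two]
    linarith
  · simp only [smul_smul, Pi.sub_apply, Int.cast_sub, sub_smul, Finset.sum_sub_distrib,
      div_mul_cancel₀ _ (two_ne_zero' ℝ)]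
    abel

lemma det_of_smul {k : ℕ} (r : ℝ) (v : Fin k → Fin k → ℝ) :
    (Matrix.of fun j => r • v j).det = r ^ k * (Matrix.of v).det := by
  have : (Matrix.of fun j => r • v j) = r • Matrix.of v := rfl
  rw [this, Matrix.det_smul, Fintype.card_fin]

lemma prod_two_mul_add_one_le {d : ℕ} (c : ℕ) (hc : 1 ≤ c) (l : Fin d → ℕ) :
    ∏ i, (2 * (c * l i : ℕ) + 1 : ℝ) ≤ c ^ d * ∏ i, (2 * l i + 1 : ℝ) := by
  have hc' : (1 : ℝ) ≤ c := by exact_mod_cast hc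
  calc ∏ i, (2 * (c * l i : ℕ) + 1 : ℝ) ≤ ∏ i, (c * (2 * l i + 1) : ℝ) := by
        refine Finset.prod_le_prod (fun i _ => by positivity) fun i _ => ?_
        push_cast
        linarith
    _ = _ := by rw [Finset.prod_mul_distrib]; simp

/-- Measurable sets of small doubling are covered by few translates of a `gapBox`. -/
theorem exists_cover_of_volume_add_le (k K : ℕ) : ∃ (D M : ℕ) (B : ℝ), ∀ A : Set (Fin k → ℝ),
    MeasurableSet A → 0 < volume A → volume A ≠ ⊤ → volume (A + A) ≤ K * volume A →
    ∃ (d : ℕ) (X : Finset (Fin k → ℝ)) (a : Fin d → Fin k → ℝ) (l : Fin d → ℕ)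
      (v : Fin k → Fin k → ℝ), d ≤ D ∧ X.card ≤ M ∧ (Matrix.of v).det ≠ 0 ∧
      (∀ u ∈ A, ∃ x ∈ X, u - x ∈ gapBox a l v) ∧
      (∏ i, (2 * l i + 1 : ℝ)) * |(Matrix.of v).det| ≤ B * (volume A).toReal := by
  classical
  obtain ⟨D, M, h⟩ := exists_cover_of_isCompact k (2 * K)
  refine ⟨D, 2 * K * (M * M), 2 ^ D * 2 ^ k * M, fun A hA hpos hfin hK => ?_⟩
  obtain ⟨A', hA'A, hA', hlt⟩ : ∃ A' ⊆ A, IsCompact A' ∧ volume A < volume A' + volume A / 2 :=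
    hA.exists_isCompact_lt_add hfin (by simpa using hpos.ne')
  have hhalf : volume A ≤ 2 * volume A' := by
    have h1 : volume A / 2 ≤ volume A' := by
      have h2 : volume A / 2 + volume A / 2 < volume A' + volume A / 2 := by
        rwa [ENNReal.add_halves]
      exact (lt_of_add_lt_add_right h2).le
    calc volume A = 2 * (volume A / 2) := (ENNReal.mul_div_cancel two_ne_zero ofNat_ne_top).symm
      _ ≤ _ := by gcongr
  have hpos' : 0 < volume A' := by
    rcases eq_or_ne (volume A') 0 with h0 | h0
    · rw [h0, mul_zero] at hhalf
      exact absurd hhalf (not_le.2 hpos)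
    · exact pos_iff_ne_zero.2 h0
  have hfin' : volume A' ≠ ⊤ := hA'.measure_lt_top.ne
  have hK2 : (K : ℝ≥0∞) * volume A ≤ ((2 * K : ℕ) : ℝ≥0∞) * volume A' := by
    calc (K : ℝ≥0∞) * volume A ≤ K * (2 * volume A') := by gcongr
      _ = _ := by push_cast; ring
  obtain ⟨d, X, a, l, v, hd, hX, hv, hcov, hsize⟩ := h A' hA' hpos'
    ((measure_mono (Set.add_subset_add hA'A hA'A)).trans (hK.trans hK2))
  obtain ⟨Y, hY, hAY⟩ := exists_finset_subset_add_sub (A := A) hA'.measurableSet hpos' hfin'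
    ((measure_mono (Set.add_subset_add_left hA'A)).trans (hK.trans hK2))
  refine ⟨d, Y + (X - X), a, fun i => 2 * l i, fun j => (2 : ℝ) • v j, hd, ?_, ?_, ?_, ?_⟩
  · calc (Y + (X - X)).card ≤ Y.card * (X - X).card := Finset.card_add_le
      _ ≤ Y.card * (X.card * X.card) := by gcongr; exact Finset.card_sub_le
      _ ≤ _ := by gcongr
  · rw [det_of_smul]
    exact mul_ne_zero (by positivity) hv
  · intro u hu
    obtain ⟨y, hy, b, hb, b', hb', rfl⟩ := hAY u hu
    obtain ⟨x, hx, hbx⟩ := hcov b hb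
    obtain ⟨x', hx', hbx'⟩ := hcov b' hb'
    refine ⟨y + (x - x'), Finset.add_mem_add hy (Finset.sub_mem_sub hx hx'), ?_⟩
    have := sub_mem_gapBox_two hbx hbx'
    convert this using 1
    abel
  · have h1 : (volume A').toReal ≤ (volume A).toReal :=
      ENNReal.toReal_mono hfin (measure_mono hA'A)
    have h2 := prod_two_mul_add_one_le 2 one_le_two l
    rw [det_of_smul, abs_mul, abs_of_pos (by positivity : (0 : ℝ) < 2 ^ k)]
    calc (∏ i, (2 * (2 * l i : ℕ) + 1 : ℝ)) * (2 ^ k * |(Matrix.of v).det|)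
        ≤ (2 ^ d * ∏ i, (2 * l i + 1 : ℝ)) * (2 ^ k * |(Matrix.of v).det|) := by
          gcongr; exact_mod_cast h2
      _ = 2 ^ d * 2 ^ k * ((∏ i, (2 * l i + 1 : ℝ)) * |(Matrix.of v).det|) := by ring
      _ ≤ 2 ^ D * 2 ^ k * (M * (volume A).toReal) := by
          have h3 : (2 : ℝ) ^ d ≤ 2 ^ D := pow_le_pow_right₀ one_le_two hd
          exact mul_le_mul (by gcongr) (hsize.trans (by gcongr)) (by positivity) (by positivity)
      _ = _ := by ring

/-- A parallelotope thickened along one of its vectors lies in a parallelotope of comparable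
volume. -/
lemma exists_parallelotope_enlarge {k : ℕ} {v : Fin k → Fin k → ℝ} (hv : (Matrix.of v).det ≠ 0)
    {τ : Fin k → ℝ} (hτ : ∀ j, |τ j| ≤ 8) {ρ : ℝ} (hρ : 0 ≤ ρ) :
    ∃ v' : Fin k → Fin k → ℝ, (Matrix.of v').det ≠ 0 ∧
      |(Matrix.of v').det| ≤ 2 ^ k * (8 * ρ + 1) * |(Matrix.of v).det| ∧
      ∀ (t : Fin k → ℝ) (r : ℝ), (∀ j, |t j| ≤ 1) → |r| ≤ ρ →
        ∃ t' : Fin k → ℝ, (∀ j, |t' j| ≤ 1) ∧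
          ∑ j, t' j • v' j = ∑ j, t j • v j + r • ∑ j, τ j • v j := by
  by_cases h0 : ∀ j, τ j = 0
  · refine ⟨v, hv, ?_, fun t r ht _ => ⟨t, ht, by simp [h0]⟩⟩
    have : (1 : ℝ) ≤ 2 ^ k := one_le_pow₀ one_le_two
    exact le_mul_of_one_le_left (abs_nonneg _) (by nlinarith)
  push Not at h0
  obtain ⟨j₁, hj₁⟩ := h0
  obtain ⟨j₀, -, hmax⟩ := Finset.exists_max_image Finset.univ (fun j => |τ j|) ⟨j₁, Finset.mem_univ _⟩
  have hτ0 : τ j₀ ≠ 0 := by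
    have := hmax j₁ (Finset.mem_univ _)
    have h1 : 0 < |τ j₁| := abs_pos.2 hj₁
    exact abs_pos.1 (by linarith)
  have habs : 0 < |τ j₀| := abs_pos.2 hτ0
  obtain ⟨σ, hσ⟩ : ∃ σ, σ = ρ + |τ j₀|⁻¹ := ⟨_, rfl⟩
  have hσ0 : 0 < σ := by rw [hσ]; positivity
  let w : Fin k → ℝ := ∑ j, τ j • v j
  let v' : Fin k → Fin k → ℝ := Function.update (fun j => (2 : ℝ) • v j) j₀ (σ • w)
  have hdet : (Matrix.of v').det = σ * τ j₀ / 2 * (2 ^ k * (Matrix.of v).det) := by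
    have h1 : Matrix.of v' = ((2 : ℝ) • Matrix.of v).updateRow j₀
        (∑ j, (σ * τ j / 2) • ((2 : ℝ) • Matrix.of v) j) := by
      have h2 : σ • w = ∑ j, (σ * τ j / 2) • ((2 : ℝ) • Matrix.of v) j := by
        rw [Finset.smul_sum]
        refine Finset.sum_congr rfl fun j _ => ?_
        funext i
        simp only [Pi.smul_apply, smul_eq_mul, Matrix.smul_apply, Matrix.of_apply]
        ring
      rw [← h2]
      rfl
    rw [h1, Matrix.det_updateRow_sum, Matrix.det_smul, Fintype.card_fin, smul_eq_mul]
  refine ⟨v', ?_, ?_, ?_⟩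
  · rw [hdet]
    exact mul_ne_zero (div_ne_zero (mul_ne_zero hσ0.ne' hτ0) two_ne_zero)
      (mul_ne_zero (by positivity) hv)
  · rw [hdet, abs_mul, abs_mul, abs_div, abs_mul, abs_of_pos hσ0,
      abs_of_pos (by positivity : (0 : ℝ) < 2 ^ k), abs_two]
    have h1 : σ * |τ j₀| ≤ 8 * ρ + 1 := by
      rw [hσ, add_mul, inv_mul_cancel₀ habs.ne']
      nlinarith [hτ j₀]
    have h2 : σ * |τ j₀| / 2 ≤ 8 * ρ + 1 := by
      have : 0 ≤ σ * |τ j₀| := by positivity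
      linarith
    calc σ * |τ j₀| / 2 * (2 ^ k * |(Matrix.of v).det|)
        ≤ (8 * ρ + 1) * (2 ^ k * |(Matrix.of v).det|) := by gcongr
      _ = _ := by ring
  · intro t r ht hr
    let t' : Fin k → ℝ := Function.update (fun j => (t j - t j₀ * τ j / τ j₀) / 2) j₀
      ((r + t j₀ / τ j₀) / σ)
    refine ⟨t', fun j => ?_, ?_⟩
    · by_cases hj : j = j₀
      · subst hj
        simp only [t', Function.update_self]
        rw [abs_div, abs_of_pos hσ0, div_le_one hσ0, hσ]
        refine (abs_add_le _ _).trans (add_le_add hr ?_)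
        rw [abs_div, ← one_div]
        exact div_le_div_of_nonneg_right (ht j) habs.le
      · simp only [t', Function.update_of_ne hj]
        rw [abs_div, abs_two, div_le_one two_pos]
        refine (abs_sub _ _).trans ?_
        have h1 : |t j₀ * τ j / τ j₀| ≤ 1 := by
          rw [abs_div, abs_mul, div_le_one habs]
          have := hmax j (Finset.mem_univ _)
          calc |t j₀| * |τ j| ≤ 1 * |τ j₀| := by gcongr; exact ht j₀
            _ = _ := one_mul _
        have := ht j
        linarith
    · rw [← Finset.add_sum_erase _ _ (Finset.mem_univ j₀)]
      have h1 : ∑ j ∈ Finset.univ.erase j₀, t' j • v' j =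
          ∑ j ∈ Finset.univ.erase j₀, (t j - t j₀ * τ j / τ j₀) • v j := by
        refine Finset.sum_congr rfl fun j hj => ?_
        have hj' := Finset.ne_of_mem_erase hj
        simp only [t', v', Function.update_of_ne hj', smul_smul]
        rw [div_mul_cancel₀ _ two_ne_zero]
      have h2 : ∑ j ∈ Finset.univ.erase j₀, (t j - t j₀ * τ j / τ j₀) • v j =
          ∑ j, (t j - t j₀ * τ j / τ j₀) • v j := by
        rw [← Finset.add_sum_erase Finset.univ _ (Finset.mem_univ j₀), mul_div_cancel_right₀ _ hτ0,
          sub_self, zero_smul, zero_add]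
      have h3 : t' j₀ • v' j₀ = (r + t j₀ / τ j₀) • w := by
        simp only [t', v', Function.update_self, smul_smul]
        rw [div_mul_cancel₀ _ hσ0.ne']
      rw [h1, h2, h3]
      simp only [sub_smul, Finset.sum_sub_distrib, add_smul]
      have h4 : ∑ j, (t j₀ * τ j / τ j₀) • v j = (t j₀ / τ j₀) • w := by
        rw [Finset.smul_sum]
        refine Finset.sum_congr rfl fun j _ => ?_
        rw [smul_smul]; congr 1; ring
      rw [h4]
      abel

/-- The weighted `ℓ¹` norm. -/
noncomputable def weightedNorm {ι : Type*} [Fintype ι] (l : ι → ℕ) (y : ι → ℝ) : ℝ :=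
  ∑ i, |y i| / l i

section weightedNorm

variable {ι : Type*} [Fintype ι] {l : ι → ℕ}

lemma weightedNorm_add_le (x y : ι → ℝ) :
    weightedNorm l (x + y) ≤ weightedNorm l x + weightedNorm l y := by
  rw [weightedNorm, weightedNorm, weightedNorm, ← Finset.sum_add_distrib]
  refine Finset.sum_le_sum fun i _ => ?_
  rw [← add_div]
  exact div_le_div_of_nonneg_right (abs_add_le _ _) (Nat.cast_nonneg _)

lemma weightedNorm_smul (r : ℝ) (x : ι → ℝ) :
    weightedNorm l (r • x) = |r| * weightedNorm l x := by
  simp [weightedNorm, Finset.mul_sum, abs_mul, mul_div_assoc]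

lemma weightedNorm_sum_smul_le {κ : Type*} (s : Finset κ) (m : κ → ℝ) (e : κ → ι → ℝ) :
    weightedNorm l (∑ i ∈ s, m i • e i) ≤ ∑ i ∈ s, |m i| * weightedNorm l (e i) := by
  classical
  induction s using Finset.induction_on with
  | empty => simp [weightedNorm]
  | insert i s hi ih =>
    rw [Finset.sum_insert hi, Finset.sum_insert hi, ← weightedNorm_smul]
    exact (weightedNorm_add_le _ _).trans (by gcongr)

lemma abs_le_of_weightedNorm_le (hl : ∀ i, 1 ≤ l i) {y : ι → ℝ} {R : ℝ}
    (h : weightedNorm l y ≤ R) (i : ι) : |y i| ≤ R * l i := by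
  have hli : (0 : ℝ) < l i := by exact_mod_cast hl i
  rw [← div_le_iff₀ hli]
  refine le_trans ?_ h
  exact Finset.single_le_sum (f := fun i => |y i| / (l i : ℝ)) (fun i _ => by positivity)
    (Finset.mem_univ i)

lemma weightedNorm_le_of_abs_le (hl : ∀ i, 1 ≤ l i) {y : ι → ℝ} {R : ℝ}
    (h : ∀ i, |y i| ≤ R * l i) : weightedNorm l y ≤ Fintype.card ι * R := by
  calc weightedNorm l y ≤ ∑ _i : ι, R := by
        refine Finset.sum_le_sum fun i _ => ?_
        have hli : (0 : ℝ) < l i := by exact_mod_cast hl i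
        rw [div_le_iff₀ hli]
        exact h i
    _ = _ := by simp

lemma isLatticeNorm_weightedNorm (hl : ∀ i, 1 ≤ l i) :
    IsLatticeNorm fun n : ι → ℤ => weightedNorm l fun i => (n i : ℝ) := by
  classical
  refine ⟨fun x y => ?_, fun m x => ?_, fun R => ?_⟩
  · have := weightedNorm_add_le (l := l) (fun i => (x i : ℝ)) fun i => (y i : ℝ)
    convert this using 2
    funext i
    simp
  · rw [← weightedNorm_smul]
    congr 1
    funext i
    simp
  · refine (Finset.finite_toSet (Fintype.piFinset fun i =>
      Finset.Icc (-⌊R * l i⌋) ⌊R * l i⌋)).subset fun x hx => ?_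
    simp only [Finset.mem_coe, Fintype.mem_piFinset, Finset.mem_Icc]
    intro i
    have h1 := abs_le_of_weightedNorm_le hl hx i
    have h2 : |x i| ≤ ⌊R * l i⌋ := by
      rw [Int.le_floor]
      exact_mod_cast h1
    exact abs_le.1 h2

end weightedNorm

/-- Quotienting a box in `ℤ^(d+1)` by a short primitive vector. -/
theorem exists_box_quotient (d : ℕ) : ∃ T : ℝ, 0 ≤ T ∧ ∀ (l : Fin (d + 1) → ℕ)
    (μ : Fin (d + 1) → ℤ) (f : (Fin (d + 1) → ℤ) →ₗ[ℤ] ℤ), (∀ i, 1 ≤ l i) → f μ = 1 →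
    (∀ i, |μ i| ≤ 8 * l i) →
    ∃ (β : Fin d → Fin (d + 1) → ℤ) (s : Fin d → ℝ) (l' : Fin d → ℕ) (ρ : ℝ), 0 ≤ ρ ∧
      (∀ n : Fin (d + 1) → ℤ, (∀ i, |n i| ≤ l i) → ∃ (m : Fin d → ℤ) (p : ℤ),
        (∀ i, |m i| ≤ l' i) ∧ n = ∑ i, m i • β i + p • μ ∧ |p - ∑ i, m i * s i| ≤ ρ) ∧
      (∏ i, (2 * l' i + 1 : ℝ)) * (8 * ρ + 1) ≤ T * ∏ i, (2 * l i + 1 : ℝ) := by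
  classical
  obtain ⟨C, hC1, hC⟩ := exists_reduced_basis d
  obtain ⟨T₀, hT₀⟩ : ∃ T₀ : ℝ, T₀ = (d + 1) + 2 * d * C * (d + 1) := ⟨_, rfl⟩
  obtain ⟨T₁, hT₁⟩ : ∃ T₁ : ℕ, T₁ = ⌈2 * d * C * (d + 1) + 1 + 4 * (d + 1)⌉₊ := ⟨_, rfl⟩
  have hT₀0 : 0 ≤ T₀ := by rw [hT₀]; positivity
  have hT₁1 : 1 ≤ T₁ := by
    rw [hT₁, Nat.one_le_ceil_iff]; positivity
  refine ⟨2 * (8 * T₀ + 1) * T₁ ^ (d + 1), by positivity, fun l μ f hl hfμ hμ => ?_⟩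
  obtain ⟨N, hN⟩ : ∃ N : (Fin (d + 1) → ℤ) → ℝ, N = fun n => weightedNorm l fun i => (n i : ℝ) :=
    ⟨_, rfl⟩
  have hNl : IsLatticeNorm N := hN ▸ isLatticeNorm_weightedNorm hl
  have hμ0 : μ ≠ 0 := by
    rintro rfl
    simp at hfμ
  have hNμ : 0 < N μ := hNl.pos hμ0
  have hNμ8 : N μ ≤ 8 * (d + 1) := by
    have := weightedNorm_le_of_abs_le hl (y := fun i => (μ i : ℝ)) (R := 8)
      (fun i => by exact_mod_cast hμ i)
    rw [Fintype.card_fin] at this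
    rw [hN]
    push_cast at this
    linarith
  let π : (Fin (d + 1) → ℤ) →+ LinearMap.ker f :=
    { toFun := fun x => ⟨x - f x • μ, by
        rw [LinearMap.mem_ker, map_sub, map_smul, hfμ, smul_eq_mul, mul_one, sub_self]⟩
      map_zero' := by ext; simp
      map_add' := fun x y => by
        ext i
        simp [add_mul]
        ring }
  have hπval : ∀ x, (π x : Fin (d + 1) → ℤ) = x - f x • μ := fun x => rfl
  have hπ : Function.Surjective π := fun y => ⟨y, by
    have hy : f (y : Fin (d + 1) → ℤ) = 0 := y.2
    ext i
    simp [hπval, hy]⟩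
  have hπμ : π μ = 0 := by
    ext i
    simp [hπval, hfμ]
  have hker : ∀ x, π x = 0 → ∃ m : ℤ, x = m • μ := fun x hx =>
    ⟨f x, sub_eq_zero.1 (by rw [← hπval, hx]; rfl)⟩
  have hrank : Module.finrank ℤ (LinearMap.ker f) = d := by
    have h1 := f.ker.finrank_quotient_add_finrank
    rw [f.quotKerEquivRange.finrank_eq] at h1
    have h2 : LinearMap.range f = ⊤ := LinearMap.range_eq_top.2 fun m =>
      ⟨m • μ, by rw [map_smul, hfμ, smul_eq_mul, mul_one]⟩
    rw [h2, finrank_top, Module.finrank_self, Module.finrank_fin_fun] at h1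
    omega
  have hQ := hNl.isLatticeNorm_quotient hπ hπμ hker
  obtain ⟨Q, hQdef⟩ : ∃ Q, Q = IsLatticeNorm.quotient N π := ⟨_, rfl⟩
  rw [← hQdef] at hQ
  obtain ⟨c, hcpos, hcgen, hcC⟩ := hC (LinearMap.ker f) Q hQ hrank
  have hz : ∀ i, ∃ (q : ℕ) (z : Fin (d + 1) → ℤ), 0 < q ∧ π z = q • c i ∧ N z / q < 2 * Q (c i) :=
    fun i => IsLatticeNorm.exists_of_quotient_lt hπ (by
      rw [← hQdef]
      linarith [hcpos i])
  choose q z hq hzc hzN using hz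
  let s : Fin d → ℝ := fun i => f (z i) / q i
  let e : Fin d → Fin (d + 1) → ℝ := fun i j => ((c i : Fin (d + 1) → ℤ) j : ℝ) + s i * μ j
  have he : ∀ i, weightedNorm l (e i) ≤ 2 * Q (c i) := by
    intro i
    have hqi : (0 : ℝ) < q i := by exact_mod_cast hq i
    have h1 : e i = (q i : ℝ)⁻¹ • fun j => (z i j : ℝ) := by
      funext j
      have h2 := congrArg (fun y : LinearMap.ker f => ((y : Fin (d + 1) → ℤ) j : ℝ)) (hzc i)
      simp only [hπval, Pi.sub_apply, Pi.smul_apply, smul_eq_mul, Int.cast_sub, Int.cast_mul,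
        Submodule.coe_smul_of_tower, nsmul_eq_mul, Int.cast_natCast] at h2
      simp only [e, s, Pi.smul_apply, smul_eq_mul]
      field_simp
      linarith
    rw [h1, weightedNorm_smul, abs_of_pos (inv_pos.2 hqi)]
    have := (hzN i).le
    rw [hN, div_eq_inv_mul] at this
    exact this
  let l' : Fin d → ℕ := fun i => ⌊C * (d + 1) / Q (c i)⌋₊
  have hl'iff : ∀ i (m : ℤ), |m| ≤ l' i ↔ |(m : ℝ)| * Q (c i) ≤ C * (d + 1) := by
    intro i m
    rw [← le_div_iff₀ (hcpos i)]
    have h1 : (|m| : ℤ) = (m.natAbs : ℤ) := (Int.natCast_natAbs m).symm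
    have h2 : |(m : ℝ)| = (m.natAbs : ℝ) := by
      rw [Nat.cast_natAbs, Int.cast_abs]
    rw [h1, h2]
    have h3 : (0 : ℝ) ≤ C * (d + 1) / Q (c i) := by
      have := hcpos i
      positivity
    rw [← Nat.le_floor_iff h3]
    exact Int.ofNat_le
  have hcomb : ∀ m : Fin d → ℤ, (∀ i, |m i| ≤ l' i) →
      weightedNorm l (∑ i, (m i : ℝ) • e i) ≤ 2 * d * C * (d + 1) := by
    intro m hm
    calc weightedNorm l (∑ i, (m i : ℝ) • e i) ≤ ∑ i, |(m i : ℝ)| * weightedNorm l (e i) :=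
          weightedNorm_sum_smul_le _ _ _
      _ ≤ ∑ _i : Fin d, 2 * (C * (d + 1)) := by
          refine Finset.sum_le_sum fun i _ => ?_
          have h1 := (hl'iff i (m i)).1 (hm i)
          calc |(m i : ℝ)| * weightedNorm l (e i) ≤ |(m i : ℝ)| * (2 * Q (c i)) := by
                gcongr; exact he i
            _ = 2 * (|(m i : ℝ)| * Q (c i)) := by ring
            _ ≤ _ := by gcongr
      _ = _ := by simp; ring
  have hsplit : ∀ (m : Fin d → ℤ) (p : ℤ),
      (fun j => ((∑ i, m i • (c i : Fin (d + 1) → ℤ) + p • μ) j : ℝ)) =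
        ∑ i, (m i : ℝ) • e i + (p - ∑ i, m i * s i : ℝ) • fun j => (μ j : ℝ) := by
    intro m p
    funext j
    simp only [Pi.add_apply, Finset.sum_apply, Pi.smul_apply, smul_eq_mul, Int.cast_add,
      Int.cast_sum, Int.cast_mul, e, mul_add, Finset.sum_add_distrib, sub_mul, Finset.sum_mul,
      mul_assoc]
    ring
  refine ⟨fun i => c i, s, l', T₀ / N μ, by positivity, fun n hn => ?_, ?_⟩
  · have hNn : N n ≤ d + 1 := by
      have := weightedNorm_le_of_abs_le hl (y := fun i => (n i : ℝ)) (R := 1)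
        (fun i => by rw [one_mul]; exact_mod_cast hn i)
      rw [Fintype.card_fin, mul_one] at this
      rw [hN]
      exact_mod_cast this
    obtain ⟨m, hm⟩ := hcgen (π n)
    have hml : ∀ i, |m i| ≤ l' i := by
      intro i
      rw [hl'iff]
      refine (hcC m i).trans ?_
      rw [← hm, hQdef]
      gcongr
      exact (hNl.quotient_le_self π n).trans hNn
    have hn_eq : n = ∑ i, m i • (c i : Fin (d + 1) → ℤ) + f n • μ := by
      have h1 := congrArg (fun y : LinearMap.ker f => (y : Fin (d + 1) → ℤ)) hm
      simp only [hπval, AddSubmonoidClass.coe_finsetSum, Submodule.coe_smul] at h1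
      rw [← h1]
      abel
    refine ⟨m, f n, hml, hn_eq, ?_⟩
    rw [le_div_iff₀ hNμ]
    have h1 := hsplit m (f n)
    rw [← hn_eq] at h1
    have h2 : (f n - ∑ i, m i * s i : ℝ) • (fun j => (μ j : ℝ)) =
        (fun j => (n j : ℝ)) + (-1 : ℝ) • ∑ i, (m i : ℝ) • e i := by
      rw [h1, neg_one_smul]
      abel
    have h3 := weightedNorm_smul (l := l) (f n - ∑ i, m i * s i : ℝ) fun j => (μ j : ℝ)
    have h4 := weightedNorm_add_le (l := l) (fun j => (n j : ℝ)) ((-1 : ℝ) • ∑ i, (m i : ℝ) • e i)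
    rw [weightedNorm_smul, abs_neg, abs_one, one_mul, ← h2, h3] at h4
    have h5 := hcomb m hml
    rw [hN] at hNn ⊢
    rw [hT₀]
    linarith
  · obtain ⟨J, hJ⟩ : ∃ J : ℕ, J = ⌊(N μ)⁻¹⌋₊ := ⟨_, rfl⟩
    have hJ1 : (J : ℝ) * N μ ≤ 1 := by
      rw [← le_div_iff₀ hNμ, one_div, hJ]
      exact Nat.floor_le (by positivity)
    have hJ2 : (N μ)⁻¹ ≤ J + 1 := by
      rw [hJ]
      exact (Nat.lt_floor_add_one _).le
    let dom : Finset ((Fin d → ℤ) × ℕ) :=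
      (Fintype.piFinset fun i => Finset.Icc (-(l' i : ℤ)) (l' i)) ×ˢ Finset.range (J + 1)
    let cod : Finset (Fin (d + 1) → ℤ) :=
      Fintype.piFinset fun i => Finset.Icc (-((T₁ * l i : ℕ) : ℤ)) (T₁ * l i : ℕ)
    let F : (Fin d → ℤ) × ℕ → (Fin (d + 1) → ℤ) := fun x =>
      ∑ i, x.1 i • (c i : Fin (d + 1) → ℤ) + ((x.2 : ℤ) + round (∑ i, x.1 i * s i)) • μ
    have hπF : ∀ x, π (F x) = ∑ i, x.1 i • c i := by
      intro x
      ext j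
      have h1 : f (F x) = x.2 + round (∑ i, x.1 i * s i) := by
        have h2 : ∀ i, f (c i : Fin (d + 1) → ℤ) = 0 := fun i => (c i).2
        simp only [F, map_add, map_sum, map_smul, hfμ, h2, mul_zero, Finset.sum_const_zero,
          zero_add, smul_eq_mul, mul_one]
      rw [hπval, h1]
      simp [F]
    have hcard : dom.card ≤ cod.card := by
      refine Finset.card_le_card_of_injOn F ?_ ?_
      · rintro ⟨m, j⟩ hx
        simp only [dom, Finset.coe_product, Set.mem_prod, Finset.mem_coe, Fintype.mem_piFinset,
          Finset.mem_Icc, Finset.mem_range, ← abs_le] at hx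
        obtain ⟨hm, hj⟩ := hx
        simp only [cod, Finset.mem_coe, Fintype.mem_piFinset, Finset.mem_Icc, ← abs_le]
        intro i
        have h1 : weightedNorm l (fun i => (F (m, j) i : ℝ)) ≤ T₁ := by
          simp only [F]
          rw [hsplit]
          refine (weightedNorm_add_le _ _).trans ?_
          rw [weightedNorm_smul]
          have h2 := hcomb m hm
          have h3 : |(((j : ℤ) + round (∑ i, m i * s i) : ℤ) : ℝ) - ∑ i, m i * s i| ≤ j + 1 / 2 := by
            have h4 := abs_sub_round (∑ i, (m i : ℝ) * s i)
            rw [abs_le] at h4 ⊢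
            push_cast
            have : (0 : ℝ) ≤ j := Nat.cast_nonneg j
            constructor <;> linarith [h4.1, h4.2]
          have h5 : (j : ℝ) ≤ J := by
            exact_mod_cast Nat.lt_succ_iff.1 hj
          have h6 : weightedNorm l (fun j => (μ j : ℝ)) = N μ := by rw [hN]
          rw [h6]
          have h7 : |(((j : ℤ) + round (∑ i, m i * s i) : ℤ) : ℝ) - ∑ i, m i * s i| * N μ ≤
              1 + 4 * (d + 1) := by
            calc _ ≤ (J + 1 / 2) * N μ := by
                  gcongr
                  exact h3.trans (by gcongr)
              _ = J * N μ + N μ / 2 := by ring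
              _ ≤ _ := by linarith
          have h8 := Nat.le_ceil (2 * d * C * (d + 1) + 1 + 4 * (d + 1) : ℝ)
          rw [← hT₁] at h8
          linarith
        have h2 := abs_le_of_weightedNorm_le hl h1 i
        exact_mod_cast h2
      · rintro ⟨m, j⟩ - ⟨m', j'⟩ - hF
        have h1 : ∑ i, (m - m') i • c i = 0 := by
          have := congrArg π hF
          rw [hπF, hπF] at this
          simp only [Pi.sub_apply, sub_smul, Finset.sum_sub_distrib, this, sub_self]
        have h2 : m = m' := by
          funext i
          have h3 := hcC (m - m') i
          rw [h1, hQ.map_zero, mul_zero] at h3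
          have h4 : |((m - m') i : ℝ)| ≤ 0 := by
            by_contra h5
            push Not at h5
            exact absurd h3 (not_le.2 (mul_pos h5 (hcpos i)))
          have h5 : ((m - m') i : ℝ) = 0 := abs_eq_zero.1 (le_antisymm h4 (abs_nonneg _))
          have h6 : (m - m') i = 0 := by exact_mod_cast h5
          simpa [sub_eq_zero] using h6
        subst h2
        simp only [F, _root_.add_right_inj] at hF
        have h3 := smul_left_injective ℤ hμ0 hF
        simpa using h3
    have hdom : (dom.card : ℝ) = (∏ i, (2 * l' i + 1 : ℝ)) * (J + 1) := by
      simp only [dom, Finset.card_product, Fintype.card_piFinset, Int.card_Icc, Finset.card_range]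
      push_cast
      congr 1
      refine Finset.prod_congr rfl fun i _ => ?_
      have : ((l' i : ℤ) + 1 - -(l' i : ℤ)).toNat = 2 * l' i + 1 := by omega
      rw [this]
      push_cast
      rfl
    have hcod : (cod.card : ℝ) ≤ T₁ ^ (d + 1) * ∏ i, (2 * l i + 1 : ℝ) := by
      simp only [cod, Fintype.card_piFinset, Int.card_Icc]
      push_cast
      have h0 : (T₁ : ℝ) ^ (d + 1) = ∏ _i : Fin (d + 1), (T₁ : ℝ) := by simp
      rw [h0, ← Finset.prod_mul_distrib]
      refine Finset.prod_le_prod (fun i _ => by positivity) fun i _ => ?_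
      have h1 : (((T₁ : ℤ) * l i) + 1 - -((T₁ : ℤ) * l i)).toNat = 2 * (T₁ * l i) + 1 := by
        have : (0 : ℤ) ≤ (T₁ : ℤ) * l i := by positivity
        zify
        rw [Int.toNat_of_nonneg (by linarith)]
        ring
      rw [h1]
      have : (1 : ℝ) ≤ T₁ := by exact_mod_cast hT₁1
      push_cast
      linarith
    have h8 : 8 * (T₀ / N μ) + 1 ≤ 2 * (8 * T₀ + 1) * (J + 1) := by
      have hJ0 : (0 : ℝ) ≤ J := Nat.cast_nonneg J
      calc 8 * (T₀ / N μ) + 1 = 8 * T₀ * (N μ)⁻¹ + 1 := by ring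
        _ ≤ 8 * T₀ * (J + 1) + 1 := by gcongr
        _ ≤ _ := by nlinarith [mul_nonneg hT₀0 hJ0]
    have hle : (dom.card : ℝ) ≤ cod.card := by exact_mod_cast hcard
    rw [hdom] at hle
    calc (∏ i, (2 * l' i + 1 : ℝ)) * (8 * (T₀ / N μ) + 1)
        ≤ (∏ i, (2 * l' i + 1 : ℝ)) * (2 * (8 * T₀ + 1) * (J + 1)) := by
          refine mul_le_mul_of_nonneg_left h8 (by positivity)
      _ = 2 * (8 * T₀ + 1) * ((∏ i, (2 * l' i + 1 : ℝ)) * (J + 1)) := by ring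
      _ ≤ 2 * (8 * T₀ + 1) * (T₁ ^ (d + 1) * ∏ i, (2 * l i + 1 : ℝ)) :=
          mul_le_mul_of_nonneg_left (hle.trans hcod) (by positivity)
      _ = _ := by ring

lemma exists_eq_smul_primitive {ι : Type*} [Fintype ι] {n : ι → ℤ} (hn : n ≠ 0) :
    ∃ (g : ℤ) (μ : ι → ℤ) (f : (ι → ℤ) →ₗ[ℤ] ℤ), g ≠ 0 ∧ n = g • μ ∧ f μ = 1 := by
  obtain ⟨g, hg⟩ := IsPrincipalIdealRing.principal (Ideal.span (Set.range n))
  have h1 : ∀ i, ∃ m : ℤ, n i = g * m := fun i => by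
    have : n i ∈ Ideal.span (Set.range n) := Ideal.subset_span ⟨i, rfl⟩
    rw [hg] at this
    exact Ideal.mem_span_singleton.1 this
  choose μ hμ using h1
  have h2 : g ∈ Ideal.span (Set.range n) := by
    rw [hg]
    exact Ideal.mem_span_singleton_self g
  obtain ⟨c, hc⟩ := Ideal.mem_span_range_iff_exists_fun.1 h2
  have hg0 : g ≠ 0 := by
    rintro rfl
    exact hn (funext fun i => by simp [hμ i])
  refine ⟨g, μ, ∑ i, c i • LinearMap.proj i, hg0, funext hμ, ?_⟩
  have h3 : g * ∑ i, c i * μ i = g * 1 := by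
    rw [mul_one, Finset.mul_sum]
    conv_rhs => rw [← hc]
    refine Finset.sum_congr rfl fun i _ => ?_
    rw [hμ i]
    ring
  simpa using mul_left_cancel₀ hg0 h3

/-- A non-proper `gapBox` is contained in one of smaller rank and comparable size. -/
theorem exists_gapBox_of_not_gapProper (k d : ℕ) : ∃ T : ℝ, 0 ≤ T ∧
    ∀ (a : Fin (d + 1) → Fin k → ℝ) (l : Fin (d + 1) → ℕ) (v : Fin k → Fin k → ℝ),
      (Matrix.of v).det ≠ 0 → (∀ i, 1 ≤ l i) → ¬ GapProper a l v →
      ∃ (a' : Fin d → Fin k → ℝ) (l' : Fin d → ℕ) (v' : Fin k → Fin k → ℝ),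
        (Matrix.of v').det ≠ 0 ∧ gapBox a l v ⊆ gapBox a' l' v' ∧
        (∏ i, (2 * l' i + 1 : ℝ)) * |(Matrix.of v').det| ≤
          T * ((∏ i, (2 * l i + 1 : ℝ)) * |(Matrix.of v).det|) := by
  obtain ⟨T, hT, h⟩ := exists_box_quotient d
  refine ⟨2 ^ k * T, by positivity, fun a l v hv hl hnp => ?_⟩
  simp only [GapProper, not_forall] at hnp
  obtain ⟨n, t, hn, ht, hsum, hn0⟩ := hnp
  obtain ⟨g, μ, f, hg, rfl, hf⟩ := exists_eq_smul_primitive hn0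
  have hg1 : (1 : ℝ) ≤ |(g : ℝ)| := by exact_mod_cast Int.one_le_abs hg
  have hg0 : (g : ℝ) ≠ 0 := by exact_mod_cast hg
  have hμ : ∀ i, |μ i| ≤ 8 * l i := fun i => by
    refine le_trans ?_ (hn i)
    rw [Pi.smul_apply, smul_eq_mul, abs_mul]
    exact le_mul_of_one_le_left (abs_nonneg _) (Int.one_le_abs hg)
  obtain ⟨β, s, l', ρ, hρ, hdec, hsize⟩ := h l μ f hl hf hμ
  let τ : Fin k → ℝ := fun j => -t j / g
  have hτ : ∀ j, |τ j| ≤ 8 := fun j => by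
    simp only [τ]
    rw [abs_div, abs_neg]
    exact (div_le_self (abs_nonneg _) hg1).trans (ht j)
  let w : Fin k → ℝ := ∑ i, (μ i : ℝ) • a i
  have hw : w = ∑ j, τ j • v j := by
    have h1 : (g : ℝ) • w = (g : ℝ) • ∑ j, τ j • v j := by
      simp only [w, τ, Finset.smul_sum, smul_smul, mul_div_cancel₀ _ hg0]
      simp only [Pi.smul_apply, smul_eq_mul, Int.cast_mul] at hsum
      rw [eq_neg_of_add_eq_zero_left hsum]
      simp
    exact smul_right_injective _ hg0 h1
  obtain ⟨v', hv', hvol, henl⟩ := exists_parallelotope_enlarge hv hτ hρ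
  refine ⟨fun i => ∑ j, (β i j : ℝ) • a j + s i • w, l', v', hv', ?_, ?_⟩
  · rintro _ ⟨n, t, hn, ht, rfl⟩
    obtain ⟨m, p, hm, hnm, hp⟩ := hdec n hn
    obtain ⟨t', ht', heq⟩ := henl t (p - ∑ i, m i * s i) ht hp
    refine ⟨m, t', hm, ht', ?_⟩
    have h1 : ∑ i, (n i : ℝ) • a i =
        ∑ i, (m i : ℝ) • ∑ j, (β i j : ℝ) • a j + (p : ℝ) • w := by
      simp only [w, Finset.smul_sum, smul_smul]
      rw [Finset.sum_comm, ← Finset.sum_add_distrib]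
      refine Finset.sum_congr rfl fun j _ => ?_
      rw [← Finset.sum_smul, ← add_smul, hnm]
      simp
    rw [heq, ← hw, h1]
    simp only [smul_add, Finset.sum_add_distrib, sub_smul, smul_smul, Finset.sum_smul]
    abel
  · calc (∏ i, (2 * l' i + 1 : ℝ)) * |(Matrix.of v').det|
        ≤ (∏ i, (2 * l' i + 1 : ℝ)) * (2 ^ k * (8 * ρ + 1) * |(Matrix.of v).det|) :=
          mul_le_mul_of_nonneg_left hvol (by positivity)
      _ = 2 ^ k * |(Matrix.of v).det| * ((∏ i, (2 * l' i + 1 : ℝ)) * (8 * ρ + 1)) := by ring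
      _ ≤ 2 ^ k * |(Matrix.of v).det| * (T * ∏ i, (2 * l i + 1 : ℝ)) :=
          mul_le_mul_of_nonneg_left hsize (by positivity)
      _ = _ := by ring

lemma exists_linearMap_comp_comp_eq {F V W : Type*} [Field F] [AddCommGroup V] [Module F V]
    [AddCommGroup W] [Module F W] (T : V →ₗ[F] W) : ∃ S : W →ₗ[F] V, T ∘ₗ S ∘ₗ T = T := by
  obtain ⟨g, hg⟩ := T.rangeRestrict.exists_rightInverse_of_surjective T.range_rangeRestrict
  obtain ⟨S, hS⟩ := LinearMap.exists_extend g
  refine ⟨S, LinearMap.ext fun x => ?_⟩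
  have h1 : S (T x) = g (T.rangeRestrict x) := by
    rw [← hS]
    rfl
  have h2 : T.rangeRestrict (g (T.rangeRestrict x)) = T.rangeRestrict x :=
    LinearMap.congr_fun hg _
  simp only [LinearMap.comp_apply, h1]
  exact congrArg Subtype.val h2

/-- Integer matrices have integral generalized inverses up to a positive factor. -/
lemma exists_matrix_mul_mul_eq_smul {ι κ : Type*} [Fintype ι] [Fintype κ] (M : Matrix κ ι ℤ) :
    ∃ (N : ℕ) (S : Matrix ι κ ℤ), 0 < N ∧ M * S * M = (N : ℤ) • M := by
  classical
  let M' : Matrix κ ι ℚ := M.map (Int.cast : ℤ → ℚ)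
  obtain ⟨S₀, hS₀⟩ := exists_linearMap_comp_comp_eq (Matrix.toLin' M')
  have h1 : M' * LinearMap.toMatrix' S₀ * M' = M' := by
    have := congrArg LinearMap.toMatrix' hS₀
    rw [LinearMap.toMatrix'_comp, LinearMap.toMatrix'_comp, LinearMap.toMatrix'_toLin'] at this
    rw [Matrix.mul_assoc]
    exact this
  obtain ⟨⟨N, hN⟩, hmul⟩ := IsLocalization.exist_integer_multiples_of_finset
    (nonZeroDivisors ℤ) (Finset.univ.image fun p : ι × κ => LinearMap.toMatrix' S₀ p.1 p.2)
  have hN0 : N ≠ 0 := nonZeroDivisors.ne_zero hN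
  have h2 : ∀ i j, ∃ z : ℤ, (z : ℚ) = N * LinearMap.toMatrix' S₀ i j := by
    intro i j
    obtain ⟨z, hz⟩ := hmul _ (Finset.mem_image_of_mem _ (Finset.mem_univ (i, j)))
    exact ⟨z, by simpa [Submonoid.smul_def] using hz⟩
  choose Z hZ using h2
  have h3 : M * Matrix.of Z * M = N • M := by
    have hinj : Function.Injective fun A : Matrix κ ι ℤ => A.map (Int.cast : ℤ → ℚ) :=
      Matrix.map_injective Int.cast_injective
    apply hinj
    have h4 : (Matrix.of Z).map (Int.cast : ℤ → ℚ) = (N : ℚ) • LinearMap.toMatrix' S₀ := by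
      ext i j
      simp [hZ]
    have h5 : (M * Matrix.of Z * M).map (Int.cast : ℤ → ℚ) =
        M' * (Matrix.of Z).map (Int.cast : ℤ → ℚ) * M' := by
      have h6 := Matrix.map_mul (L := M * Matrix.of Z) (M := M) (f := Int.castRingHom ℚ)
      have h7 := Matrix.map_mul (L := M) (M := Matrix.of Z) (f := Int.castRingHom ℚ)
      rw [h7] at h6
      exact h6
    show (M * Matrix.of Z * M).map (Int.cast : ℤ → ℚ) = (N • M).map (Int.cast : ℤ → ℚ)
    rw [h5, h4, Matrix.mul_smul, Matrix.smul_mul, h1]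
    ext i j
    simp [M']
  refine ⟨N.natAbs, N.sign • Matrix.of Z, Int.natAbs_pos.2 hN0, ?_⟩
  rw [Matrix.mul_smul, Matrix.smul_mul, h3, smul_smul, Int.sign_mul_self_eq_natAbs]

/-- Approximate integer linear relations become exact after enlarging a `gapBox`. -/
theorem exists_exact_relations {ι κ : Type*} [Fintype ι] [Fintype κ] (M : Matrix κ ι ℤ) :
    ∃ c : ℕ, 1 ≤ c ∧ ∀ {k d : ℕ} (a : Fin d → Fin k → ℝ) (l : Fin d → ℕ) (v : Fin k → Fin k → ℝ)
      (x : ι → Fin k → ℝ),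
      (∀ q, ∑ i, (M q i : ℝ) • x i ∈ gapBox a (fun i => 4 * l i) fun j => (4 : ℝ) • v j) →
      ∃ (x' : ι → Fin k → ℝ) (a' : Fin d → Fin k → ℝ), (∀ q, ∑ i, (M q i : ℝ) • x' i = 0) ∧
        ∀ i u, u - x i ∈ gapBox a l v →
          u - x' i ∈ gapBox a' (fun i => c * l i) fun j => (c : ℝ) • v j := by
  obtain ⟨N, S, hN, hS⟩ := exists_matrix_mul_mul_eq_smul M
  have hN0 : (0 : ℝ) < N := by exact_mod_cast hN
  have hN1 : (1 : ℝ) ≤ N := by exact_mod_cast hN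
  obtain ⟨s, hs⟩ : ∃ s : ℕ, s = ∑ i, ∑ q, (S i q).natAbs := ⟨_, rfl⟩
  have hsi : ∀ i, ∑ q, |S i q| ≤ s := by
    intro i
    have h1 : ∑ q, (S i q).natAbs ≤ s := by
      rw [hs]
      exact Finset.single_le_sum (f := fun i => ∑ q, (S i q).natAbs) (fun _ _ => Nat.zero_le _)
        (Finset.mem_univ i)
    calc ∑ q, |S i q| = ((∑ q, (S i q).natAbs : ℕ) : ℤ) := by
          push_cast
          rfl
      _ ≤ _ := by exact_mod_cast h1
  have hsiR : ∀ i, ∑ q, |(S i q : ℝ)| ≤ s := fun i => by exact_mod_cast hsi i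
  refine ⟨N + 4 * s, by omega, fun {k d} a l v x hx => ?_⟩
  choose n t hn ht hxe using hx
  obtain ⟨δ, hδ⟩ : ∃ δ : κ → Fin k → ℝ, δ = fun q => ∑ i, (M q i : ℝ) • x i := ⟨_, rfl⟩
  have hδq : ∀ q, ∑ i, (M q i : ℝ) • x i = δ q := fun q => by rw [hδ]
  refine ⟨fun i => x i - (N : ℝ)⁻¹ • ∑ q, (S i q : ℝ) • δ q, fun i => (N : ℝ)⁻¹ • a i,
    fun q => ?_, fun i u hu => ?_⟩
  · have h1 : ∑ i, (M q i : ℝ) • ∑ q', (S i q' : ℝ) • δ q' = (N : ℝ) • δ q := by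
      have h2 : ∀ i', ∑ q', (M * S) q q' * M q' i' = N * M q i' := fun i' => by
        have := congrFun (congrFun hS q) i'
        rw [Matrix.mul_apply] at this
        simpa using this
      calc ∑ i, (M q i : ℝ) • ∑ q', (S i q' : ℝ) • δ q'
          = ∑ q', ((M * S) q q' : ℝ) • δ q' := by
            simp only [Finset.smul_sum, smul_smul]
            rw [Finset.sum_comm]
            refine Finset.sum_congr rfl fun q' _ => ?_
            rw [← Finset.sum_smul, Matrix.mul_apply]
            push_cast
            rfl
        _ = ∑ i', (N * M q i' : ℝ) • x i' := by
            rw [hδ]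
            simp only [Finset.smul_sum, smul_smul]
            rw [Finset.sum_comm]
            refine Finset.sum_congr rfl fun i' _ => ?_
            rw [← Finset.sum_smul]
            congr 1
            exact_mod_cast h2 i'
        _ = _ := by
            rw [hδ, Finset.smul_sum]
            simp only [smul_smul]
    simp only [smul_sub, Finset.sum_sub_distrib, hδq]
    rw [sub_eq_zero]
    have h3 : ∑ i, (M q i : ℝ) • (N : ℝ)⁻¹ • ∑ q', (S i q' : ℝ) • δ q' =
        (N : ℝ)⁻¹ • ∑ i, (M q i : ℝ) • ∑ q', (S i q' : ℝ) • δ q' := by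
      rw [Finset.smul_sum]
      exact Finset.sum_congr rfl fun i _ => smul_comm _ _ _
    rw [h3, h1, inv_smul_smul₀ hN0.ne']
  · obtain ⟨n₀, t₀, hn₀, ht₀, hu⟩ := hu
    have hc0 : (0 : ℝ) < ((N + 4 * s : ℕ) : ℝ) := by
      exact_mod_cast (by omega : 0 < N + 4 * s)
    refine ⟨fun j => N * n₀ j + ∑ q, S i q * n q j,
      fun j => (t₀ j + (N : ℝ)⁻¹ * ∑ q, S i q * (4 * t q j)) / ((N + 4 * s : ℕ) : ℝ),
      fun j => ?_, fun j => ?_, ?_⟩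
    · have h1 : |∑ q, S i q * n q j| ≤ s * (4 * l j) := by
        calc |∑ q, S i q * n q j| ≤ ∑ q, |S i q * n q j| := Finset.abs_sum_le_sum_abs _ _
          _ ≤ ∑ q, |S i q| * (4 * l j) := by
              refine Finset.sum_le_sum fun q _ => ?_
              rw [abs_mul]
              gcongr
              exact_mod_cast hn q j
          _ = (∑ q, |S i q|) * (4 * l j) := by rw [Finset.sum_mul]
          _ ≤ _ := by gcongr; exact hsi i
      have h2 : |(N : ℤ) * n₀ j| ≤ N * l j := by
        rw [abs_mul, Nat.abs_cast]
        gcongr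
        exact hn₀ j
      refine (abs_add_le _ _).trans ?_
      push_cast
      linarith
    · rw [abs_div, abs_of_pos hc0, div_le_one hc0]
      have h1 : |∑ q, (S i q : ℝ) * (4 * t q j)| ≤ s * 4 := by
        calc |∑ q, (S i q : ℝ) * (4 * t q j)| ≤ ∑ q, |(S i q : ℝ) * (4 * t q j)| :=
              Finset.abs_sum_le_sum_abs _ _
          _ ≤ ∑ q, |(S i q : ℝ)| * 4 := by
              refine Finset.sum_le_sum fun q _ => ?_
              rw [abs_mul, abs_mul, abs_of_pos (by norm_num : (0 : ℝ) < 4)]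
              have := ht q j
              gcongr
              linarith
          _ = (∑ q, |(S i q : ℝ)|) * 4 := by rw [Finset.sum_mul]
          _ ≤ _ := by gcongr; exact hsiR i
      have h2 : |(N : ℝ)⁻¹ * ∑ q, (S i q : ℝ) * (4 * t q j)| ≤ s * 4 := by
        rw [abs_mul, abs_of_pos (inv_pos.2 hN0)]
        exact (mul_le_of_le_one_left (abs_nonneg _) (inv_le_one_of_one_le₀ hN1)).trans h1
      refine (abs_add_le _ _).trans ?_
      have := ht₀ j
      push_cast
      linarith
    · have hδe : ∀ q, δ q = ∑ j, (n q j : ℝ) • a j + ∑ j, (4 * t q j) • v j := by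
        intro q
        rw [← hδq, hxe]
        simp only [smul_smul, mul_comm]
      have h1 : u - (x i - (N : ℝ)⁻¹ • ∑ q, (S i q : ℝ) • δ q) =
          (u - x i) + (N : ℝ)⁻¹ • ∑ q, (S i q : ℝ) • δ q := by abel
      rw [h1, hu]
      have h2 : ∑ q, (S i q : ℝ) • δ q = ∑ j, (∑ q, (S i q : ℝ) * n q j) • a j +
          ∑ j, (∑ q, (S i q : ℝ) * (4 * t q j)) • v j := by
        simp only [hδe, smul_add, Finset.sum_add_distrib, Finset.smul_sum, smul_smul,
          Finset.sum_smul]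
        congr 1 <;> exact Finset.sum_comm
      rw [h2]
      simp only [smul_smul, div_mul_cancel₀ _ hc0.ne', smul_add, Finset.smul_sum, add_smul,
        Finset.sum_add_distrib, Int.cast_add, Int.cast_mul, Int.cast_sum, Int.cast_natCast, add_mul]
      have h3 : ∀ j, (N : ℝ) * n₀ j * (N : ℝ)⁻¹ = n₀ j := fun j => by field_simp
      have h4 : ∀ j, (∑ q, (S i q : ℝ) * n q j) * (N : ℝ)⁻¹ = (N : ℝ)⁻¹ * ∑ q, (S i q : ℝ) * n q j :=
        fun j => mul_comm _ _
      simp only [h3, h4]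
      abel

lemma zero_mem_gapBox {k d : ℕ} (a : Fin d → Fin k → ℝ) (l : Fin d → ℕ) (v : Fin k → Fin k → ℝ) :
    (0 : Fin k → ℝ) ∈ gapBox a l v :=
  ⟨0, 0, fun i => by simp, fun j => by simp, by simp⟩

lemma gapBox_smul_subset_of_le {k d : ℕ} (a : Fin d → Fin k → ℝ) (l : Fin d → ℕ)
    (v : Fin k → Fin k → ℝ) {b c : ℕ} (hc : 0 < c) (h : b ≤ c) :
    gapBox a (fun i => b * l i) (fun j => (b : ℝ) • v j) ⊆
      gapBox a (fun i => c * l i) (fun j => (c : ℝ) • v j) := by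
  rintro _ ⟨n, t, hn, ht, rfl⟩
  have hc0 : (0 : ℝ) < c := by exact_mod_cast hc
  have hbc : (b : ℝ) ≤ c := by exact_mod_cast h
  refine ⟨n, fun j => (b / c : ℝ) * t j, fun i => (hn i).trans ?_, fun j => ?_, ?_⟩
  · exact_mod_cast Nat.mul_le_mul_right _ h
  · rw [abs_mul, abs_of_nonneg (by positivity)]
    exact mul_le_one₀ ((div_le_one hc0).2 hbc) (abs_nonneg _) (ht j)
  · congr 1
    refine Finset.sum_congr rfl fun j _ => ?_
    rw [smul_smul, smul_smul]
    congr 1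
    field_simp

/-- The number of quadruples violating `x i + x j = x p + x q`. -/
noncomputable def inexactCount {m : ℕ} {E : Type*} [AddCommGroup E] (x : Fin m → E) : ℕ :=
  {q : Fin m × Fin m × Fin m × Fin m | x q.1 + x q.2.1 ≠ x q.2.2.1 + x q.2.2.2}.ncard

/-- If some additive relation between the centres holds only approximately, then the centres can be
moved so as to satisfy strictly more additive relations. -/
lemma exists_inexactCount_lt (m : ℕ) : ∃ c : ℕ, 1 ≤ c ∧
    ∀ {k d : ℕ} (a : Fin d → Fin k → ℝ) (l : Fin d → ℕ) (v : Fin k → Fin k → ℝ)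
      (x : Fin m → Fin k → ℝ) (i j p q : Fin m),
      x i + x j - x p - x q ∈ gapBox a (fun i => 4 * l i) (fun j => (4 : ℝ) • v j) →
      x i + x j ≠ x p + x q →
      ∃ (x' : Fin m → Fin k → ℝ) (a' : Fin d → Fin k → ℝ), inexactCount x' < inexactCount x ∧
        ∀ i u, u - x i ∈ gapBox a l v →
          u - x' i ∈ gapBox a' (fun i => c * l i) fun j => (c : ℝ) • v j := by
  classical
  obtain ⟨M, hM⟩ : ∃ M : Finset (Fin m × Fin m × Fin m × Fin m) →
      Matrix (Fin m × Fin m × Fin m × Fin m) (Fin m) ℤ, ∀ R q i, M R q i =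
        if q ∈ R then ((if i = q.1 then 1 else 0) + (if i = q.2.1 then 1 else 0) -
          (if i = q.2.2.1 then 1 else 0) - (if i = q.2.2.2 then 1 else 0)) else 0 :=
    ⟨_, fun _ _ _ => rfl⟩
  have hsum : ∀ R q {k : ℕ} (x : Fin m → Fin k → ℝ), ∑ i, (M R q i : ℝ) • x i =
      if q ∈ R then x q.1 + x q.2.1 - x q.2.2.1 - x q.2.2.2 else 0 := by
    intro R q k x
    by_cases hq : q ∈ R
    · simp [hM, hq, sub_smul, add_smul, Finset.sum_sub_distrib, Finset.sum_add_distrib]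
    · simp [hM, hq]
  choose c hc hcM using fun R => exists_exact_relations (M R)
  refine ⟨Finset.univ.sup c, (hc ∅).trans (Finset.le_sup (Finset.mem_univ _)), ?_⟩
  intro k d a l v x i j p q hmem hne
  obtain ⟨R, hR⟩ : ∃ R : Finset (Fin m × Fin m × Fin m × Fin m), R = Finset.univ.filter fun q =>
      x q.1 + x q.2.1 - x q.2.2.1 - x q.2.2.2 ∈
        gapBox a (fun i => 4 * l i) (fun j => (4 : ℝ) • v j) := ⟨_, rfl⟩
  have hRm : ∀ q, q ∈ R ↔ x q.1 + x q.2.1 - x q.2.2.1 - x q.2.2.2 ∈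
        gapBox a (fun i => 4 * l i) (fun j => (4 : ℝ) • v j) := fun q => by simp [hR]
  obtain ⟨x', a', hx', htr⟩ := hcM R a l v x fun q => by
    rw [hsum]
    split_ifs with h
    · exact (hRm q).1 h
    · exact zero_mem_gapBox _ _ _
  have hexact : ∀ q ∈ R, x' q.1 + x' q.2.1 = x' q.2.2.1 + x' q.2.2.2 := fun q hq => by
    have := hx' q
    rw [hsum, if_pos hq, sub_sub, sub_eq_zero] at this
    exact this
  refine ⟨x', a', Set.ncard_lt_ncard ⟨fun q hq hq' => ?_, fun hsub => ?_⟩ (Set.toFinite _),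
    fun i u hu => ?_⟩
  · refine hq (hexact q ((hRm q).2 ?_))
    rw [hq', add_sub_cancel_left, sub_self]
    exact zero_mem_gapBox _ _ _
  · exact hsub (a := (i, j, p, q)) hne (hexact (i, j, p, q) ((hRm _).2 hmem))
  · exact gapBox_smul_subset_of_le a' l v
      ((hc ∅).trans (Finset.le_sup (Finset.mem_univ _))) (Finset.le_sup (Finset.mem_univ R))
      (htr i u hu)

/-- A short direction of a cover can be absorbed into the set of centres. -/
lemma exists_cover_drop_direction {k d m L : ℕ} {A : Set (Fin k → ℝ)} (x : Fin m → Fin k → ℝ)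
    (a : Fin (d + 1) → Fin k → ℝ) (l : Fin (d + 1) → ℕ) (v : Fin k → Fin k → ℝ)
    (hA : ∀ u ∈ A, ∃ i, u - x i ∈ gapBox a l v) (p : Fin (d + 1)) (hp : l p ≤ L) :
    ∃ x' : Fin (m * (2 * L + 1)) → Fin k → ℝ,
      ∀ u ∈ A, ∃ i, u - x' i ∈ gapBox (fun i => a (p.succAbove i)) (fun i => l (p.succAbove i)) v := by
  refine ⟨fun i => x (finProdFinEquiv.symm i).1 +
    ((finProdFinEquiv.symm i).2.1 - L : ℝ) • a p, fun u hu => ?_⟩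
  obtain ⟨i, n, t, hn, ht, hx⟩ := hA u hu
  have hnp := abs_le.1 (hn p)
  refine ⟨finProdFinEquiv (i, ⟨(n p + L).toNat, by omega⟩), fun i => n (p.succAbove i), t,
    fun i => hn _, ht, ?_⟩
  have hcast : (((n p + L).toNat : ℕ) : ℝ) = n p + L := by
    have : (((n p + L).toNat : ℕ) : ℤ) = n p + L := Int.toNat_of_nonneg (by omega)
    exact_mod_cast this
  simp only [Equiv.symm_apply_apply, hcast, add_sub_cancel_right]
  rw [← sub_sub, hx, Fin.sum_univ_succAbove _ p]
  abel

/-- The volume parameter of a box. -/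
noncomputable def gapSize {k d : ℕ} (l : Fin d → ℕ) (v : Fin k → Fin k → ℝ) : ℝ :=
  (∏ i, (2 * l i + 1 : ℝ)) * |(Matrix.of v).det|

lemma gapSize_nonneg {k d : ℕ} (l : Fin d → ℕ) (v : Fin k → Fin k → ℝ) : 0 ≤ gapSize l v := by
  unfold gapSize
  positivity

lemma gapSize_succAbove_le {k d : ℕ} (l : Fin (d + 1) → ℕ) (v : Fin k → Fin k → ℝ)
    (p : Fin (d + 1)) : gapSize (fun i => l (p.succAbove i)) v ≤ gapSize l v := by
  unfold gapSize
  rw [Fin.prod_univ_succAbove (fun i => (2 * l i + 1 : ℝ)) p]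
  gcongr
  refine le_mul_of_one_le_left (Finset.prod_nonneg fun _ _ => by positivity) ?_
  have : (0 : ℝ) ≤ l p := Nat.cast_nonneg _
  linarith

lemma gapSize_smul_le {k d : ℕ} (l : Fin d → ℕ) (v : Fin k → Fin k → ℝ) {c : ℕ} (hc : 1 ≤ c) :
    gapSize (fun i => c * l i) (fun j => (c : ℝ) • v j) ≤ (c : ℝ) ^ (d + k) * gapSize l v := by
  unfold gapSize
  have h := prod_two_mul_add_one_le c hc l
  rw [det_of_smul, abs_mul, abs_of_nonneg (by positivity : (0 : ℝ) ≤ (c : ℝ) ^ k)]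
  calc _ ≤ ((c : ℝ) ^ d * ∏ i, (2 * l i + 1 : ℝ)) * ((c : ℝ) ^ k * |(Matrix.of v).det|) := by gcongr
    _ = _ := by ring

/-- A set has a cover by boundedly many translates of a proper box whose centres satisfy every
approximate additive relation exactly. -/
def HasExactCover {k : ℕ} (E : ℕ → ℝ) (η C V : ℝ) (A : Set (Fin k → ℝ)) : Prop :=
  ∃ (d m : ℕ) (x : Fin m → Fin k → ℝ) (a : Fin d → Fin k → ℝ) (l : Fin d → ℕ)
    (v : Fin k → Fin k → ℝ), (m : ℝ) ≤ C ∧ (Matrix.of v).det ≠ 0 ∧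
    (∀ u ∈ A, ∃ i, u - x i ∈ gapBox a l v) ∧ gapSize l v ≤ C * V ∧ GapProper a l v ∧
    (∀ i j p q, x i + x j - x p - x q ∈ gapBox a (fun i => 4 * l i) (fun j => (4 : ℝ) • v j) →
      x i + x j = x p + x q) ∧
    (m : ℝ) ^ 2 * (E d * (gapSize l v * ∑ i, (2 * l i + 1 : ℝ)⁻¹)) ≤ η * V

lemma HasExactCover.mono {k : ℕ} {E : ℕ → ℝ} {η C C' V : ℝ} {A : Set (Fin k → ℝ)} (hV : 0 ≤ V)
    (h : HasExactCover E η C V A) (hC : C ≤ C') : HasExactCover E η C' V A := by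
  obtain ⟨d, m, x, a, l, v, hm, hdet, hA, hs, h⟩ := h
  exact ⟨d, m, x, a, l, v, hm.trans hC, hdet, hA,
    hs.trans (mul_le_mul_of_nonneg_right hC hV), h⟩

lemma error_le_of_forall_le {k d m L : ℕ} {e η B V : ℝ} (he : 0 ≤ e) (hV : 0 ≤ V)
    (hL : 1 ≤ L) (h : (m : ℝ) ^ 2 * e * B * d ≤ η * L) (l : Fin d → ℕ) (v : Fin k → Fin k → ℝ)
    (hl : ∀ i, L ≤ l i) (hs : gapSize l v ≤ B * V) :
    (m : ℝ) ^ 2 * (e * (gapSize l v * ∑ i, (2 * l i + 1 : ℝ)⁻¹)) ≤ η * V := by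
  have hL0 : (0 : ℝ) < L := by exact_mod_cast hL
  have h1 : ∑ i, (2 * l i + 1 : ℝ)⁻¹ ≤ d * (L : ℝ)⁻¹ := by
    calc ∑ i, (2 * l i + 1 : ℝ)⁻¹ ≤ ∑ _i : Fin d, (L : ℝ)⁻¹ := by
          refine Finset.sum_le_sum fun i _ => inv_anti₀ hL0 ?_
          have : (L : ℝ) ≤ l i := by exact_mod_cast hl i
          linarith
      _ = _ := by simp
  have h0 : 0 ≤ B * V := (gapSize_nonneg l v).trans hs
  calc (m : ℝ) ^ 2 * (e * (gapSize l v * ∑ i, (2 * l i + 1 : ℝ)⁻¹))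
      ≤ (m : ℝ) ^ 2 * (e * ((B * V) * (d * (L : ℝ)⁻¹))) := by
        gcongr
    _ = ((m : ℝ) ^ 2 * e * B * d) * (L : ℝ)⁻¹ * V := by ring
    _ ≤ (η * L) * (L : ℝ)⁻¹ * V := by gcongr
    _ = η * V := by field_simp

/-- Every cover by translates of a box can be refined to an exact cover, with bounds depending only
on the dimension, the number of translates and the size of the box. -/
lemma exists_hasExactCover (k : ℕ) (E : ℕ → ℝ) (hE : ∀ d, 0 ≤ E d) (η : ℝ) (hη : 0 < η) (d m : ℕ)
    (B : ℝ) : ∃ C : ℝ, ∀ (A : Set (Fin k → ℝ)) (V : ℝ) (x : Fin m → Fin k → ℝ)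
      (a : Fin d → Fin k → ℝ) (l : Fin d → ℕ) (v : Fin k → Fin k → ℝ), 0 < V →
      (Matrix.of v).det ≠ 0 → (∀ u ∈ A, ∃ i, u - x i ∈ gapBox a l v) → gapSize l v ≤ B * V →
      HasExactCover E η C V A := by
  induction d using Nat.strong_induction_on generalizing m B with
  | _ d ihd =>
  suffices hcount : ∀ e : ℕ, ∀ B : ℝ, ∃ C : ℝ, ∀ (A : Set (Fin k → ℝ)) (V : ℝ)
      (x : Fin m → Fin k → ℝ) (a : Fin d → Fin k → ℝ) (l : Fin d → ℕ) (v : Fin k → Fin k → ℝ),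
      0 < V → (Matrix.of v).det ≠ 0 → (∀ u ∈ A, ∃ i, u - x i ∈ gapBox a l v) →
      gapSize l v ≤ B * V → inexactCount x ≤ e → HasExactCover E η C V A by
    obtain ⟨C, hC⟩ := hcount (Nat.card (Fin m × Fin m × Fin m × Fin m)) B
    exact ⟨C, fun A V x a l v hV hdet hA hs => hC A V x a l v hV hdet hA hs
      (Set.ncard_le_card _)⟩
  intro e
  induction e using Nat.strong_induction_on with
  | _ e ihe =>
  intro B
  obtain ⟨c, hc, hcx⟩ := exists_inexactCount_lt m
  obtain ⟨L, hL1, hL⟩ : ∃ L : ℕ, 1 ≤ L ∧ (m : ℝ) ^ 2 * E d * B * d ≤ η * L := by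
    obtain ⟨L, hL⟩ := exists_nat_ge ((m : ℝ) ^ 2 * E d * B * d / η)
    refine ⟨L + 1, by omega, ?_⟩
    rw [div_le_iff₀ hη] at hL
    push_cast
    nlinarith
  obtain ⟨C₁, hC₁⟩ : ∃ C₁ : ℝ, ∀ d₁, d = d₁ + 1 → ∀ (A : Set (Fin k → ℝ)) (V : ℝ)
      (x : Fin (m * (2 * L + 1)) → Fin k → ℝ) (a : Fin d₁ → Fin k → ℝ) (l : Fin d₁ → ℕ)
      (v : Fin k → Fin k → ℝ), 0 < V → (Matrix.of v).det ≠ 0 →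
      (∀ u ∈ A, ∃ i, u - x i ∈ gapBox a l v) → gapSize l v ≤ B * V → HasExactCover E η C₁ V A := by
    rcases d with _ | d₁
    · exact ⟨0, fun d₁ h => by omega⟩
    · obtain ⟨C₁, h⟩ := ihd d₁ (by omega) (m * (2 * L + 1)) B
      refine ⟨C₁, fun d₂ h₂ => ?_⟩
      obtain rfl : d₁ = d₂ := by omega
      exact h
  obtain ⟨C₂, hC₂⟩ : ∃ C₂ : ℝ, ∀ (A : Set (Fin k → ℝ)) (V : ℝ)
      (x : Fin m → Fin k → ℝ) (a : Fin d → Fin k → ℝ) (l : Fin d → ℕ)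
      (v : Fin k → Fin k → ℝ), 0 < V → (Matrix.of v).det ≠ 0 → (∀ i, 1 ≤ l i) →
      (∀ u ∈ A, ∃ i, u - x i ∈ gapBox a l v) → gapSize l v ≤ B * V → ¬ GapProper a l v →
      HasExactCover E η C₂ V A := by
    rcases d with _ | d₁
    · exact ⟨0, fun A V x a l v _ _ _ _ _ h => (h fun n _ _ _ _ => Subsingleton.elim _ _).elim⟩
    · obtain ⟨T, hT, h⟩ := exists_gapBox_of_not_gapProper k d₁
      obtain ⟨C₂, h₂⟩ := ihd d₁ (by omega) m (T * B)
      refine ⟨C₂, fun A V x a l v hV hdet hl hA hs hnp => ?_⟩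
      obtain ⟨a', l', v', hdet', hsub, hs'⟩ := h a l v hdet hl hnp
      refine h₂ A V x a' l' v' hV hdet' (fun u hu => ?_) (hs'.trans ?_)
      · obtain ⟨i, hi⟩ := hA u hu
        exact ⟨i, hsub hi⟩
      · rw [mul_assoc]
        exact mul_le_mul_of_nonneg_left hs hT
  obtain ⟨C₃, hC₃⟩ : ∃ C₃ : ℝ, ∀ (A : Set (Fin k → ℝ)) (V : ℝ)
      (x : Fin m → Fin k → ℝ) (a : Fin d → Fin k → ℝ) (l : Fin d → ℕ) (v : Fin k → Fin k → ℝ),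
      0 < V → (Matrix.of v).det ≠ 0 → (∀ u ∈ A, ∃ i, u - x i ∈ gapBox a l v) →
      gapSize l v ≤ (c : ℝ) ^ (d + k) * B * V → inexactCount x < e → HasExactCover E η C₃ V A := by
    rcases e with _ | e₁
    · exact ⟨0, fun A V x a l v _ _ _ _ h => by omega⟩
    · obtain ⟨C₃, h⟩ := ihe e₁ (by omega) ((c : ℝ) ^ (d + k) * B)
      exact ⟨C₃, fun A V x a l v hV hdet hA hs hlt => h A V x a l v hV hdet hA hs (by omega)⟩
  refine ⟨max (max C₁ C₂) (max C₃ (max m B)), fun A V x a l v hV hdet hA hs hcnt => ?_⟩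
  by_cases hlong : ∀ i, L ≤ l i
  · by_cases hprop : GapProper a l v
    · by_cases hex : ∀ i j p q, x i + x j - x p - x q ∈
          gapBox a (fun i => 4 * l i) (fun j => (4 : ℝ) • v j) → x i + x j = x p + x q
      · refine ⟨d, m, x, a, l, v, by simp, hdet, hA,
          hs.trans (mul_le_mul_of_nonneg_right (by simp) hV.le), hprop, hex,
          error_le_of_forall_le (hE d) hV.le hL1 hL l v hlong hs⟩
      · push Not at hex
        obtain ⟨i, j, p, q, hmem, hne⟩ := hex
        obtain ⟨x', a', hlt, htr⟩ := hcx a l v x i j p q hmem hne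
        refine (hC₃ A V x' a' _ _ hV ?_ (fun u hu => ?_)
          ((gapSize_smul_le l v hc).trans ?_) (by omega)).mono hV.le (by simp)
        · rw [det_of_smul]
          exact mul_ne_zero (pow_ne_zero _ (by positivity)) hdet
        · obtain ⟨i, hi⟩ := hA u hu
          exact ⟨i, htr i u hi⟩
        · rw [mul_assoc]
          gcongr
    · exact (hC₂ A V x a l v hV hdet (fun i => hL1.trans (hlong i)) hA hs hprop).mono hV.le (by simp)
  · push Not at hlong
    obtain ⟨p, hp⟩ := hlong
    rcases d with _ | d₁
    · exact p.elim0
    · obtain ⟨x', hx'⟩ := exists_cover_drop_direction x a l v hA p hp.le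
      exact (hC₁ d₁ rfl A V x' _ _ v hV hdet hx' ((gapSize_succAbove_le l v p).trans hs)).mono hV.le
        (by simp)

/-- Translates of a box are sums of a progression and a parallelotope. -/
lemma exists_gap_parallelotope {k d : ℕ} (a : Fin d → Fin k → ℝ) (l : Fin d → ℕ)
    (v : Fin k → Fin k → ℝ) : ∃ P Q : Set (Fin k → ℝ), IsGAPR k d P ∧ IsParallelotope k Q ∧
      (∀ x, {x} + P + Q = {u | u - x ∈ gapBox a l v}) ∧
      (P.ncard : ℝ≥0∞) * volume Q ≤ ENNReal.ofReal (2 ^ k * gapSize l v) := by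
  classical
  refine ⟨_, _, ⟨a, fun i => 2 * l i + 1, fun i => Nat.le_add_left _ _, rfl⟩,
    ⟨-∑ i, (l i + 1 : ℝ) • a i - ∑ j, v j, fun j => (2 : ℝ) • v j, rfl⟩, fun x => ?_, ?_⟩
  · ext u
    constructor
    · rintro ⟨_, ⟨_, rfl, _, ⟨n, hn, rfl⟩, rfl⟩, _, ⟨t, ht, rfl⟩, rfl⟩
      refine ⟨fun i => n i - (l i + 1), fun j => 2 * t j - 1, fun i => ?_, fun j => ?_, ?_⟩
      · have h : 1 ≤ n i ∧ n i ≤ 2 * l i + 1 := hn i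
        exact abs_le.2 ⟨by dsimp only; omega, by dsimp only; omega⟩
      · have h0 := ht.1 j
        have h1 := ht.2 j
        simp only [Pi.zero_apply, Pi.one_apply] at h0 h1
        rw [abs_le]
        constructor <;> linarith
      · push_cast
        simp only [sub_smul, Finset.sum_sub_distrib, one_smul, smul_smul, mul_comm (2 : ℝ)]
        abel
    · rintro ⟨n, t, hn, ht, hu⟩
      have hn' : ∀ i, ((n i + l i + 1).toNat : ℤ) = n i + l i + 1 := fun i => by
        have := abs_le.1 (hn i)
        omega
      refine ⟨_, ⟨x, rfl, _, ⟨fun i => (n i + l i + 1).toNat, fun i => ?_, rfl⟩, rfl⟩, _,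
        ⟨fun j => (t j + 1) / 2, ⟨fun j => ?_, fun j => ?_⟩, rfl⟩, ?_⟩
      · have := abs_le.1 (hn i)
        have := hn' i
        exact ⟨by dsimp only; omega, by dsimp only; omega⟩
      · have := abs_le.1 (ht j)
        simp only [Pi.zero_apply]
        linarith
      · have := abs_le.1 (ht j)
        simp only [Pi.one_apply]
        linarith
      · have hcast : ∀ i, (((n i + l i + 1).toNat : ℕ) : ℝ) = n i + (l i + 1) := fun i => by
          rw [← add_assoc]
          exact_mod_cast hn' i
        have hu' : u = x + (∑ i, (n i : ℝ) • a i + ∑ j, t j • v j) := by rw [← hu]; abel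
        simp only [hcast, add_smul (_ : ℝ) (_ + 1 : ℝ), Finset.sum_add_distrib, smul_smul,
          div_mul_cancel₀ _ (two_ne_zero' ℝ), add_smul _ (1 : ℝ), one_smul, hu']
        abel
  · have hP : ((fun n : Fin d → ℕ => ∑ i, (n i : ℝ) • a i) ''
        {n | ∀ i, 1 ≤ n i ∧ n i ≤ 2 * l i + 1}).ncard ≤ ∏ i, (2 * l i + 1) := by
      have hset : {n : Fin d → ℕ | ∀ i, 1 ≤ n i ∧ n i ≤ 2 * l i + 1} =
          (Fintype.piFinset fun i => Finset.Icc 1 (2 * l i + 1) : Finset (Fin d → ℕ)) := by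
        ext n
        simp only [Finset.mem_coe, Fintype.mem_piFinset, Finset.mem_Icc, mem_ofPred_eq]
      rw [hset]
      refine (Set.ncard_image_le (Finset.finite_toSet _)).trans ?_
      rw [Set.ncard_coe_finset, Fintype.card_piFinset]
      simp
    have hQ := volume_image_add_sum_smul (-∑ i, (l i + 1 : ℝ) • a i - ∑ j, v j)
      (fun j => (2 : ℝ) • v j) (Set.Icc 0 1)
    rw [hQ, det_of_smul]
    have h1 : volume (Set.Icc (0 : Fin k → ℝ) 1) = 1 := by simp [Real.volume_Icc_pi]
    rw [h1, mul_one, ← ENNReal.ofReal_natCast, ← ENNReal.ofReal_mul (by positivity)]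
    refine ENNReal.ofReal_le_ofReal ?_
    rw [abs_mul, abs_of_nonneg (by positivity : (0 : ℝ) ≤ 2 ^ k), gapSize]
    have : (((fun n : Fin d → ℕ => ∑ i, (n i : ℝ) • a i) ''
        {n | ∀ i, 1 ≤ n i ∧ n i ≤ 2 * l i + 1}).ncard : ℝ) ≤ ∏ i, (2 * l i + 1 : ℝ) := by
      exact_mod_cast hP
    calc _ ≤ (∏ i, (2 * l i + 1 : ℝ)) * (2 ^ k * |(Matrix.of v).det|) := by gcongr
      _ = _ := by ring

lemma add_mem_gapBox_two {k d : ℕ} {a : Fin d → Fin k → ℝ} {l : Fin d → ℕ}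
    {v : Fin k → Fin k → ℝ} {x y : Fin k → ℝ} (hx : x ∈ gapBox a l v) (hy : y ∈ gapBox a l v) :
    x + y ∈ gapBox a (fun i => 2 * l i) fun j => (2 : ℝ) • v j := by
  have hneg : -y ∈ gapBox a l v := by
    obtain ⟨n, t, hn, ht, rfl⟩ := hy
    refine ⟨-n, -t, fun i => by simpa using hn i, fun j => by simpa using ht j, ?_⟩
    simp only [Pi.neg_apply, Int.cast_neg, neg_smul, Finset.sum_neg_distrib]
    abel
  simpa using sub_mem_gapBox_two hx hneg

lemma sub_mem_gapBox_four {k d : ℕ} {a : Fin d → Fin k → ℝ} {l : Fin d → ℕ}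
    {v : Fin k → Fin k → ℝ} {x y : Fin k → ℝ}
    (hx : x ∈ gapBox a (fun i => 2 * l i) fun j => (2 : ℝ) • v j)
    (hy : y ∈ gapBox a (fun i => 2 * l i) fun j => (2 : ℝ) • v j) :
    x - y ∈ gapBox a (fun i => 4 * l i) fun j => (4 : ℝ) • v j := by
  have h := sub_mem_gapBox_two hx hy
  have h1 : (fun i => 2 * (2 * l i)) = fun i => 4 * l i := funext fun i => by ring
  have h2 : (fun j => (2 : ℝ) • (2 : ℝ) • v j) = fun j => (4 : ℝ) • v j := funext fun j => by
    rw [smul_smul]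
    norm_num
  rwa [h1, h2] at h

lemma measurableSet_sub_mem_gapBox {k d : ℕ} (a : Fin d → Fin k → ℝ) (l : Fin d → ℕ)
    (v : Fin k → Fin k → ℝ) (x : Fin k → ℝ) : MeasurableSet {u | u - x ∈ gapBox a l v} :=
  (isCompact_gapBox a l v).measurableSet.preimage (measurable_id.sub_const x)

/-- The doubled pieces of an exact cover are separated by disjoint boxes. -/
lemma sum_volume_add_self_le {k d : ℕ} {a : Fin d → Fin k → ℝ} {l : Fin d → ℕ}
    {v : Fin k → Fin k → ℝ} (A : Set (Fin k → ℝ)) (X : Finset (Fin k → ℝ))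
    (hX : ∀ x ∈ X, ∀ y ∈ X, ∀ z ∈ X, ∀ w ∈ X,
      x + y - z - w ∈ gapBox a (fun i => 4 * l i) (fun j => (4 : ℝ) • v j) → x + y = z + w) :
    ∑ x ∈ X, volume ((A ∩ {u | u - x ∈ gapBox a l v}) + (A ∩ {u | u - x ∈ gapBox a l v})) ≤
      volume (A + A) := by
  obtain ⟨T, hT⟩ : ∃ T : (Fin k → ℝ) → Set (Fin k → ℝ), ∀ x, T x =
      {u | u - (x + x) ∈ gapBox a (fun i => 2 * l i) fun j => (2 : ℝ) • v j} := ⟨_, fun _ => rfl⟩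
  have hTm : ∀ x, MeasurableSet (T x) := fun x => by
    rw [hT]
    exact measurableSet_sub_mem_gapBox _ _ _ _
  have hdisj : (X : Set (Fin k → ℝ)).PairwiseDisjoint T := by
    intro x hx y hy hxy
    refine Set.disjoint_left.2 fun u hux huy => hxy ?_
    rw [hT] at hux huy
    have h := sub_mem_gapBox_four huy hux
    have h' : x + x = y + y := hX x hx x hx y hy y hy (by convert h using 1; abel)
    rw [← two_smul ℝ x, ← two_smul ℝ y] at h'
    exact smul_right_injective _ (two_ne_zero' ℝ) h'
  calc ∑ x ∈ X, volume ((A ∩ {u | u - x ∈ gapBox a l v}) + (A ∩ {u | u - x ∈ gapBox a l v}))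
      ≤ ∑ x ∈ X, volume.restrict (A + A) (T x) := by
        refine Finset.sum_le_sum fun x _ => ?_
        rw [Measure.restrict_apply (hTm x)]
        refine measure_mono ?_
        rintro _ ⟨u, ⟨huA, hu⟩, w, ⟨hwA, hw⟩, rfl⟩
        refine ⟨?_, Set.add_mem_add huA hwA⟩
        show u + w ∈ T x
        rw [hT, mem_ofPred_eq, add_sub_add_comm]
        exact add_mem_gapBox_two hu hw
    _ = volume.restrict (A + A) (⋃ x ∈ X, T x) :=
        (measure_biUnion_finset hdisj fun x _ => hTm x).symm
    _ ≤ volume.restrict (A + A) univ := measure_mono (subset_univ _)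
    _ = volume (A + A) := Measure.restrict_apply_univ _

lemma exists_hasExactCover_of_volume_add_le (k K : ℕ) (E : ℕ → ℝ) (hE : ∀ d, 0 ≤ E d) (η : ℝ)
    (hη : 0 < η) : ∃ C : ℝ, ∀ A : Set (Fin k → ℝ), MeasurableSet A → 0 < volume A →
      volume A ≠ ⊤ → volume (A + A) ≤ K * volume A →
      HasExactCover E η C (volume A).toReal A := by
  obtain ⟨D, M, B, h⟩ := exists_cover_of_volume_add_le k K
  choose C hC using fun d m => exists_hasExactCover k E hE η hη d m B
  refine ⟨∑ d ∈ Finset.range (D + 1), ∑ m ∈ Finset.range (M + 1), |C d m|,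
    fun A hA hpos hfin hK => ?_⟩
  obtain ⟨d, X, a, l, v, hd, hM, hdet, hcov, hs⟩ := h A hA hpos hfin hK
  refine (hC d X.card A (volume A).toReal (fun i => X.equivFin.symm i) a l v
    (ENNReal.toReal_pos hpos.ne' hfin) hdet (fun u hu => ?_) hs).mono ENNReal.toReal_nonneg ?_
  · obtain ⟨x, hx, hux⟩ := hcov u hu
    exact ⟨X.equivFin ⟨x, hx⟩, by simpa using hux⟩
  · calc C d X.card ≤ |C d X.card| := le_abs_self _
      _ ≤ ∑ m ∈ Finset.range (M + 1), |C d m| :=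
          Finset.single_le_sum (f := fun m => |C d m|) (fun _ _ => abs_nonneg _)
            (Finset.mem_range.2 (by omega))
      _ ≤ _ := Finset.single_le_sum (f := fun d => ∑ m ∈ Finset.range (M + 1), |C d m|)
            (fun _ _ => Finset.sum_nonneg fun _ _ => abs_nonneg _) (Finset.mem_range.2 (by omega))

/-- In an exact cover whose pieces nearly satisfy the Brunn–Minkowski inequality in dimension `n`,
the doubling constant is nearly at least `2 ^ n`. -/
lemma two_pow_mul_volume_le {k d n : ℕ} (hn : 0 < n) {a : Fin d → Fin k → ℝ} {l : Fin d → ℕ}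
    {v : Fin k → Fin k → ℝ} {A : Set (Fin k → ℝ)} {X : Finset (Fin k → ℝ)} {δ : ℝ}
    (hX : ∀ x ∈ X, ∀ y ∈ X, ∀ z ∈ X, ∀ w ∈ X,
      x + y - z - w ∈ gapBox a (fun i => 4 * l i) (fun j => (4 : ℝ) • v j) → x + y = z + w)
    (hA : ∀ u ∈ A, ∃ x ∈ X, u - x ∈ gapBox a l v) (hfin : volume A ≠ ⊤)
    (hfin2 : volume (A + A) ≠ ⊤)
    (hbm : ∀ x ∈ X, bmSum n (volume (A ∩ {u | u - x ∈ gapBox a l v})).toReal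
      (volume (A ∩ {u | u - x ∈ gapBox a l v})).toReal ≤
      (volume ((A ∩ {u | u - x ∈ gapBox a l v}) + (A ∩ {u | u - x ∈ gapBox a l v}))).toReal + δ) :
    2 ^ n * (volume A).toReal ≤ (volume (A + A)).toReal + X.card * δ := by
  obtain ⟨S, hS⟩ : ∃ S : (Fin k → ℝ) → Set (Fin k → ℝ),
      S = fun x => A ∩ {u | u - x ∈ gapBox a l v} := ⟨_, rfl⟩
  have hSA : ∀ x, S x ⊆ A := fun x => by rw [hS]; exact inter_subset_left
  have hbm' : ∀ x ∈ X, 2 ^ n * (volume (S x)).toReal ≤ (volume (S x + S x)).toReal + δ :=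
    fun x hx => by
      rw [← bmSum_self hn ENNReal.toReal_nonneg, hS]
      exact hbm x hx
  have hSfin : ∀ x ∈ X, volume (S x) ≠ ⊤ := fun x _ => measure_ne_top_of_subset (hSA x) hfin
  have hSSfin : ∀ x ∈ X, volume (S x + S x) ≠ ⊤ := fun x _ =>
    measure_ne_top_of_subset (Set.add_subset_add (hSA x) (hSA x)) hfin2
  have h1 : (volume A).toReal ≤ ∑ x ∈ X, (volume (S x)).toReal := by
    rw [← ENNReal.toReal_sum hSfin]
    refine ENNReal.toReal_mono (ENNReal.sum_ne_top.2 hSfin)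
      ((measure_mono fun u hu => ?_).trans (measure_biUnion_finset_le X S))
    obtain ⟨x, hx, hux⟩ := hA u hu
    rw [hS]
    exact Set.mem_biUnion hx ⟨hu, hux⟩
  have h2 : ∑ x ∈ X, (volume (S x + S x)).toReal ≤ (volume (A + A)).toReal := by
    rw [← ENNReal.toReal_sum hSSfin]
    refine ENNReal.toReal_mono hfin2 ?_
    rw [hS]
    exact sum_volume_add_self_le A X hX
  calc 2 ^ n * (volume A).toReal ≤ 2 ^ n * ∑ x ∈ X, (volume (S x)).toReal := by gcongr
    _ = ∑ x ∈ X, 2 ^ n * (volume (S x)).toReal := Finset.mul_sum _ _ _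
    _ ≤ ∑ x ∈ X, ((volume (S x + S x)).toReal + δ) := Finset.sum_le_sum hbm'
    _ = ∑ x ∈ X, (volume (S x + S x)).toReal + X.card * δ := by
        rw [Finset.sum_add_distrib, Finset.sum_const, nsmul_eq_mul]
    _ ≤ _ := by gcongr

theorem stmt_11 (k d : ℕ) (hk : 1 ≤ k) (η ε : ℝ) (hη : 0 < η) (hε : 0 < ε) :
    ∃ C : ℝ, 0 < C ∧
      ∀ A : Set (Fin k → ℝ), MeasurableSet A → 0 < volume A → volume A < ⊤ →
        volume (A + A) ≤ ENNReal.ofReal (2 ^ (k + d + 1) - ε) * volume A →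
        ∃ (d' : ℕ) (X P Q : Set (Fin k → ℝ)), d' ≤ d ∧ X.Finite ∧ X.Nonempty ∧
          IsGAPR k d' P ∧ IsParallelotope k Q ∧ A ⊆ X + P + Q ∧
          (X.ncard : ℝ) ≤ C ∧
          (P.ncard : ℝ≥0∞) * volume Q ≤ ENNReal.ofReal C * volume A ∧
          (∀ x ∈ X, ∀ y ∈ X,
            ((volume (A ∩ ({x} + P + Q))).toReal ^ (((k + d' : ℕ) : ℝ))⁻¹ +
                  (volume (A ∩ ({y} + P + Q))).toReal ^ (((k + d' : ℕ) : ℝ))⁻¹) ^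
                  ((k + d' : ℕ) : ℝ) -
                η * ((X.ncard : ℝ) ^ 2)⁻¹ * (volume A).toReal ≤
              (volume (A ∩ ({x} + P + Q) + A ∩ ({y} + P + Q))).toReal) ∧
          (∀ x ∈ X, ∀ y ∈ X, ∀ z ∈ X, ∀ w ∈ X,
            ((A ∩ ({x} + P + Q) + A ∩ ({y} + P + Q)) ∩
                (A ∩ ({z} + P + Q) + A ∩ ({w} + P + Q))).Nonempty →
              x + y = z + w) := by
  classical
  choose E hE hbm using fun d => bmSum_volume_le k d hk
  obtain ⟨η₀, hη₀, hη₀η, hη₀ε, hη₀1⟩ : ∃ η₀ : ℝ, 0 < η₀ ∧ η₀ ≤ η ∧ η₀ < ε ∧ η₀ < 1 :=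
    ⟨min η (min (ε / 2) (1 / 2)), by positivity, min_le_left _ _,
      ((min_le_right _ _).trans (min_le_left _ _)).trans_lt (by linarith),
      ((min_le_right _ _).trans (min_le_right _ _)).trans_lt (by norm_num)⟩
  obtain ⟨C, hC⟩ := exists_hasExactCover_of_volume_add_le k (2 ^ (k + d + 1)) E hE η₀ hη₀
  refine ⟨2 ^ k * max C 1, by positivity, fun A hA hpos hfin hAA => ?_⟩
  have hfin' := hfin.ne
  obtain ⟨V, hV⟩ : ∃ V, V = (volume A).toReal := ⟨_, rfl⟩
  have hVpos : 0 < V := by rw [hV]; exact ENNReal.toReal_pos hpos.ne' hfin'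
  have hAAfin : volume (A + A) ≠ ⊤ :=
    (hAA.trans_lt (ENNReal.mul_lt_top ENNReal.ofReal_lt_top hfin)).ne
  obtain ⟨d', m, x, a, l, v, hm, hdet, hcov, hs, hprop, hex, herr⟩ := hC A hA hpos hfin' <| by
    refine hAA.trans (mul_le_mul_left (ENNReal.ofReal_le_of_le_toReal ?_) _)
    simp [hε.le]
  rw [← hV] at hs herr
  obtain ⟨X, hX⟩ : ∃ X : Finset (Fin k → ℝ), ∀ y, y ∈ X ↔
      (∃ i, x i = y) ∧ (A ∩ {u | u - y ∈ gapBox a l v}).Nonempty :=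
    ⟨(Finset.univ.image x).filter fun y => (A ∩ {u | u - y ∈ gapBox a l v}).Nonempty,
      fun y => by simp⟩
  have hXm : X.card ≤ m := by
    calc X.card ≤ (Finset.univ.image x).card :=
          Finset.card_le_card fun y hy => by simpa using ((hX y).1 hy).1
      _ ≤ (Finset.univ : Finset (Fin m)).card := Finset.card_image_le
      _ = m := by simp
  have hcovX : ∀ u ∈ A, ∃ y ∈ X, u - y ∈ gapBox a l v := fun u hu => by
    obtain ⟨i, hi⟩ := hcov u hu
    exact ⟨x i, (hX _).2 ⟨⟨i, rfl⟩, u, hu, hi⟩, hi⟩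
  have hexX : ∀ y ∈ X, ∀ y' ∈ X, ∀ z ∈ X, ∀ w ∈ X, y + y' - z - w ∈
      gapBox a (fun i => 4 * l i) (fun j => (4 : ℝ) • v j) → y + y' = z + w := by
    intro y hy y' hy' z hz w hw h
    obtain ⟨i, rfl⟩ := ((hX y).1 hy).1
    obtain ⟨j, rfl⟩ := ((hX y').1 hy').1
    obtain ⟨p, rfl⟩ := ((hX z).1 hz).1
    obtain ⟨q, rfl⟩ := ((hX w).1 hw).1
    exact hex i j p q h
  obtain ⟨δ, hδ⟩ : ∃ δ : ℝ, δ = E d' * (gapSize l v * ∑ i, (2 * l i + 1 : ℝ)⁻¹) := ⟨_, rfl⟩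
  have hδ0 : 0 ≤ δ := by
    rw [hδ]
    exact mul_nonneg (hE _) (mul_nonneg (gapSize_nonneg _ _)
      (Finset.sum_nonneg fun _ _ => by positivity))
  have hδV : (X.card : ℝ) ^ 2 * δ ≤ η₀ * V := by
    rw [← hδ] at herr
    refine le_trans ?_ herr
    gcongr
  have hbmX : ∀ y ∈ X, ∀ z ∈ X, bmSum (k + d') (volume (A ∩ {u | u - y ∈ gapBox a l v})).toReal
      (volume (A ∩ {u | u - z ∈ gapBox a l v})).toReal ≤
      (volume ((A ∩ {u | u - y ∈ gapBox a l v}) + (A ∩ {u | u - z ∈ gapBox a l v}))).toReal + δ := by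
    intro y hy z hz
    rw [hδ, gapSize]
    exact hbm d' a l v hdet hprop y z _ _ (hA.inter (measurableSet_sub_mem_gapBox _ _ _ _))
      (hA.inter (measurableSet_sub_mem_gapBox _ _ _ _)) ((hX y).1 hy).2 ((hX z).1 hz).2
      (fun u hu => hu.2) (fun u hu => hu.2)
  have hXne : X.Nonempty := by
    obtain ⟨u, hu⟩ := nonempty_of_measure_ne_zero hpos.ne'
    obtain ⟨y, hy, -⟩ := hcovX u hu
    exact ⟨y, hy⟩
  have hcard : (1 : ℝ) ≤ X.card := by exact_mod_cast hXne.card_pos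
  have hd' : d' ≤ d := by
    by_contra hlt
    have hlow := two_pow_mul_volume_le (n := k + d') (by omega) hexX hcovX hfin' hAAfin
      fun y hy => hbmX y hy y hy
    rw [← hV] at hlow
    have hup : (volume (A + A)).toReal ≤ max (2 ^ (k + d + 1) - ε) 0 * V := by
      have := ENNReal.toReal_mono (ENNReal.mul_ne_top ENNReal.ofReal_ne_top hfin') hAA
      rwa [ENNReal.toReal_mul, ENNReal.toReal_ofReal', ← hV] at this
    have hδ1 : (X.card : ℝ) * δ ≤ η₀ * V := by
      refine le_trans ?_ hδV
      gcongr
      exact le_self_pow₀ hcard two_ne_zero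
    have hpow : (2 : ℝ) ^ (k + d + 1) ≤ 2 ^ (k + d') := pow_le_pow_right₀ one_le_two (by omega)
    have hone : (1 : ℝ) ≤ 2 ^ (k + d') := one_le_pow₀ one_le_two
    have : 2 ^ (k + d') * V ≤ (max (2 ^ (k + d + 1) - ε) 0 + η₀) * V := by linarith
    have hle := le_of_mul_le_mul_right this hVpos
    rcases max_cases ((2 : ℝ) ^ (k + d + 1) - ε) 0 with h | h <;> linarith [h.1]
  obtain ⟨P, Q, hP, hQ, hPQ, hvol⟩ := exists_gap_parallelotope a l v
  refine ⟨d', X, P, Q, hd', X.finite_toSet, hXne, hP, hQ, fun u hu => ?_, ?_, hvol.trans ?_, ?_, ?_⟩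
  · obtain ⟨y, hy, huy⟩ := hcovX u hu
    have : u ∈ {y} + P + Q := by rw [hPQ]; exact huy
    exact Set.add_subset_add_right (Set.add_subset_add_right (by simpa using hy)) this
  · rw [Set.ncard_coe_finset]
    have h1 : (X.card : ℝ) ≤ m := by exact_mod_cast hXm
    have h2 : (1 : ℝ) ≤ 2 ^ k := one_le_pow₀ one_le_two
    have h3 := le_max_left C 1
    have h4 := le_max_right C 1
    nlinarith
  · rw [← ENNReal.ofReal_toReal hfin', ← ENNReal.ofReal_mul (by positivity), ← hV, mul_assoc]
    refine ENNReal.ofReal_le_ofReal ?_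
    gcongr
    exact hs.trans (mul_le_mul_of_nonneg_right (le_max_left _ _) hVpos.le)
  · intro y hy z hz
    have h := hbmX y hy z hz
    rw [bmSum] at h
    rw [hPQ, hPQ, Set.ncard_coe_finset, ← hV]
    have h1 : δ ≤ η * ((X.card : ℝ) ^ 2)⁻¹ * V := by
      rw [mul_right_comm, ← div_eq_mul_inv, le_div_iff₀ (by positivity), mul_comm]
      exact hδV.trans (by gcongr)
    linarith
  · intro y hy z hz y' hy' z' hz' hne
    simp only [hPQ] at hne
    obtain ⟨_, ⟨s, ⟨-, hs⟩, t, ⟨-, ht⟩, rfl⟩, s', ⟨-, hs'⟩, t', ⟨-, ht'⟩, heq⟩ := hne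
    refine hexX y hy z hz y' hy' z' hz' ?_
    have h := sub_mem_gapBox_four (add_mem_gapBox_two hs' ht') (add_mem_gapBox_two hs ht)
    convert h using 1
    have heq' : s' + t' = s + t := heq
    have : s' - y' + (t' - z') - (s - y + (t - z)) = (s' + t') - (s + t) + (y + z - y' - z') := by
      abel
    rw [this, heq', sub_self, zero_add]
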